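/- arXiv:2404.09926 — 8 statements merged into one kernel-verified Lean document; each statement's English description precedes it below -/
import Mathlib

section
/- Let 0 ≤ α < 1 and set q_α = 2^{-2α-1}(1-α)² / (2α + 2^{-2α-1}(1-α)²). Then for every continuously differentiable compactly supported function φ : ℝ² → ℂ one has ∫_{ℝ²} (1+|x|)^{2α} |(∂₁ + i∂₂)φ(x)|² dx ≥ q_α ∫_{ℝ²} (1+|x|)^{2α} |∇φ(x)|² dx. -/
open MeasureTheory Real

/-- The alternating form `Re (a * conj (I * b))`. -/
noncomputable def crossForm (a b : ℂ) : ℝ := a.im * b.re - a.re * b.im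

lemma crossForm_continuous {X : Type*} [TopologicalSpace X] {f g : X → ℂ} (hf : Continuous f)
    (hg : Continuous g) : Continuous fun x => crossForm (f x) (g x) := by
  unfold crossForm
  exact ((Complex.continuous_im.comp hf).mul (Complex.continuous_re.comp hg)).sub
    ((Complex.continuous_re.comp hf).mul (Complex.continuous_im.comp hg))

lemma memLp_two_of_continuous {f : ℝ → ℂ} (hf : Continuous f) (a b : ℝ) :
    MemLp f 2 (volume.restrict (Set.Ioc a b)) := by
  obtain ⟨C, hC⟩ := (isCompact_Icc (a := a) (b := b)).exists_bound_of_continuousOn hf.continuousOn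
  have h : MemLp f 2 (volume.restrict (Set.Icc a b)) :=
    MemLp.of_bound hf.aestronglyMeasurable C
      ((ae_restrict_iff' measurableSet_Icc).2 (ae_of_all _ hC))
  exact h.mono_measure (Measure.restrict_mono Set.Ioc_subset_Icc_self le_rfl)

lemma circle_ineq {f f' : ℝ → ℂ} (hf : ∀ x, HasDerivAt f (f' x) x) (hf' : Continuous f')
    (hper : f (-π) = f π) :
    0 ≤ ∫ t in (-π)..π, (‖f' t‖ ^ 2 - crossForm (f t) (f' t)) := by
  have hfc : Continuous f := continuous_iff_continuousAt.2 fun x => (hf x).continuousAt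
  have hab : -π < π := by linarith [pi_pos]
  set g : ℝ → ℂ := fun t => f' t + (Complex.I / 2) * f t with hg
  have hgc : Continuous g := by fun_prop
  have hcoef : ∀ n : ℤ, fourierCoeffOn hab g n
      = Complex.I * (n + 1 / 2) * fourierCoeffOn hab f n := by
    intro n
    have h1 : fourierCoeffOn hab f' n = Complex.I * n * fourierCoeffOn hab f n := by
      by_cases hn : n = 0
      · subst hn
        rw [fourierCoeffOn_eq_integral]
        have : ∫ x in (-π)..π, f' x = 0 := by
          rw [intervalIntegral.integral_eq_sub_of_hasDerivAt (fun x _ => hf x)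
            (hf'.intervalIntegrable _ _), hper, sub_self]
        simp [this]
      · rw [fourierCoeffOn_of_hasDerivAt hab hn (fun x _ => hf x) (hf'.intervalIntegrable _ _),
          hper, sub_self]
        have : (n : ℂ) ≠ 0 := by exact_mod_cast hn
        have hpi : (π : ℂ) ≠ 0 := by exact_mod_cast pi_ne_zero
        push_cast
        field_simp
        ring
    have h2 : fourierCoeffOn hab g n = fourierCoeffOn hab f' n +
        (Complex.I / 2) * fourierCoeffOn hab f n := by
      rw [← fourierCoeffOn.const_mul, fourierCoeffOn_eq_integral, fourierCoeffOn_eq_integral,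
        fourierCoeffOn_eq_integral, ← smul_add, ← intervalIntegral.integral_add]
      · simp only [hg, smul_add]
      · apply Continuous.intervalIntegrable
        fun_prop
      · apply Continuous.intervalIntegrable
        fun_prop
    rw [h2, h1]; ring
  have p1 := hasSum_sq_fourierCoeffOn hab (memLp_two_of_continuous hfc _ _)
  have p2 := hasSum_sq_fourierCoeffOn hab (memLp_two_of_continuous hgc _ _)
  have p3 := hasSum_le (fun n : ℤ => ?_) (p1.mul_left (1 / 4)) p2
  · have hp : (0 : ℝ) < (π - -π)⁻¹ := by
      apply inv_pos.2; linarith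
    simp only [smul_eq_mul] at p3
    have p4 : 1 / 4 * (∫ x in (-π)..π, ‖f x‖ ^ 2) ≤ ∫ x in (-π)..π, ‖g x‖ ^ 2 := by
      by_contra hcon
      push Not at hcon
      nlinarith
    have : ∫ t in (-π)..π, (‖f' t‖ ^ 2 - crossForm (f t) (f' t))
        = (∫ x in (-π)..π, ‖g x‖ ^ 2) - ∫ x in (-π)..π, 1 / 4 * ‖f x‖ ^ 2 := by
      rw [← intervalIntegral.integral_sub]
      · congr 1
        ext t
        simp only [hg, Complex.sq_norm, Complex.normSq_apply, crossForm]
        simp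
        ring
      · apply Continuous.intervalIntegrable
        fun_prop
      · apply Continuous.intervalIntegrable
        fun_prop
    rw [this, intervalIntegral.integral_const_mul]
    linarith
  · rw [hcoef]
    have : ‖(n : ℂ) + 1 / 2‖ ^ 2 = ((n : ℝ) + 1 / 2) ^ 2 := by
      rw [Complex.sq_norm, Complex.normSq_apply]; simp; ring
    simp only [norm_mul, mul_pow, Complex.norm_I, one_mul, this]
    have h3 : (0 : ℝ) ≤ n ^ 2 + n := by
      have : (0 : ℤ) ≤ n ^ 2 + n := by
        rcases le_or_gt 0 n with h | h
        · positivity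
        · nlinarith
      exact_mod_cast this
    have h4 : (1 / 4 : ℝ) ≤ ((n : ℝ) + 1 / 2) ^ 2 := by nlinarith
    exact mul_le_mul_of_nonneg_right h4 (by positivity)

lemma crossForm_bound (a b : ℂ) : |crossForm a b| ≤ 2 * ‖a‖ * ‖b‖ := by
  unfold crossForm
  have h1 := Complex.abs_re_le_norm a
  have h2 := Complex.abs_im_le_norm a
  have h3 := Complex.abs_re_le_norm b
  have h4 := Complex.abs_im_le_norm b
  calc |a.im * b.re - a.re * b.im| ≤ |a.im * b.re| + |a.re * b.im| := abs_sub _ _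
    _ = |a.im| * |b.re| + |a.re| * |b.im| := by rw [abs_mul, abs_mul]
    _ ≤ ‖a‖ * ‖b‖ + ‖a‖ * ‖b‖ := by gcongr
    _ = _ := by ring

lemma hasDerivAt_cross {Φ A B : ℝ → ℝ → ℂ}
    (hA : ∀ r t, HasDerivAt (fun s => Φ s t) (A r t) r)
    (hB : ∀ r t, HasDerivAt (fun t => Φ r t) (B r t) t)
    (hAc : Continuous (Function.uncurry A)) (hBc : Continuous (Function.uncurry B))
    (hper : ∀ r, Φ r (-π) = Φ r π) (r : ℝ) :
    HasDerivAt (fun s => ∫ t in (-π)..π, crossForm (Φ s t) (B s t))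
      (∫ t in (-π)..π, 2 * crossForm (A r t) (B r t)) r := by
  have cB : ∀ s, Continuous (B s) := fun s => hBc.comp (by fun_prop : Continuous fun t => (s, t))
  have cΦ : ∀ s, Continuous (Φ s) := fun s =>
    continuous_iff_continuousAt.2 fun x => (hB s x).continuousAt
  have key : ∀ s, (∫ t in (-π)..π, crossForm (Φ s t) (B s t))
      - (∫ t in (-π)..π, crossForm (Φ r t) (B r t))
      = ∫ t in (-π)..π, crossForm (Φ s t - Φ r t) (B s t + B r t) := by
    intro s
    have hd : ∀ t, HasDerivAt (fun t => crossForm (Φ r t) (Φ s t))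
        (crossForm (B r t) (Φ s t) + crossForm (Φ r t) (B s t)) t := by
      intro t
      have r1 := (Complex.reCLM.hasFDerivAt.comp_hasDerivAt t (hB r t))
      have i1 := (Complex.imCLM.hasFDerivAt.comp_hasDerivAt t (hB r t))
      have r2 := (Complex.reCLM.hasFDerivAt.comp_hasDerivAt t (hB s t))
      have i2 := (Complex.imCLM.hasFDerivAt.comp_hasDerivAt t (hB s t))
      have h : HasDerivAt (fun t => crossForm (Φ r t) (Φ s t)) _ t := (i1.mul r2).sub (r1.mul i2)
      refine h.congr_deriv ?_
      simp only [crossForm, Function.comp_apply, Complex.reCLM_apply, Complex.imCLM_apply]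
      ring
    have c1 : Continuous fun t => crossForm (B r t) (Φ s t) + crossForm (Φ r t) (B s t) :=
      (crossForm_continuous (cB r) (cΦ s)).add (crossForm_continuous (cΦ r) (cB s))
    have h0 := intervalIntegral.integral_eq_sub_of_hasDerivAt (a := -π) (b := π) (fun x _ => hd x)
      (c1.intervalIntegrable _ _)
    rw [hper, hper, sub_self] at h0
    rw [← intervalIntegral.integral_sub, ← add_zero (∫ t in (-π)..π, crossForm (Φ s t - Φ r t) _),
      ← h0, ← intervalIntegral.integral_add]
    · congr 1
      ext t
      simp only [crossForm, Complex.sub_re, Complex.sub_im, Complex.add_re, Complex.add_im]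
      ring
    · exact (crossForm_continuous ((cΦ s).sub (cΦ r))
        ((cB s).add (cB r))).intervalIntegrable _ _
    · exact c1.intervalIntegrable _ _
    · exact (crossForm_continuous (cΦ s) (cB s)).intervalIntegrable _ _
    · exact (crossForm_continuous (cΦ r) (cB r)).intervalIntegrable _ _
  rw [hasDerivAt_iff_tendsto_slope]
  have hs : slope (fun s => ∫ t in (-π)..π, crossForm (Φ s t) (B s t)) r = fun s =>
      ∫ t in (-π)..π, crossForm (slope (fun s => Φ s t) r s) (B s t + B r t) := by
    ext s
    rw [slope_def_module, key, smul_eq_mul, ← intervalIntegral.integral_const_mul]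
    congr 1
    ext t
    rw [slope_def_module]
    simp only [crossForm, Complex.smul_re, Complex.smul_im, smul_eq_mul, Complex.sub_re,
      Complex.sub_im]
    ring
  rw [hs]
  have hK : IsCompact (Set.Icc (r - 1) (r + 1) ×ˢ Set.Icc (-π) π) :=
    isCompact_Icc.prod isCompact_Icc
  obtain ⟨M, hM⟩ := hK.exists_bound_of_continuousOn hAc.continuousOn
  obtain ⟨N, hN⟩ := hK.exists_bound_of_continuousOn hBc.continuousOn
  have hnear : ∀ᶠ s in nhdsWithin r {r}ᶜ, s ∈ Set.Icc (r - 1) (r + 1) :=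
    nhdsWithin_le_nhds (Icc_mem_nhds (by linarith) (by linarith))
  have hr : r ∈ Set.Icc (r - 1) (r + 1) := ⟨by linarith, by linarith⟩
  apply intervalIntegral.tendsto_integral_filter_of_dominated_convergence (fun _ => 2 * M * (N + N))
  · refine Filter.Eventually.of_forall fun s => Continuous.aestronglyMeasurable ?_
    refine crossForm_continuous ?_ ((cB s).add (cB r))
    simp only [slope_def_module]
    exact ((cΦ s).sub (cΦ r)).const_smul _
  · filter_upwards [hnear, self_mem_nhdsWithin] with s hs hne
    refine ae_of_all _ fun t ht => ?_
    rw [Set.uIoc_of_le (by linarith [pi_pos])] at ht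
    have ht' : t ∈ Set.Icc (-π) π := Set.Ioc_subset_Icc_self ht
    rw [Real.norm_eq_abs]
    refine (crossForm_bound _ _).trans ?_
    have b1 : ‖B s t‖ ≤ N := hN (s, t) ⟨hs, ht'⟩
    have b2 : ‖B r t‖ ≤ N := hN (r, t) ⟨hr, ht'⟩
    have b3 : ‖slope (fun s => Φ s t) r s‖ ≤ M := by
      have := (convex_Icc (r - 1) (r + 1)).norm_image_sub_le_of_norm_hasDerivWithin_le
        (f := fun s => Φ s t) (f' := fun s => A s t) (C := M)
        (fun x _ => (hA x t).hasDerivWithinAt) (fun x hx => hM (x, t) ⟨hx, ht'⟩) hr hs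
      rw [slope_def_module, norm_smul, norm_inv]
      have hpos : 0 < ‖s - r‖ := norm_pos_iff.2 (sub_ne_zero.2 hne)
      rw [inv_mul_le_iff₀ hpos, mul_comm]
      exact this
    have b4 : 0 ≤ M := (norm_nonneg _).trans b3
    gcongr
    exact (norm_add_le _ _).trans (add_le_add b1 b2)
  · exact intervalIntegrable_const
  · refine ae_of_all _ fun t _ => ?_
    have t1 := (hasDerivAt_iff_tendsto_slope.1 (hA r t))
    have t2 : Filter.Tendsto (fun s => B s t + B r t) (nhdsWithin r {r}ᶜ) (nhds (B r t + B r t)) := by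
      have : Continuous fun s => B s t + B r t :=
        (hBc.comp (by fun_prop : Continuous fun s => (s, t))).add continuous_const
      exact (this.tendsto r).mono_left nhdsWithin_le_nhds
    have c : Continuous fun p : ℂ × ℂ => crossForm p.1 p.2 :=
      crossForm_continuous continuous_fst continuous_snd
    have := (c.tendsto (A r t, B r t + B r t)).comp (t1.prodMk_nhds t2)
    have e : 2 * crossForm (A r t) (B r t) = crossForm (A r t) (B r t + B r t) := by
      simp only [crossForm, Complex.add_re, Complex.add_im]
      ring
    rw [e]
    exact this

lemma radial_ineq {Φ A β : ℝ → ℝ → ℂ}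
    (hA : ∀ r t, HasDerivAt (fun s => Φ s t) (A r t) r)
    (hB : ∀ r t, HasDerivAt (fun t => Φ r t) (r * β r t) t)
    (hAc : Continuous (Function.uncurry A)) (hβc : Continuous (Function.uncurry β))
    (hper : ∀ r, Φ r (-π) = Φ r π) {R : ℝ} (hR : 0 < R) (hΦR : ∀ t, Φ R t = 0)
    {α p : ℝ} (hα0 : 0 ≤ α) (hα1 : α < 1) (hp0 : 0 ≤ p) (hp1 : p ≤ 1)
    (hp : 2 * α ≤ p * (1 + α ^ 2)) :
    0 ≤ ∫ r in (0 : ℝ)..R, ∫ t in (-π)..π, r * ((1 + r) ^ (2 * α) *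
      (‖A r t + Complex.I * β r t‖ ^ 2 - (1 - p) * (‖A r t‖ ^ 2 + ‖β r t‖ ^ 2))) := by
  have hpp : -π ≤ π := by linarith [pi_pos]
  set κ : ℝ := 1 - p * α with hκ
  have hκ0 : 0 ≤ κ := by nlinarith
  have hBc : Continuous (Function.uncurry fun (r t : ℝ) => (r : ℂ) * β r t) := by
    have : Continuous fun x : ℝ × ℝ => (x.1 : ℂ) * Function.uncurry β x := by fun_prop
    exact this
  have cA : ∀ s, Continuous (A s) := fun s => hAc.comp (by fun_prop : Continuous fun t => (s, t))
  have cβ : ∀ s, Continuous (β s) := fun s => hβc.comp (by fun_prop : Continuous fun t => (s, t))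
  have cΦ : ∀ s, Continuous (Φ s) := fun s =>
    continuous_iff_continuousAt.2 fun x => (hB s x).continuousAt
  set G : ℝ → ℝ := fun s => ∫ t in (-π)..π, crossForm (Φ s t) (s * β s t) with hG
  set G' : ℝ → ℝ := fun r => ∫ t in (-π)..π, 2 * crossForm (A r t) (r * β r t) with hG'
  set T : ℝ → ℝ := fun r => ∫ t in (-π)..π, ‖β r t‖ ^ 2 with hT
  set w : ℝ → ℝ := fun r => (1 + r) ^ (2 * α) with hw
  set w' : ℝ → ℝ := fun r => (2 * α) * (1 + r) ^ (2 * α - 1) with hw'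
  have dG : ∀ r, HasDerivAt G (G' r) r := fun r => hasDerivAt_cross hA hB hAc hBc hper r
  have cG : Continuous G := continuous_iff_continuousAt.2 fun x => (dG x).continuousAt
  have cG' : Continuous G' := by
    apply intervalIntegral.continuous_parametric_intervalIntegral_of_continuous'
    exact continuous_const.mul (crossForm_continuous hAc hBc)
  have cT : Continuous T := by
    apply intervalIntegral.continuous_parametric_intervalIntegral_of_continuous'
    exact (hβc.norm.pow 2)
  have cw : Continuous w := by
    apply Continuous.rpow_const (by fun_prop)
    intro x; right; linarith
  have cw' : ContinuousOn w' (Set.uIcc 0 R) := by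
    apply ContinuousOn.mul continuousOn_const
    apply ContinuousOn.rpow_const (by fun_prop)
    intro x hx
    rw [Set.uIcc_of_le hR.le] at hx
    left; linarith [hx.1]
  have dw : ∀ x ∈ Set.uIcc 0 R, HasDerivAt w (w' x) x := by
    intro x hx
    rw [Set.uIcc_of_le hR.le] at hx
    have h1 : HasDerivAt (fun y : ℝ => 1 + y) 1 x := (hasDerivAt_id x).const_add 1
    have := h1.rpow_const (p := 2 * α) (Or.inl (by linarith [hx.1]))
    refine this.congr_deriv ?_
    simp only [hw']; ring
  have ibp := intervalIntegral.integral_mul_deriv_eq_deriv_mul dw (fun x _ => dG x)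
    cw'.intervalIntegrable (cG'.intervalIntegrable 0 R)
  have G0 : G 0 = 0 := by simp [hG, crossForm]
  have GR : G R = 0 := by simp [hG, crossForm, hΦR]
  rw [G0, GR] at ibp
  have step3 : ∀ r, G r ≤ r ^ 2 * T r := by
    intro r
    have h := circle_ineq (hB r) (continuous_const.mul (cβ r)) (hper r)
    rw [intervalIntegral.integral_sub] at h
    · have e : ∫ t in (-π)..π, ‖(r : ℂ) * β r t‖ ^ 2 = r ^ 2 * T r := by
        rw [hT, ← intervalIntegral.integral_const_mul]
        congr 1
        ext t
        rw [norm_mul, mul_pow, Complex.norm_real, Real.norm_eq_abs, sq_abs]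
      rw [e] at h
      simp only [hG]
      linarith
    · exact ((continuous_const.mul (cβ r)).norm.pow 2).intervalIntegrable _ _
    · exact (crossForm_continuous (cΦ r) (continuous_const.mul (cβ r))).intervalIntegrable _ _
  have cE : Continuous fun r => ∫ t in (-π)..π, r * ((1 + r) ^ (2 * α) *
      (‖A r t + Complex.I * β r t‖ ^ 2 - (1 - p) * (‖A r t‖ ^ 2 + ‖β r t‖ ^ 2))) := by
    apply intervalIntegral.continuous_parametric_intervalIntegral_of_continuous'
    have : Continuous fun x : ℝ × ℝ => x.1 * (w x.1 *
      (‖Function.uncurry A x + Complex.I * Function.uncurry β x‖ ^ 2 -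
        (1 - p) * (‖Function.uncurry A x‖ ^ 2 + ‖Function.uncurry β x‖ ^ 2))) := by fun_prop
    exact this
  have step1 : ∀ r ∈ Set.Icc 0 R, w r * (p * (1 - α ^ 2)) * (r * T r) + κ * (w r * G' r) ≤
      ∫ t in (-π)..π, r * ((1 + r) ^ (2 * α) *
      (‖A r t + Complex.I * β r t‖ ^ 2 - (1 - p) * (‖A r t‖ ^ 2 + ‖β r t‖ ^ 2))) := by
    intro r hr
    have hw0 : 0 ≤ w r := rpow_nonneg (by linarith [hr.1]) _
    have c1 : Continuous fun t => w r * (p * (1 - α ^ 2)) * (r * ‖β r t‖ ^ 2) :=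
      continuous_const.mul (continuous_const.mul ((cβ r).norm.pow 2))
    have c2 : Continuous fun t => κ * (w r * (2 * crossForm (A r t) (r * β r t))) :=
      continuous_const.mul (continuous_const.mul (continuous_const.mul
        (crossForm_continuous (cA r) (continuous_const.mul (cβ r)))))
    have e : w r * (p * (1 - α ^ 2)) * (r * T r) + κ * (w r * G' r) =
        ∫ t in (-π)..π, (w r * (p * (1 - α ^ 2)) * (r * ‖β r t‖ ^ 2) +
          κ * (w r * (2 * crossForm (A r t) (r * β r t)))) := by
      rw [intervalIntegral.integral_add (c1.intervalIntegrable _ _) (c2.intervalIntegrable _ _)]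
      simp only [intervalIntegral.integral_const_mul, hT, hG']
    rw [e]
    apply intervalIntegral.integral_mono_on hpp
    · exact (c1.add c2).intervalIntegrable _ _
    · apply Continuous.intervalIntegrable
      have h1 := cA r
      have h2 := cβ r
      fun_prop
    · intro t _
      have key : r * ((1 + r) ^ (2 * α) *
          (‖A r t + Complex.I * β r t‖ ^ 2 - (1 - p) * (‖A r t‖ ^ 2 + ‖β r t‖ ^ 2)))
          - (w r * (p * (1 - α ^ 2)) * (r * ‖β r t‖ ^ 2) +
          κ * (w r * (2 * crossForm (A r t) (r * β r t))))
          = r * w r * p * (((A r t).re - α * (β r t).im) ^ 2 + ((A r t).im + α * (β r t).re) ^ 2) := by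
        simp only [Complex.sq_norm, Complex.normSq_apply, crossForm, hw, hκ, Complex.add_re,
          Complex.add_im, Complex.mul_re, Complex.mul_im, Complex.I_re, Complex.I_im,
          Complex.ofReal_re, Complex.ofReal_im]
        ring
      have : 0 ≤ r * w r * p * (((A r t).re - α * (β r t).im) ^ 2 +
          ((A r t).im + α * (β r t).re) ^ 2) := by
        have := hr.1
        positivity
      linarith
  have cL : Continuous fun r => w r * (p * (1 - α ^ 2)) * (r * T r) := by fun_prop
  have cM : Continuous fun r => κ * (w r * G' r) := by fun_prop
  have h1 : ∫ r in (0 : ℝ)..R, (w r * (p * (1 - α ^ 2)) * (r * T r) + κ * (w r * G' r)) ≤ _ :=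
    intervalIntegral.integral_mono_on hR.le ((cL.add cM).intervalIntegrable _ _)
      (cE.intervalIntegrable 0 R) step1
  refine le_trans ?_ h1
  have iwG : IntervalIntegrable (fun r => w' r * G r) volume 0 R :=
    (cw'.mul cG.continuousOn).intervalIntegrable
  rw [intervalIntegral.integral_add (cL.intervalIntegrable _ _) (cM.intervalIntegrable _ _),
    intervalIntegral.integral_const_mul κ, ibp]
  have e2 : (∫ r in (0 : ℝ)..R, w r * (p * (1 - α ^ 2)) * (r * T r)) +
      κ * (w R * 0 - w 0 * 0 - ∫ r in (0 : ℝ)..R, w' r * G r)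
      = ∫ r in (0 : ℝ)..R, (w r * (p * (1 - α ^ 2)) * (r * T r) - κ * (w' r * G r)) := by
    rw [intervalIntegral.integral_sub (cL.intervalIntegrable _ _) (iwG.const_mul κ),
      intervalIntegral.integral_const_mul κ]
    ring
  rw [e2]
  apply intervalIntegral.integral_nonneg hR.le
  intro r hr
  have hr0 := hr.1
  have hv : 0 ≤ (1 + r) ^ (2 * α - 1) := rpow_nonneg (by linarith) _
  have hwv : w r = (1 + r) * (1 + r) ^ (2 * α - 1) := by
    simp only [hw]
    rw [rpow_sub_one (by linarith)]
    field_simp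
  have hT0 : 0 ≤ T r := intervalIntegral.integral_nonneg hpp fun t _ => by positivity
  have a1 : κ * (w' r * G r) ≤ κ * (w' r * (r ^ 2 * T r)) := by
    have : 0 ≤ w' r := by simp only [hw']; positivity
    have := step3 r
    gcongr
  have a2 : 0 ≤ (1 + r) * (p * (1 - α ^ 2)) - κ * (2 * α) * r := by
    have b1 : 0 ≤ p * (1 - α ^ 2) := mul_nonneg hp0 (by nlinarith)
    have b2 : 0 ≤ p * (1 - α ^ 2) - κ * (2 * α) := by
      simp only [hκ]; nlinarith
    nlinarith
  have a3 : w r * (p * (1 - α ^ 2)) * (r * T r) - κ * (w' r * (r ^ 2 * T r)) =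
      (1 + r) ^ (2 * α - 1) * (r * T r) * ((1 + r) * (p * (1 - α ^ 2)) - κ * (2 * α) * r) := by
    rw [hwv]; simp only [hw']; ring
  have a4 : 0 ≤ (1 + r) ^ (2 * α - 1) * (r * T r) *
      ((1 + r) * (p * (1 - α ^ 2)) - κ * (2 * α) * r) := by positivity
  linarith

/-- The radial unit vector. -/
noncomputable def radialVec (t : ℝ) : EuclideanSpace ℝ (Fin 2) :=
  cos t • EuclideanSpace.single 0 1 + sin t • EuclideanSpace.single 1 1

/-- The angular unit vector. -/
noncomputable def angularVec (t : ℝ) : EuclideanSpace ℝ (Fin 2) :=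
  (-sin t) • EuclideanSpace.single 0 1 + cos t • EuclideanSpace.single 1 1

lemma radialVec_continuous : Continuous radialVec := by unfold radialVec; fun_prop

lemma angularVec_continuous : Continuous angularVec := by unfold angularVec; fun_prop

lemma norm_radialVec (t : ℝ) : ‖radialVec t‖ = 1 := by
  rw [EuclideanSpace.norm_eq, Real.sqrt_eq_one]
  simp [radialVec, Fin.sum_univ_two]

lemma radialVec_hasDerivAt (t : ℝ) : HasDerivAt radialVec (angularVec t) t := by
  unfold radialVec angularVec
  exact ((hasDerivAt_cos t).smul_const _).add ((hasDerivAt_sin t).smul_const _)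

lemma repr_polar (p : ℝ × ℝ) :
    Complex.orthonormalBasisOneI.repr (Complex.polarCoord.symm p) = p.1 • radialVec p.2 := by
  ext i
  rw [Complex.orthonormalBasisOneI_repr_apply, Complex.polarCoord_symm_apply]
  fin_cases i <;> simp [radialVec, ← Complex.ofReal_cos, ← Complex.ofReal_sin]

lemma integral_polar {F : EuclideanSpace ℝ (Fin 2) → ℝ} (hF : Continuous F) {R : ℝ} (hR : 0 < R)
    (hz : ∀ x, R ≤ ‖x‖ → F x = 0) :
    ∫ x, F x = ∫ r in (0 : ℝ)..R, ∫ t in (-π)..π, r * F (r • radialVec t) := by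
  have hpp : -π ≤ π := by linarith [pi_pos]
  have mp := Complex.orthonormalBasisOneI.repr.measurePreserving
  rw [← mp.integral_comp
    Complex.orthonormalBasisOneI.repr.toHomeomorph.measurableEmbedding,
    ← Complex.integral_comp_polarCoord_symm]
  simp only [repr_polar, smul_eq_mul, polarCoord_target]
  have hc : Continuous fun p : ℝ × ℝ => p.1 * F (p.1 • radialVec p.2) := by
    have := radialVec_continuous
    fun_prop
  have e1 : ∫ p in Set.Ioi (0 : ℝ) ×ˢ Set.Ioo (-π) π, p.1 * F (p.1 • radialVec p.2)
      = ∫ p in Set.Ioc 0 R ×ˢ Set.Ioo (-π) π, p.1 * F (p.1 • radialVec p.2) := by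
    apply setIntegral_eq_of_subset_of_forall_sdiff_eq_zero
    · exact measurableSet_Ioi.prod measurableSet_Ioo
    · exact Set.prod_mono Set.Ioc_subset_Ioi_self le_rfl
    · rintro ⟨r, t⟩ ⟨⟨h1, h2⟩, h3⟩
      have h1' : 0 < r := h1
      have : R < r := by
        by_contra hcon
        exact h3 ⟨⟨h1', not_lt.1 hcon⟩, h2⟩
      have : F (r • radialVec t) = 0 := by
        apply hz
        rw [norm_smul, norm_radialVec, Real.norm_eq_abs, abs_of_pos h1']
        linarith
      simp [this]
  rw [e1, Measure.volume_eq_prod, setIntegral_prod, intervalIntegral.integral_of_le hR.le]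
  · congr 1
    ext r
    rw [intervalIntegral.integral_of_le hpp, integral_Ioc_eq_integral_Ioo]
  · refine IntegrableOn.mono_set (t := Set.Icc 0 R ×ˢ Set.Icc (-π) π) ?_
      (Set.prod_mono Set.Ioc_subset_Icc_self Set.Ioo_subset_Icc_self)
    exact hc.continuousOn.integrableOn_compact (isCompact_Icc.prod isCompact_Icc)

/-- Proposition: lower bound for the weighted `(∂₁ + i∂₂)`-Dirichlet integral with
weight `(1+|x|)^{2α}`, `0 ≤ α < 1`. -/
theorem weighted_lower_bound_plus
    (α : ℝ) (hα0 : 0 ≤ α) (hα1 : α < 1)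
    (φ : EuclideanSpace ℝ (Fin 2) → ℂ)
    (hφ : ContDiff ℝ 1 φ) (hsupp : HasCompactSupport φ) :
    ∫ x : EuclideanSpace ℝ (Fin 2),
        (1 + ‖x‖) ^ (2 * α) *
          ‖fderiv ℝ φ x (EuclideanSpace.single 0 1) +
            Complex.I * fderiv ℝ φ x (EuclideanSpace.single 1 1)‖ ^ 2 ≥
      (2 : ℝ) ^ (-2 * α - 1) * (1 - α) ^ 2 /
          (2 * α + (2 : ℝ) ^ (-2 * α - 1) * (1 - α) ^ 2) *
        ∫ x : EuclideanSpace ℝ (Fin 2),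
          (1 + ‖x‖) ^ (2 * α) *
            (‖fderiv ℝ φ x (EuclideanSpace.single 0 1)‖ ^ 2 +
              ‖fderiv ℝ φ x (EuclideanSpace.single 1 1)‖ ^ 2) := by
  set s : ℝ := (2 : ℝ) ^ (-2 * α - 1) * (1 - α) ^ 2 with hs
  have hs0 : 0 < s := by
    have : 0 < 1 - α := by linarith
    positivity
  have hs1 : s ≤ (1 - α) ^ 2 := by
    have : (2 : ℝ) ^ (-2 * α - 1) ≤ 1 := rpow_le_one_of_one_le_of_nonpos (by norm_num) (by linarith)
    nlinarith [sq_nonneg (1 - α)]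
  set p : ℝ := 2 * α / (2 * α + s) with hp
  have hd : 0 < 2 * α + s := by linarith
  have hq : s / (2 * α + s) = 1 - p := by rw [hp]; field_simp; ring
  have hp0 : 0 ≤ p := by positivity
  have hp1 : p ≤ 1 := by rw [hp, div_le_one hd]; linarith
  have hp2 : 2 * α ≤ p * (1 + α ^ 2) := by
    rw [hp, div_mul_eq_mul_div, le_div_iff₀ hd]
    apply mul_le_mul_of_nonneg_left _ (by linarith)
    nlinarith
  rw [hq, ge_iff_le, ← sub_nonneg, ← integral_const_mul]
  have cD : Continuous (fderiv ℝ φ) := hφ.continuous_fderiv (by norm_num)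
  have cw : Continuous fun x : EuclideanSpace ℝ (Fin 2) => (1 + ‖x‖) ^ (2 * α) := by
    apply Continuous.rpow_const (by fun_prop)
    intro x; right; linarith
  obtain ⟨R, hR, hRs⟩ : ∃ R : ℝ, 0 < R ∧ ∀ x, R ≤ ‖x‖ → x ∉ tsupport φ := by
    obtain ⟨R, hR⟩ := hsupp.isCompact.isBounded.exists_norm_le
    refine ⟨max R 0 + 1, by positivity, fun x hx hmem => ?_⟩
    have := hR x hmem
    linarith [le_max_left R 0]
  have hφ0 : ∀ x, R ≤ ‖x‖ → φ x = 0 := fun x hx => image_eq_zero_of_notMem_tsupport (hRs x hx)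
  have hD0 : ∀ x, R ≤ ‖x‖ → fderiv ℝ φ x = 0 := fun x hx => by
    by_contra h
    exact hRs x hx (support_fderiv_subset ℝ h)
  have hDs : HasCompactSupport (fderiv ℝ φ) := hsupp.fderiv ℝ
  have c1 : Continuous fun x => (1 + ‖x‖) ^ (2 * α) *
          ‖fderiv ℝ φ x (EuclideanSpace.single 0 1) +
            Complex.I * fderiv ℝ φ x (EuclideanSpace.single 1 1)‖ ^ 2 := by fun_prop
  have c2 : Continuous fun x => (1 - p) * ((1 + ‖x‖) ^ (2 * α) *
            (‖fderiv ℝ φ x (EuclideanSpace.single 0 1)‖ ^ 2 +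
              ‖fderiv ℝ φ x (EuclideanSpace.single 1 1)‖ ^ 2)) := by fun_prop
  have i1 := c1.integrable_of_hasCompactSupport (μ := volume)
    (hDs.mono' (fun x hx => subset_closure (fun h => hx (by simp [h]))))
  have i2 := c2.integrable_of_hasCompactSupport (μ := volume)
    (hDs.mono' (fun x hx => subset_closure (fun h => hx (by simp [h]))))
  rw [← integral_sub i1 i2, integral_polar (by fun_prop) hR (fun x hx => by simp [hD0 x hx])]
  have cu := radialVec_continuous
  have cv := angularVec_continuous
  have dφ : ∀ x, HasFDerivAt φ (fderiv ℝ φ x) x := fun x =>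
    (hφ.differentiable (by norm_num) x).hasFDerivAt
  have main := radial_ineq (Φ := fun r t => φ (r • radialVec t))
    (A := fun r t => fderiv ℝ φ (r • radialVec t) (radialVec t))
    (β := fun r t => fderiv ℝ φ (r • radialVec t) (angularVec t))
    (R := R) (α := α) (p := p) ?_ ?_ ?_ ?_ ?_ hR ?_ hα0 hα1 hp0 hp1 hp2
  · refine main.trans_eq ?_
    apply intervalIntegral.integral_congr
    intro r hr
    rw [Set.uIcc_of_le hR.le] at hr
    apply intervalIntegral.integral_congr
    intro t _
    have hn : ‖r • radialVec t‖ = r := by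
      rw [norm_smul, norm_radialVec, Real.norm_eq_abs, abs_of_nonneg hr.1, mul_one]
    simp only [hn]
    generalize fderiv ℝ φ (r • radialVec t) = L
    simp only [radialVec, angularVec, map_add, map_smul]
    generalize L (EuclideanSpace.single 0 1) = x
    generalize L (EuclideanSpace.single 1 1) = y
    have hcs := sin_sq_add_cos_sq t
    have h1 : ‖cos t • x + sin t • y + Complex.I * (-sin t • x + cos t • y)‖ ^ 2
        = ‖x + Complex.I * y‖ ^ 2 := by
      simp only [Complex.sq_norm, Complex.normSq_apply, Complex.add_re,
          Complex.add_im, Complex.mul_re, Complex.mul_im, Complex.I_re, Complex.I_im,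
          Complex.smul_re, Complex.smul_im, smul_eq_mul]
      linear_combination ((x.re - y.im) ^ 2 + (x.im + y.re) ^ 2) * hcs
    have h2 : ‖cos t • x + sin t • y‖ ^ 2 + ‖-sin t • x + cos t • y‖ ^ 2
        = ‖x‖ ^ 2 + ‖y‖ ^ 2 := by
      simp only [Complex.sq_norm, Complex.normSq_apply, Complex.add_re,
          Complex.add_im, Complex.smul_re, Complex.smul_im, smul_eq_mul]
      linear_combination (x.re ^ 2 + x.im ^ 2 + y.re ^ 2 + y.im ^ 2) * hcs
    rw [h1, h2]
    ring
  · intro r t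
    have h : HasDerivAt (fun s : ℝ => s • radialVec t) (radialVec t) r := by
      simpa using (hasDerivAt_id r).smul_const (radialVec t)
    exact (dφ _).comp_hasDerivAt r h
  · intro r t
    have h : HasDerivAt (fun t : ℝ => r • radialVec t) (r • angularVec t) t :=
      (radialVec_hasDerivAt t).const_smul r
    have := (dφ (r • radialVec t)).comp_hasDerivAt t h
    rw [map_smul, Complex.real_smul] at this
    exact this
  · have : Continuous fun x : ℝ × ℝ => fderiv ℝ φ (x.1 • radialVec x.2) (radialVec x.2) := by fun_prop
    exact this
  · have : Continuous fun x : ℝ × ℝ => fderiv ℝ φ (x.1 • radialVec x.2) (angularVec x.2) := by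
      fun_prop
    exact this
  · intro r
    simp [radialVec]
  · intro t
    apply hφ0
    rw [norm_smul, norm_radialVec, Real.norm_eq_abs, abs_of_pos hR, mul_one]
end

section
/- Let 0 ≤ α < 1 and set q_α = 2^{-2α-1}(1-α)² / (2α + 2^{-2α-1}(1-α)²). Then for every continuously differentiable compactly supported function φ : ℝ² → ℂ one has ∫_{ℝ²} (1+|x|)^{-2α} |(∂₁ - i∂₂)φ(x)|² dx ≥ q_α ∫_{ℝ²} (1+|x|)^{-2α} |∇φ(x)|² dx. -/
open MeasureTheory Real

lemma wirt (f f' : ℝ → ℝ) (hf : ∀ x, HasDerivAt f (f' x) x) (hf' : Continuous f')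
    (hper : f (2 * π) = f 0) (hmean : ∫ x in (0:ℝ)..(2 * π), f x = 0) :
    ∫ x in (0:ℝ)..(2 * π), f x ^ 2 ≤ ∫ x in (0:ℝ)..(2 * π), f' x ^ 2 := by
  have hab : (0:ℝ) < 2 * π := by positivity
  have hfc : Continuous f := continuous_iff_continuousAt.2 fun x => (hf x).continuousAt
  have hL : ∀ g : ℝ → ℝ, Continuous g →
      MemLp (fun x => (g x : ℂ)) 2 (volume.restrict (Set.Ioc 0 (2 * π))) := by
    intro g hg
    have h1 : Continuous (fun x => (g x : ℂ)) := by fun_prop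
    obtain ⟨C, hC⟩ := (isCompact_Icc (a := (0:ℝ)) (b := 2 * π)).exists_bound_of_continuousOn h1.continuousOn
    refine MemLp.of_bound h1.aestronglyMeasurable C ?_
    refine (ae_restrict_iff' measurableSet_Ioc).2 (ae_of_all _ fun x hx => hC x ⟨hx.1.le, hx.2⟩)
  have s1 := hasSum_sq_fourierCoeffOn hab (hL f hfc)
  have s2 := hasSum_sq_fourierCoeffOn hab (hL f' hf')
  have key := hasSum_le (fun n => ?_) s1 s2
  · simp only [smul_eq_mul, sub_zero, Complex.norm_real, norm_eq_abs, sq_abs] at key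
    exact le_of_mul_le_mul_left key (by positivity)
  · by_cases hn : n = 0
    · subst hn
      rw [fourierCoeffOn_eq_integral]
      simp [intervalIntegral.integral_ofReal, hmean]
    · rw [fourierCoeffOn_of_hasDerivAt (f' := fun x => (f' x : ℂ)) hab hn (fun x _ => (hf x).ofReal_comp)
        ((by fun_prop : Continuous (fun x => (f' x : ℂ))).intervalIntegrable _ _)]
      rw [hper]
      have h1 : (1:ℝ) ≤ |(n:ℝ)| := by exact_mod_cast Int.one_le_abs hn
      gcongr
      simp only [sub_self, mul_zero, zero_sub, norm_mul, norm_neg, norm_div, norm_one, Complex.ofReal_zero, sub_zero, Complex.norm_I]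
      simp only [Complex.norm_intCast, Complex.norm_real, norm_eq_abs, abs_of_pos pi_pos, Complex.norm_ofNat, mul_one, Complex.ofReal_mul, Complex.ofReal_ofNat]
      rw [← mul_assoc]
      refine mul_le_of_le_one_left (norm_nonneg _) ?_
      rw [one_div, inv_mul_le_iff₀ (by positivity)]
      have h2 : ‖(2 * (π:ℂ))‖ = 2 * π := by simp [abs_of_pos pi_pos]
      rw [h2]; nlinarith [pi_pos]

lemma circle (a b a' b' : ℝ → ℝ) (ha : ∀ x, HasDerivAt a (a' x) x) (hb : ∀ x, HasDerivAt b (b' x) x)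
    (ha' : Continuous a') (hb' : Continuous b')
    (pa : a (2 * π) = a 0) (pb : b (2 * π) = b 0) :
    0 ≤ ∫ x in (0:ℝ)..(2 * π), (a' x ^ 2 + b' x ^ 2 + 2 * (a x * b' x)) := by
  have hac : Continuous a := continuous_iff_continuousAt.2 fun x => (ha x).continuousAt
  set c := (2 * π)⁻¹ * ∫ x in (0:ℝ)..(2 * π), a x with hc
  have hw := wirt (fun x => a x - c) a' (fun x => (ha x).sub_const c) ha' (by simp [pa]) (by
    rw [intervalIntegral.integral_sub (hac.intervalIntegrable _ _) (by simp)]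
    simp [hc]; field_simp; simp)
  have hb0 : ∫ x in (0:ℝ)..(2 * π), b' x = 0 := by
    rw [intervalIntegral.integral_eq_sub_of_hasDerivAt (fun x _ => hb x) (hb'.intervalIntegrable _ _), pb, sub_self]
  have e : ∫ x in (0:ℝ)..(2 * π), (a' x ^ 2 + b' x ^ 2 + 2 * (a x * b' x)) =
      (∫ x in (0:ℝ)..(2 * π), a' x ^ 2) - (∫ x in (0:ℝ)..(2 * π), (a x - c) ^ 2)
       + (∫ x in (0:ℝ)..(2 * π), (b' x + (a x - c)) ^ 2) + 2 * c * ∫ x in (0:ℝ)..(2 * π), b' x := by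
    rw [← intervalIntegral.integral_const_mul, ← intervalIntegral.integral_sub, ← intervalIntegral.integral_add, ← intervalIntegral.integral_add]
    · congr 1; ext x; ring
    all_goals exact Continuous.intervalIntegrable (by fun_prop) _ _
  rw [e, hb0]
  have : 0 ≤ ∫ x in (0:ℝ)..(2 * π), (b' x + (a x - c)) ^ 2 :=
    intervalIntegral.integral_nonneg (by positivity) fun x _ => sq_nonneg _
  linarith

open scoped NNReal in
lemma integ {E : Type*} [TopologicalSpace E] [T2Space E] [MeasurableSpace E] [OpensMeasurableSpace E] (μ : Measure E)
    [IsFiniteMeasureOnCompacts μ] (K : Set E) (hK : IsCompact K) (f : E → ℝ)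
    (hf : AEStronglyMeasurable f μ) (M : ℝ) (hM : ∀ x, |f x| ≤ M) (h0 : ∀ x, x ∉ K → f x = 0) :
    Integrable f μ := by
  have : IntegrableOn f K μ :=
    Measure.integrableOn_of_bounded (M := M) hK.measure_lt_top.ne hf (ae_of_all _ hM)
  rwa [integrableOn_iff_integrable_of_support_subset] at this
  intro x hx
  by_contra h
  exact hx (h0 x h)

open scoped NNReal in
lemma curl {E : Type*} [NormedAddCommGroup E] [NormedSpace ℝ E] [FiniteDimensional ℝ E]
    [MeasurableSpace E] [BorelSpace E] (μ : Measure E) [μ.IsAddHaarMeasure]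
    (u b : E → ℝ) (C : ℝ≥0) (hu : LipschitzWith C u) (hus : HasCompactSupport u)
    (hb : ContDiff ℝ 1 b) (hbs : HasCompactSupport b) (v w : E) :
    ∫ x, lineDeriv ℝ u x v * fderiv ℝ b x w ∂μ = ∫ x, lineDeriv ℝ u x w * fderiv ℝ b x v ∂μ := by
  obtain ⟨D, hD⟩ := hb.lipschitzWith_of_hasCompactSupport hbs one_ne_zero
  have hbd : Differentiable ℝ b := hb.differentiable one_ne_zero
  have hbc : ∀ w, Continuous (fun x => fderiv ℝ b x w) := fun w =>
    (hb.continuous_fderiv one_ne_zero).clm_apply continuous_const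
  have hbw : ∀ w, Integrable (fun x => fderiv ℝ b x w) μ := fun w =>
    (hbc w).integrable_of_hasCompactSupport (hbs.fderiv_apply ℝ w)
  have T1 := hu.integral_inv_smul_sub_mul_tendsto_integral_lineDeriv_mul (μ := μ) (hbw w) v
  have hui : Integrable (fun x => lineDeriv ℝ u x (-w)) μ := by
    refine integ μ (tsupport u) hus _ (measurable_lineDeriv hu.continuous).aestronglyMeasurable
      (C * ‖-w‖) (fun x => norm_lineDeriv_le_of_lipschitz ℝ hu) ?_
    intro x hx
    have : u =ᶠ[nhds x] 0 := notMem_tsupport_iff_eventuallyEq.1 hx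
    rw [this.lineDeriv_eq]
    simp [lineDeriv]
  have T2 := hD.integral_inv_smul_sub_mul_tendsto_integral_lineDeriv_mul (μ := μ) hui (-v)
  have e : ∀ t : ℝ, ∫ x, (t⁻¹ • (u (x + t • v) - u x)) * fderiv ℝ b x w ∂μ =
     ∫ x, (t⁻¹ • (b (x + t • (-v)) - b x)) * lineDeriv ℝ u x (-w) ∂μ := by
    intro t
    have hk : LipschitzWith (D + D) (fun x => b (x + t • (-v)) - b x) := by
      refine LipschitzWith.sub ?_ hD
      have := hD.comp (LipschitzWith.id.add (LipschitzWith.const (t • (-v))))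
      simpa [Function.comp_def] using this
    have ip := hk.integral_lineDeriv_mul_eq (μ := μ) hu hus w
    have hld : ∀ x, lineDeriv ℝ (fun x => b (x + t • (-v)) - b x) x w =
        fderiv ℝ b (x + t • (-v)) w - fderiv ℝ b x w := by
      intro x
      have h1 : HasFDerivAt (fun x => b (x + t • (-v)) - b x)
        (fderiv ℝ b (x + t • (-v)) - fderiv ℝ b x) x := by
        refine HasFDerivAt.sub ?_ (hbd x).hasFDerivAt
        exact (hasFDerivAt_comp_add_right _).2 (hbd _).hasFDerivAt
      rw [(h1.hasLineDerivAt w).lineDeriv]; simp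
    simp only [hld] at ip
    simp only [smul_eq_mul, mul_assoc, integral_const_mul]
    congr 1
    have i1 : Continuous fun x => (fderiv ℝ b (x + t • (-v)) w) * u x :=
      ((hbc w).comp (continuous_add_const _)).mul hu.continuous
    have i2 : Continuous fun x => (fderiv ℝ b x w) * u x := (hbc w).mul hu.continuous
    have i3 : Continuous fun x => u (x + t • v) * (fderiv ℝ b x w)  :=
      (hu.continuous.comp (continuous_add_const _)).mul (hbc w)
    have i4 : Continuous fun x => u x * (fderiv ℝ b x w)  := hu.continuous.mul (hbc w)
    have hbs' := hbs.fderiv_apply ℝ w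
    calc _ = ∫ x, (fderiv ℝ b (x + t • (-v)) w - fderiv ℝ b x w) * u x ∂μ := by
            simp only [sub_mul]
            rw [integral_sub (i3.integrable_of_hasCompactSupport hbs'.mul_left)
              (i4.integrable_of_hasCompactSupport hbs'.mul_left),
              integral_sub (i1.integrable_of_hasCompactSupport hus.mul_left)
              (i2.integrable_of_hasCompactSupport hus.mul_left),
              ← integral_add_right_eq_self _ (t • (-v))]
            simp [mul_comm]
      _ = _ := ip
      _ = _ := by simp only [mul_comm]
  simp only [e] at T1
  rw [tendsto_nhds_unique T1 T2]
  refine integral_congr_ae (ae_of_all _ fun x => ?_)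
  simp only [lineDeriv_neg, (hbd x).lineDeriv_eq_fderiv, map_neg]
  ring

abbrev E2 := EuclideanSpace ℝ (Fin 2)

noncomputable def rot (θ : ℝ) (x : E2) : E2 :=
  !₂[cos θ * x 0 - sin θ * x 1, sin θ * x 0 + cos θ * x 1]

lemma nsq (x : E2) : ‖x‖ ^ 2 = x 0 ^ 2 + x 1 ^ 2 := by
  simp [EuclideanSpace.real_norm_sq_eq, Fin.sum_univ_two]

lemma rot_norm (θ : ℝ) (x : E2) : ‖rot θ x‖ = ‖x‖ := by
  have : ‖rot θ x‖ ^ 2 = ‖x‖ ^ 2 := by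
    rw [nsq, nsq]
    simp only [rot, PiLp.toLp_apply, Matrix.cons_val_zero, Matrix.cons_val_one]
    linear_combination (x 0 ^ 2 + x 1 ^ 2) * sin_sq_add_cos_sq θ
  exact (sq_eq_sq₀ (norm_nonneg _) (norm_nonneg _)).1 this

noncomputable def rotL (θ : ℝ) : E2 →ₗᵢ[ℝ] E2 where
  toFun := rot θ
  map_add' x y := by ext i; fin_cases i <;> simp [rot] <;> ring
  map_smul' c x := by ext i; fin_cases i <;> simp [rot] <;> ring
  norm_map' := rot_norm θ

lemma rot_integral (θ : ℝ) (F : E2 → ℝ) : ∫ x, F (rot θ x) = ∫ x, F x := by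
  have := ((rotL θ).toLinearIsometryEquiv rfl).measurePreserving.integral_comp
    ((rotL θ).toLinearIsometryEquiv rfl).toHomeomorph.measurableEmbedding F
  exact this

lemma rot_cont : Continuous (fun p : ℝ × E2 => rot p.1 p.2) := by
  unfold rot
  refine (PiLp.continuous_toLp 2 _).comp (continuous_pi fun i => ?_)
  fin_cases i
  · simp; fun_prop
  · simp; fun_prop

lemma rot_cont_left (x : E2) : Continuous (fun θ : ℝ => rot θ x) := by
  unfold rot
  refine (PiLp.continuous_toLp 2 _).comp (continuous_pi fun i => ?_)
  fin_cases i
  · simp; fun_prop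
  · simp; fun_prop

lemma rot_avg (F G : E2 → ℝ) (hF : Measurable F) (hG : Continuous G) (hGs : HasCompactSupport G)
    (hFG : ∀ x, |F x| ≤ G x) (hpos : ∀ x, 0 ≤ ∫ θ in (0:ℝ)..(2 * π), F (rot θ x)) :
    0 ≤ ∫ x, F x := by
  have hab : (0:ℝ) ≤ 2 * π := by positivity
  obtain ⟨M, hM⟩ := hG.bounded_above_of_compact_support hGs
  obtain ⟨R, hR⟩ := hGs.isBounded.subset_closedBall (0 : E2)
  have hFM : ∀ x, |F x| ≤ M := fun x => (hFG x).trans ((le_abs_self _).trans (hM x))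
  have hF0 : ∀ x, x ∉ Metric.closedBall (0:E2) R → F x = 0 := by
    intro x hx
    have : G x = 0 := image_eq_zero_of_notMem_tsupport fun h => hx (hR h)
    exact abs_nonpos_iff.1 (this ▸ hFG x)
  have h_integrable : Integrable (Function.uncurry fun (θ : ℝ) (x : E2) => F (rot θ x))
      ((volume.restrict (Set.Ioc 0 (2 * π))).prod volume) := by
    have hm : Measurable (Function.uncurry fun (θ : ℝ) (x : E2) => F (rot θ x)) :=
      hF.comp rot_cont.measurable
    have h1 : IntegrableOn (Function.uncurry fun (θ : ℝ) (x : E2) => F (rot θ x))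
        (Set.univ ×ˢ Metric.closedBall (0:E2) R)
        ((volume.restrict (Set.Ioc 0 (2 * π))).prod volume) := by
      refine Measure.integrableOn_of_bounded (M := M) ?_ hm.aestronglyMeasurable
        (ae_of_all _ fun p => hFM _)
      rw [Measure.prod_prod]
      exact ENNReal.mul_ne_top (by simp [ENNReal.mul_eq_top]) (isCompact_closedBall _ _).measure_lt_top.ne
    rwa [integrableOn_iff_integrable_of_support_subset] at h1
    rintro ⟨θ, x⟩ hx
    by_contra h
    apply hx
    apply hF0
    simpa [rot_norm] using h
  have sw := integral_integral_swap h_integrable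
  simp only [rot_integral] at sw
  have h2 : 0 ≤ ∫ x : E2, ∫ θ in Set.Ioc 0 (2 * π), F (rot θ x) := by
    refine integral_nonneg fun x => ?_
    have := hpos x
    rwa [intervalIntegral.integral_of_le hab] at this
  rw [← sw] at h2
  simp at h2
  rw [max_eq_left hab] at h2
  exact nonneg_of_mul_nonneg_right h2 (by positivity)

noncomputable def wt (α : ℝ) (x : E2) : ℝ := (1 + ‖x‖) ^ (-(2 * α))
noncomputable def kap (α : ℝ) (x : E2) : ℝ := 2 * α * (wt α x / (‖x‖ * (1 + ‖x‖)))

lemma wt_cont (α : ℝ) : Continuous (wt α) := by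
  unfold wt
  refine Continuous.rpow_const (by fun_prop) fun x => Or.inl ?_
  have := norm_nonneg x
  positivity

lemma wt_pos (α : ℝ) (x : E2) : 0 < wt α x := by
  unfold wt
  have := norm_nonneg x
  positivity

lemma wt_le (α : ℝ) (hα : 0 ≤ α) (x : E2) : wt α x ≤ 1 := by
  unfold wt
  exact rpow_le_one_of_one_le_of_nonpos (by linarith [norm_nonneg x]) (by linarith)

lemma kap_meas (α : ℝ) : Measurable (kap α) := by
  unfold kap
  have := (wt_cont α).measurable
  fun_prop

lemma kap_nonneg (α : ℝ) (hα : 0 ≤ α) (x : E2) : 0 ≤ kap α x := by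
  unfold kap
  have := wt_pos α x
  positivity

lemma kap_mul (α : ℝ) (hα : 0 ≤ α) (x : E2) : kap α x * ‖x‖ ≤ 2 * α := by
  unfold kap
  rcases eq_or_ne ‖x‖ 0 with h | h
  · rw [h]; simp; exact hα
  · have : 2 * α * (wt α x / (‖x‖ * (1 + ‖x‖))) * ‖x‖ = 2 * α * (wt α x / (1 + ‖x‖)) := by
      field_simp
    rw [this]
    have h1 := wt_le α hα x
    have h2 := norm_nonneg x
    refine mul_le_of_le_one_right (by positivity) ?_
    rw [div_le_one (by positivity)]; linarith

lemma kap_mul_sq (α : ℝ) (hα : 0 ≤ α) (x : E2) : kap α x * ‖x‖ ^ 2 ≤ 2 * α * wt α x := by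
  unfold kap
  have h0 := wt_pos α x
  rcases eq_or_ne ‖x‖ 0 with h | h
  · rw [h]; simp; positivity
  · have h2 := norm_nonneg x
    have : 2 * α * (wt α x / (‖x‖ * (1 + ‖x‖))) * ‖x‖ ^ 2 = 2 * α * wt α x * (‖x‖ / (1 + ‖x‖)) := by
      field_simp
    rw [this]
    refine mul_le_of_le_one_right (by positivity) ?_
    rw [div_le_one (by positivity)]; linarith

lemma wt_hasDeriv (α : ℝ) (r : ℝ) (hr : 0 ≤ r) :
    HasDerivAt (fun r : ℝ => (1 + r) ^ (-(2 * α))) (-(2 * α) * (1 + r) ^ (-(2 * α) - 1)) r := by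
  have h := ((hasDerivAt_id r).const_add 1).rpow_const (p := -(2 * α)) (Or.inl (by simp; positivity))
  simpa using h

lemma wt_lip (α : ℝ) (hα : 0 ≤ α) (x y : E2) : |wt α x - wt α y| ≤ 2 * α * ‖x - y‖ := by
  have h := (convex_Ici (0:ℝ)).norm_image_sub_le_of_norm_hasDerivWithin_le
    (f := fun r : ℝ => (1 + r) ^ (-(2 * α))) (C := 2 * α)
    (fun r hr => (wt_hasDeriv α r hr).hasDerivWithinAt) (fun r hr => by
      have hr : 0 ≤ r := hr
      rw [norm_mul, norm_neg, norm_eq_abs, norm_eq_abs, abs_of_nonneg (by positivity : 0 ≤ 2 * α),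
        abs_of_nonneg (by positivity)]
      refine mul_le_of_le_one_right (by positivity) ?_
      exact rpow_le_one_of_one_le_of_nonpos (by linarith) (by linarith))
    (norm_nonneg y : ‖y‖ ∈ Set.Ici 0) (norm_nonneg x : ‖x‖ ∈ Set.Ici 0)
  refine h.trans ?_
  gcongr
  exact abs_norm_sub_norm_le x y

lemma wt_fderiv (α : ℝ) (x : E2) (hx : x ≠ 0) (v : E2) :
    HasLineDerivAt ℝ (wt α) (-(kap α x) * inner ℝ x v) x v := by
  have hn : ‖x‖ ≠ 0 := norm_ne_zero_iff.2 hx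
  have hd : DifferentiableAt ℝ (fun x : E2 => ‖x‖) x := differentiableAt_id.norm ℝ hx
  have h1 : HasFDerivAt (fun x : E2 => ‖x‖ ^ 2) _ x := (hasStrictFDerivAt_norm_sq x).hasFDerivAt
  have h2 := hd.hasFDerivAt.pow 2
  have h3 := congrArg (fun L => L v) (h1.unique h2)
  simp at h3
  have h4 : fderiv ℝ (fun x : E2 => ‖x‖) x v = inner ℝ x v / ‖x‖ := by
    field_simp; linarith
  have h5 := (wt_hasDeriv α ‖x‖ (norm_nonneg x)).comp_hasFDerivAt x hd.hasFDerivAt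
  have h6 := h5.hasLineDerivAt v
  have hp : (0:ℝ) < 1 + ‖x‖ := by positivity
  have h7 : HasLineDerivAt ℝ (wt α) _ x v := h6
  refine HasDerivAt.congr_deriv h7 ?_
  simp only [FunLike.coe_smul, Pi.smul_apply, smul_eq_mul, h4, kap, wt]
  rw [rpow_sub_one hp.ne']
  field_simp

noncomputable abbrev d0 (a : E2 → ℝ) (x : E2) : ℝ := fderiv ℝ a x (EuclideanSpace.single 0 1)
noncomputable abbrev d1 (a : E2 → ℝ) (x : E2) : ℝ := fderiv ℝ a x (EuclideanSpace.single 1 1)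
noncomputable abbrev dθ (a : E2 → ℝ) (x : E2) : ℝ := x 0 * d1 a x - x 1 * d0 a x

lemma coord_le (x : E2) (i : Fin 2) : |x i| ≤ ‖x‖ := PiLp.norm_apply_le x i

lemma dθ_le (a : E2 → ℝ) (x : E2) : |dθ a x| ≤ ‖x‖ * (|d0 a x| + |d1 a x|) := by
  have h0 := coord_le x 0
  have h1 := coord_le x 1
  calc |dθ a x| ≤ |x 0 * d1 a x| + |x 1 * d0 a x| := abs_sub _ _
    _ = |x 0| * |d1 a x| + |x 1| * |d0 a x| := by rw [abs_mul, abs_mul]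
    _ ≤ ‖x‖ * |d1 a x| + ‖x‖ * |d0 a x| := by gcongr
    _ = _ := by ring

section
variable {α : ℝ} {a b : E2 → ℝ}

lemma d0_cont (ha : ContDiff ℝ 1 a) : Continuous (d0 a) :=
  (ha.continuous_fderiv one_ne_zero).clm_apply continuous_const
lemma d1_cont (ha : ContDiff ℝ 1 a) : Continuous (d1 a) :=
  (ha.continuous_fderiv one_ne_zero).clm_apply continuous_const
lemma dθ_cont (ha : ContDiff ℝ 1 a) : Continuous (dθ a) := by
  have := d0_cont ha
  have := d1_cont ha
  unfold dθ
  fun_prop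
lemma d0_supp (ha : HasCompactSupport a) : HasCompactSupport (d0 a) := ha.fderiv_apply ℝ _
lemma d1_supp (ha : HasCompactSupport a) : HasCompactSupport (d1 a) := ha.fderiv_apply ℝ _

lemma kab_bound (hα : 0 ≤ α) (x : E2) :
    |kap α x * (a x * dθ b x)| ≤ 2 * α * (|a x| * (|d0 b x| + |d1 b x|)) := by
  have h := dθ_le b x
  have hk := kap_nonneg α hα x
  have hm := kap_mul α hα x
  rw [abs_mul, abs_mul, abs_of_nonneg hk]
  calc kap α x * (|a x| * |dθ b x|) ≤ kap α x * (|a x| * (‖x‖ * (|d0 b x| + |d1 b x|))) := by gcongr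
    _ = kap α x * ‖x‖ * (|a x| * (|d0 b x| + |d1 b x|)) := by ring
    _ ≤ _ := by gcongr

lemma ksq_bound (hα : 0 ≤ α) (x : E2) :
    |kap α x * dθ a x ^ 2| ≤ 2 * α * (|d0 a x| + |d1 a x|) ^ 2 := by
  have h := dθ_le a x
  have hk := kap_nonneg α hα x
  have hm := kap_mul_sq α hα x
  have hw := wt_le α hα x
  have hm' : kap α x * ‖x‖ ^ 2 ≤ 2 * α := hm.trans (mul_le_of_le_one_right (by positivity) hw)
  rw [abs_mul, abs_of_nonneg hk, abs_pow]
  calc kap α x * |dθ a x| ^ 2 ≤ kap α x * (‖x‖ * (|d0 a x| + |d1 a x|)) ^ 2 := by gcongr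
    _ = kap α x * ‖x‖ ^ 2 * (|d0 a x| + |d1 a x|) ^ 2 := by ring
    _ ≤ _ := by gcongr

lemma suppAux {f g h : E2 → ℝ} (hf : HasCompactSupport f) (hg : HasCompactSupport g)
    (hh : ∀ x, f x = 0 → g x = 0 → h x = 0) : HasCompactSupport h := by
  refine HasCompactSupport.intro (hf.isCompact.union hg.isCompact) fun x hx => ?_
  simp only [Set.mem_union, not_or] at hx
  exact hh x (image_eq_zero_of_notMem_tsupport hx.1) (image_eq_zero_of_notMem_tsupport hx.2)

lemma kab_int (hα : 0 ≤ α) (ha : ContDiff ℝ 1 a) (hb : ContDiff ℝ 1 b) (sb : HasCompactSupport b) :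
    Integrable (fun x => kap α x * (a x * dθ b x)) := by
  have c0 := d0_cont hb
  have c1 := d1_cont hb
  have ca := ha.continuous
  have hi : Integrable (fun x => 2 * α * (|a x| * (|d0 b x| + |d1 b x|))) := by
    refine Continuous.integrable_of_hasCompactSupport (by fun_prop) ?_
    exact suppAux (d0_supp sb) (d1_supp sb) fun x h0 h1 => by simp only [h0, h1]; simp
  refine hi.mono' ?_ (ae_of_all _ fun x => kab_bound hα x)
  exact ((kap_meas α).mul (ca.mul (dθ_cont hb)).measurable).aestronglyMeasurable

lemma ksq_int (hα : 0 ≤ α) (ha : ContDiff ℝ 1 a) (sa : HasCompactSupport a) :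
    Integrable (fun x => kap α x * dθ a x ^ 2) := by
  have c0 := d0_cont ha
  have c1 := d1_cont ha
  have hi : Integrable (fun x => 2 * α * (|d0 a x| + |d1 a x|) ^ 2) := by
    refine Continuous.integrable_of_hasCompactSupport (by fun_prop) ?_
    exact suppAux (d0_supp sa) (d1_supp sa) fun x h0 h1 => by simp only [h0, h1]; simp
  refine hi.mono' ?_ (ae_of_all _ fun x => ksq_bound hα x)
  exact ((kap_meas α).mul ((dθ_cont ha).pow 2).measurable).aestronglyMeasurable

lemma wJ_int (ha : ContDiff ℝ 1 a) (hb : ContDiff ℝ 1 b) (sb : HasCompactSupport b) :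
    Integrable (fun x => wt α x * (d0 a x * d1 b x - d1 a x * d0 b x)) := by
  have c0 := d0_cont ha
  have c1 := d1_cont ha
  have c2 := d0_cont hb
  have c3 := d1_cont hb
  have cw := wt_cont α
  refine Continuous.integrable_of_hasCompactSupport (by fun_prop) ?_
  exact suppAux (d0_supp sb) (d1_supp sb) fun x h0 h1 => by simp only [h0, h1]; simp

lemma wN_int (ha : ContDiff ℝ 1 a) (sa : HasCompactSupport a) :
    Integrable (fun x => wt α x * (d0 a x ^ 2 + d1 a x ^ 2)) := by
  have c0 := d0_cont ha
  have c1 := d1_cont ha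
  have cw := wt_cont α
  refine Continuous.integrable_of_hasCompactSupport (by fun_prop) ?_
  exact suppAux (d0_supp sa) (d1_supp sa) fun x h0 h1 => by simp only [h0, h1]; simp

lemma curl_w (hα : 0 ≤ α) (ha : ContDiff ℝ 1 a) (hb : ContDiff ℝ 1 b)
    (sa : HasCompactSupport a) (sb : HasCompactSupport b) :
    ∫ x, wt α x * (d0 a x * d1 b x - d1 a x * d0 b x) = ∫ x, kap α x * (a x * dθ b x) := by
  obtain ⟨D, hD⟩ := ha.lipschitzWith_of_hasCompactSupport sa one_ne_zero
  obtain ⟨M, hM⟩ := ha.continuous.bounded_above_of_compact_support sa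
  have hM0 : 0 ≤ M := (norm_nonneg _).trans (hM 0)
  have hu : LipschitzWith (D + ⟨2 * α * M, by positivity⟩) (fun x => wt α x * a x) := by
    refine LipschitzWith.of_dist_le_mul fun x y => ?_
    rw [dist_eq_norm, dist_eq_norm]
    have e : wt α x * a x - wt α y * a y = wt α x * (a x - a y) + (wt α x - wt α y) * a y := by ring
    rw [e]
    have h1 : |a x - a y| ≤ D * ‖x - y‖ := hD.norm_sub_le x y
    have h2 := wt_lip α hα x y
    have h3 : |a y| ≤ M := hM y
    have h4 := wt_le α hα x
    have h5 := wt_pos α x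
    calc ‖wt α x * (a x - a y) + (wt α x - wt α y) * a y‖ 
        ≤ |wt α x * (a x - a y)| + |(wt α x - wt α y) * a y| := abs_add_le _ _
      _ = wt α x * |a x - a y| + |wt α x - wt α y| * |a y| := by rw [abs_mul, abs_mul, abs_of_pos h5]
      _ ≤ 1 * (D * ‖x - y‖) + (2 * α * ‖x - y‖) * M := by gcongr
      _ = (D + 2 * α * M) * ‖x - y‖ := by ring
      _ = _ := rfl
  have su : HasCompactSupport (fun x => wt α x * a x) := sa.mul_left
  have hc := curl volume _ b _ hu su hb sb (EuclideanSpace.single 0 1) (EuclideanSpace.single 1 1)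
  have hae : ∀ᵐ x : E2, x ≠ 0 := by simp [ae_iff]
  have ld : ∀ x : E2, x ≠ 0 → ∀ v, lineDeriv ℝ (fun x => wt α x * a x) x v =
      -(kap α x) * inner ℝ x v * a x + wt α x * fderiv ℝ a x v := by
    intro x hx v
    have h1 := wt_fderiv α x hx v
    have h2 := ((ha.differentiable one_ne_zero) x).hasFDerivAt.hasLineDerivAt v
    have h3 := HasDerivAt.mul h1 h2
    have h4 : HasLineDerivAt ℝ (fun x => wt α x * a x) _ x v := h3
    rw [h4.lineDeriv]; simp
  have e1 : ∀ (v w : E2), 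
     ∫ x, lineDeriv ℝ (fun x => wt α x * a x) x v * fderiv ℝ b x w =
     ∫ x, (-(kap α x) * inner ℝ x v * a x + wt α x * fderiv ℝ a x v) * fderiv ℝ b x w := by
    intro v w
    refine integral_congr_ae ?_
    filter_upwards [hae] with x hx
    rw [ld x hx]
  have hI : ∀ (v w : E2), Integrable (fun x => lineDeriv ℝ (fun x => wt α x * a x) x v * fderiv ℝ b x w) := by
    intro v w
    have hcw : Continuous fun x => fderiv ℝ b x w :=
      (hb.continuous_fderiv one_ne_zero).clm_apply continuous_const
    have hi := hcw.integrable_of_hasCompactSupport (μ := volume) (sb.fderiv_apply ℝ w)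
    exact hi.bdd_mul (measurable_lineDeriv hu.continuous).aestronglyMeasurable
      (ae_of_all _ fun x => norm_lineDeriv_le_of_lipschitz ℝ hu)
  rw [← sub_eq_zero, ← integral_sub (hI _ _) (hI _ _)] at hc
  rw [← sub_eq_zero, ← integral_sub (wJ_int ha hb sb) (kab_int hα ha hb sb), ← hc]
  refine integral_congr_ae ?_
  filter_upwards [hae] with x hx
  simp only [ld x hx, EuclideanSpace.inner_single_right]
  simp
  ring

lemma rot_deriv (ha : ContDiff ℝ 1 a) (x : E2) (θ : ℝ) :
    HasDerivAt (fun θ => a (rot θ x)) (dθ a (rot θ x)) θ := by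
  have h1 : HasDerivAt (fun θ => rot θ x)
      ((-(rot θ x 1)) • EuclideanSpace.single 0 1 + (rot θ x 0) • EuclideanSpace.single 1 1) θ := by
    have h0 := ((hasDerivAt_cos θ).smul_const x).add
      ((hasDerivAt_sin θ).smul_const (!₂[-x 1, x 0] : E2))
    have h3 : (fun θ => rot θ x) = (fun θ => cos θ • x) + (fun θ => sin θ • (!₂[-x 1, x 0] : E2)) := by
      ext θ i; fin_cases i <;> simp [rot] <;> ring
    rw [h3]
    refine h0.congr_deriv ?_
    ext i; fin_cases i <;> simp [rot] <;> ring
  have h2 := ((ha.differentiable one_ne_zero) (rot θ x)).hasFDerivAt.comp_hasDerivAt θ h1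
  convert! h2 using 1
  simp [dθ]; ring

lemma ang (hα : 0 ≤ α) (ha : ContDiff ℝ 1 a) (hb : ContDiff ℝ 1 b)
    (sa : HasCompactSupport a) (sb : HasCompactSupport b) :
    0 ≤ ∫ x, kap α x * (dθ a x ^ 2 + dθ b x ^ 2 + 2 * (a x * dθ b x)) := by
  have c0 := d0_cont ha
  have c1 := d1_cont ha
  have c2 := d0_cont hb
  have c3 := d1_cont hb
  have ca := ha.continuous
  have ta := dθ_cont ha
  have tb := dθ_cont hb
  refine rot_avg _ (fun x => 2 * α * (|d0 a x| + |d1 a x|) ^ 2 + (2 * α * (|d0 b x| + |d1 b x|) ^ 2 +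
    2 * (2 * α * (|a x| * (|d0 b x| + |d1 b x|))))) ?_ (by fun_prop) ?_ ?_ ?_
  · exact (kap_meas α).mul (by fun_prop : Continuous _).measurable
  · refine HasCompactSupport.add ?_ ?_
    · exact suppAux (d0_supp sa) (d1_supp sa) fun x h0 h1 => by simp only [h0, h1]; simp
    · exact suppAux (d0_supp sb) (d1_supp sb) fun x h0 h1 => by simp only [h0, h1]; simp
  · intro x
    have e : kap α x * (dθ a x ^ 2 + dθ b x ^ 2 + 2 * (a x * dθ b x)) =
      kap α x * dθ a x ^ 2 + (kap α x * dθ b x ^ 2 + 2 * (kap α x * (a x * dθ b x))) := by ring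
    rw [e]
    refine (abs_add_le _ _).trans (add_le_add (ksq_bound hα x) ?_)
    refine (abs_add_le _ _).trans (add_le_add (ksq_bound hα x) ?_)
    rw [abs_mul, abs_two]
    exact mul_le_mul_of_nonneg_left (kab_bound hα x) (by norm_num)
  · intro x
    have hk : ∀ θ, kap α (rot θ x) = kap α x := fun θ => by simp only [kap, wt, rot_norm]
    simp only [hk]
    rw [intervalIntegral.integral_const_mul]
    refine mul_nonneg (kap_nonneg α hα x) ?_
    have hr : Continuous fun θ => rot θ x := rot_cont_left x
    refine circle (fun θ => a (rot θ x)) (fun θ => b (rot θ x)) (fun θ => dθ a (rot θ x))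
      (fun θ => dθ b (rot θ x)) (rot_deriv ha x) (rot_deriv hb x) (ta.comp hr) (tb.comp hr) ?_ ?_ <;>
    simp [rot]

lemma ptwise (hα : 0 ≤ α) (hα1 : α < 1) (x : E2) :
    2 * α * (1 - α) * (2 * (wt α x * (d0 a x * d1 b x - d1 a x * d0 b x))) +
     (1 - α ^ 2) * (kap α x * dθ a x ^ 2 + kap α x * dθ b x ^ 2) ≤
    2 * α * ((wt α x * (d0 a x ^ 2 + d1 a x ^ 2) + wt α x * (d0 b x ^ 2 + d1 b x ^ 2)) +
      2 * (wt α x * (d0 a x * d1 b x - d1 a x * d0 b x))) := by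
  have hw := wt_pos α x
  have hk := kap_mul_sq α hα x
  have hk0 := kap_nonneg α hα x
  have hn := nsq x
  have h1 : 0 ≤ 1 - α ^ 2 := by nlinarith
  rcases eq_or_ne x 0 with h | h
  · subst h
    have : kap α 0 = 0 := by simp [kap]
    rw [this]
    have hN : 0 ≤ (d0 a 0 + α * d1 b 0) ^ 2 + (d1 a 0 - α * d0 b 0) ^ 2
        + (1 - α ^ 2) * (d0 b 0 ^ 2 + d1 b 0 ^ 2) := by positivity
    have := mul_nonneg (mul_nonneg hα hw.le) hN
    nlinarith
  · have hp : 0 < ‖x‖ ^ 2 := by positivity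
    refine le_of_mul_le_mul_right ?_ hp
    have hS : 0 ≤ (1 - α ^ 2) * (dθ a x ^ 2 + dθ b x ^ 2) := by positivity
    have key := mul_le_mul_of_nonneg_right hk hS
    have hT : 0 ≤ 2 * α * wt α x * ((x 0 * d0 a x + x 1 * d1 a x + α * dθ b x) ^ 2 +
      (x 0 * d0 b x + x 1 * d1 b x - α * dθ a x) ^ 2) := by positivity
    have hid : ((x 0 * d0 a x + x 1 * d1 a x + α * dθ b x) ^ 2 +
      (x 0 * d0 b x + x 1 * d1 b x - α * dθ a x) ^ 2) = 
      ‖x‖ ^ 2 * ((d0 a x ^ 2 + d1 a x ^ 2) + (d0 b x ^ 2 + d1 b x ^ 2) + 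
        2 * α * (d0 a x * d1 b x - d1 a x * d0 b x)) - (1 - α ^ 2) * (dθ a x ^ 2 + dθ b x ^ 2) := by
      rw [hn]; simp only [dθ]; ring
    rw [hid] at hT
    linarith
end

lemma main_real (α : ℝ) (hα : 0 ≤ α) (hα1 : α < 1) (a b : E2 → ℝ) (ha : ContDiff ℝ 1 a)
    (hb : ContDiff ℝ 1 b) (sa : HasCompactSupport a) (sb : HasCompactSupport b) (d : ℝ) (hd : 0 < d)
    (hd1 : d ≤ (1 - α) ^ 2) :
    d / (2 * α + d) * (∫ x, (wt α x * (d0 a x ^ 2 + d1 a x ^ 2) + wt α x * (d0 b x ^ 2 + d1 b x ^ 2))) ≤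
    ∫ x, ((wt α x * (d0 a x ^ 2 + d1 a x ^ 2) + wt α x * (d0 b x ^ 2 + d1 b x ^ 2)) +
      2 * (wt α x * (d0 a x * d1 b x - d1 a x * d0 b x))) := by
  have iN : Integrable (fun x => wt α x * (d0 a x ^ 2 + d1 a x ^ 2) +
      wt α x * (d0 b x ^ 2 + d1 b x ^ 2)) := (wN_int (α := α) ha sa).add (wN_int (α := α) hb sb)
  have iJ := (wJ_int (α := α) ha hb sb).const_mul 2
  have iK := kab_int hα ha hb sb
  have iS : Integrable (fun x => kap α x * dθ a x ^ 2 + kap α x * dθ b x ^ 2) := (ksq_int hα ha sa).add (ksq_int hα hb sb)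
  have hmono := integral_mono ((iJ.const_mul (2 * α * (1 - α))).add (iS.const_mul (1 - α ^ 2)))
    ((iN.add iJ).const_mul (2 * α)) (fun x => ptwise (a := a) (b := b) hα hα1 x)
  have hang := ang hα ha hb sa sb
  have hcurl := curl_w hα ha hb sa sb
  have e1 : ∫ x, kap α x * (dθ a x ^ 2 + dθ b x ^ 2 + 2 * (a x * dθ b x)) =
     (∫ x, (kap α x * dθ a x ^ 2 + kap α x * dθ b x ^ 2)) + 2 * ∫ x, kap α x * (a x * dθ b x) := by
    rw [← integral_const_mul, ← integral_add iS (iK.const_mul 2)]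
    congr 1; ext x; ring
  have e2 := integral_add iN iJ
  have e3 := integral_add (iJ.const_mul (2 * α * (1 - α))) (iS.const_mul (1 - α ^ 2))
  simp only [Pi.add_apply, integral_const_mul] at e2 e3 hmono
  rw [e3, e2] at hmono
  rw [e2]
  rw [e1, ← hcurl] at hang
  have hB : 0 ≤ ∫ x, (wt α x * (d0 a x ^ 2 + d1 a x ^ 2) + wt α x * (d0 b x ^ 2 + d1 b x ^ 2)) :=
    integral_nonneg fun x => by have := wt_pos α x; positivity
  have hA : 0 ≤ ∫ x, ((wt α x * (d0 a x ^ 2 + d1 a x ^ 2) + wt α x * (d0 b x ^ 2 + d1 b x ^ 2)) +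
      2 * (wt α x * (d0 a x * d1 b x - d1 a x * d0 b x))) :=
    integral_nonneg fun x => by
      have := wt_pos α x
      have e : ((wt α x * (d0 a x ^ 2 + d1 a x ^ 2) + wt α x * (d0 b x ^ 2 + d1 b x ^ 2)) +
        2 * (wt α x * (d0 a x * d1 b x - d1 a x * d0 b x))) =
        wt α x * ((d0 a x + d1 b x) ^ 2 + (d1 a x - d0 b x) ^ 2) := by ring
      simp only [Pi.zero_apply]
      rw [e]; positivity
  rw [e2] at hA
  generalize (∫ x, (wt α x * (d0 a x ^ 2 + d1 a x ^ 2) + wt α x * (d0 b x ^ 2 + d1 b x ^ 2))) = B at *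
  generalize (∫ x, wt α x * (d0 a x * d1 b x - d1 a x * d0 b x)) = P at *
  generalize (∫ x, (kap α x * dθ a x ^ 2 + kap α x * dθ b x ^ 2)) = Q at *
  have hpos : 0 < 2 * α + d := by positivity
  rw [div_mul_eq_mul_div, div_le_iff₀ hpos]
  have h1 : 0 ≤ 1 - α ^ 2 := by nlinarith
  have h2 := mul_nonneg h1 hang
  have h3 : 0 ≤ 2 * α * (B + 2 * P) := by positivity
  rcases le_total 0 P with hP | hP
  · nlinarith [mul_nonneg hd.le hP]
  · nlinarith [mul_nonneg (sub_nonneg.2 hd1) (neg_nonneg.2 hP)]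

/-- Proposition: lower bound for the weighted `(∂₁ - i∂₂)`-Dirichlet integral with
weight `(1+|x|)^{-2α}`, `0 ≤ α < 1`. -/
theorem weighted_lower_bound_minus
    (α : ℝ) (hα0 : 0 ≤ α) (hα1 : α < 1)
    (φ : EuclideanSpace ℝ (Fin 2) → ℂ)
    (hφ : ContDiff ℝ 1 φ) (hsupp : HasCompactSupport φ) :
    ∫ x : EuclideanSpace ℝ (Fin 2),
        (1 + ‖x‖) ^ (-(2 * α)) *
          ‖fderiv ℝ φ x (EuclideanSpace.single 0 1) -
            Complex.I * fderiv ℝ φ x (EuclideanSpace.single 1 1)‖ ^ 2 ≥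
      (2 : ℝ) ^ (-2 * α - 1) * (1 - α) ^ 2 /
          (2 * α + (2 : ℝ) ^ (-2 * α - 1) * (1 - α) ^ 2) *
        ∫ x : EuclideanSpace ℝ (Fin 2),
          (1 + ‖x‖) ^ (-(2 * α)) *
            (‖fderiv ℝ φ x (EuclideanSpace.single 0 1)‖ ^ 2 +
              ‖fderiv ℝ φ x (EuclideanSpace.single 1 1)‖ ^ 2) := by
  have h1 : 0 < 1 - α := by linarith
  have h2 : (2:ℝ) ^ (-2 * α - 1) ≤ 1 :=
    rpow_le_one_of_one_le_of_nonpos (by norm_num) (by linarith)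
  have hre : ∀ x v, fderiv ℝ (fun x => (φ x).re) x v = (fderiv ℝ φ x v).re := by
    intro x v
    have := (Complex.reCLM.hasFDerivAt.comp x ((hφ.differentiable one_ne_zero) x).hasFDerivAt).fderiv
    exact congrArg (fun L => L v) this
  have him : ∀ x v, fderiv ℝ (fun x => (φ x).im) x v = (fderiv ℝ φ x v).im := by
    intro x v
    have := (Complex.imCLM.hasFDerivAt.comp x ((hφ.differentiable one_ne_zero) x).hasFDerivAt).fderiv
    exact congrArg (fun L => L v) this
  have key := main_real α hα0 hα1 (fun x => (φ x).re) (fun x => (φ x).im)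
    (Complex.reCLM.contDiff.comp hφ) (Complex.imCLM.contDiff.comp hφ)
    (hsupp.comp_left (g := Complex.re) rfl) (hsupp.comp_left (g := Complex.im) rfl)
    ((2 : ℝ) ^ (-2 * α - 1) * (1 - α) ^ 2) (by positivity)
    (mul_le_of_le_one_left (by positivity) h2)
  simp only [d0, d1, hre, him, wt] at key
  refine ge_iff_le.2 (le_of_eq_of_le ?_ (le_of_le_of_eq key ?_))
  · congr 2; ext x
    simp only [Complex.sq_norm, Complex.normSq_apply]; ring
  · congr 1; ext x
    simp only [Complex.sq_norm, Complex.normSq_apply, Complex.sub_re, Complex.sub_im,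
      Complex.mul_re, Complex.mul_im, Complex.I_re, Complex.I_im]; ring
end

section
/- Let 0 ≤ α < 1, let h : ℝ² → ℝ be measurable, and assume that the two numbers m⁺ = esssup_{x∈ℝ²} e^{h(x)}/(1+|x|)^{α} and m⁻ = esssup_{x∈ℝ²} e^{-h(x)}/(1+|x|)^{-α} are both finite. Set q_α = 2^{-2α-1}(1-α)² / (2α + 2^{-2α-1}(1-α)²). Then for every continuously differentiable compactly supported function φ : ℝ² → ℂ one has ∫_{ℝ²} e^{2h(x)} |(∂₁ + i∂₂)φ(x)|² dx ≥ q_α (m⁻)^{-2} ∫_{ℝ²} (1+|x|)^{2α} |∇φ(x)|² dx and ∫_{ℝ²} e^{-2h(x)} |(∂₁ - i∂₂)φ(x)|² dx ≥ q_α (m⁺)^{-2} ∫_{ℝ²} (1+|x|)^{-2α} |∇φ(x)|² dx. -/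
open MeasureTheory Real

theorem pf_memLp {f : ℝ → ℂ} (a b : ℝ) (hf : Continuous f) :
    MemLp f 2 (volume.restrict (Set.Ioc a b)) := by
  obtain ⟨C, hC⟩ := (isCompact_Icc (a := a) (b := b)).exists_bound_of_continuousOn hf.continuousOn
  refine MemLp.of_bound hf.aestronglyMeasurable C ?_
  rw [ae_restrict_iff' measurableSet_Ioc]
  exact Filter.Eventually.of_forall fun x hx => hC x ⟨hx.1.le, hx.2⟩

theorem pf_wirtinger {a b : ℝ} (hab : a < b) {f f' : ℝ → ℂ} (hf : ∀ x, HasDerivAt f (f' x) x)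
    (hf' : Continuous f') (hper : f a = f b) (hmean : ∫ x in a..b, f x = 0) :
    (2 * π) ^ 2 * ∫ x in a..b, ‖f x‖ ^ 2 ≤ (b - a) ^ 2 * ∫ x in a..b, ‖f' x‖ ^ 2 := by
  have hfc : Continuous f := continuous_iff_continuousAt.2 fun x => (hf x).continuousAt
  have h1 := hasSum_sq_fourierCoeffOn hab (pf_memLp a b hfc)
  have h2 := hasSum_sq_fourierCoeffOn hab (pf_memLp a b hf')
  have key : ∀ n : ℤ, (2 * π) ^ 2 * ‖fourierCoeffOn hab f n‖ ^ 2 ≤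
      (b - a) ^ 2 * ‖fourierCoeffOn hab f' n‖ ^ 2 := by
    intro n
    by_cases hn : n = 0
    · subst hn
      have : fourierCoeffOn hab f 0 = 0 := by
        rw [fourierCoeffOn_eq_integral]
        simp [hmean]
      rw [this]; simp; positivity
    · have h := fourierCoeffOn_of_hasDerivAt hab hn (fun x _ => hf x)
        (hf'.intervalIntegrable a b)
      have h3 : ‖fourierCoeffOn hab f n‖ * (2 * π * |(n:ℝ)|) = (b - a) * ‖fourierCoeffOn hab f' n‖ := by
        rw [h, hper, sub_self, mul_zero, zero_sub, norm_mul, norm_div, norm_neg, norm_mul, norm_mul (↑b - ↑a : ℂ)]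
        have : ‖(b:ℂ) - a‖ = b - a := by
          rw [← Complex.ofReal_sub, Complex.norm_real, Real.norm_of_nonneg (by linarith)]
        rw [this]
        simp [abs_of_pos pi_pos]
        field_simp
      have h4 : (1:ℝ) ≤ |(n:ℝ)| := by
        exact_mod_cast Int.one_le_abs hn
      rw [← mul_pow, ← mul_pow, ← h3]
      refine pow_le_pow_left₀ (by positivity) ?_ 2
      have := norm_nonneg (fourierCoeffOn hab f n)
      have h5 : 2 * π ≤ 2 * π * |(n:ℝ)| := le_mul_of_one_le_right (by positivity) h4
      nlinarith
  have h6 := hasSum_le key (h1.mul_left _) (h2.mul_left _)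
  have hba : 0 < b - a := by linarith
  simp only [smul_eq_mul] at h6
  have h7 := mul_le_mul_of_nonneg_left h6 hba.le
  field_simp at h7
  nlinarith

/-- Continuous functions of two variables: boundedness on a compact strip. -/
theorem pf_bound {E : Type*} [NormedAddCommGroup E] {F : ℝ → ℝ → E}
    (hF : Continuous fun p : ℝ × ℝ => F p.1 p.2) (s a b : ℝ) :
    ∃ C, 0 ≤ C ∧ ∀ r ∈ Set.Icc (s-1) (s+1), ∀ t ∈ Set.uIcc a b, ‖F r t‖ ≤ C := by
  obtain ⟨C, hC⟩ := (isCompact_Icc.prod isCompact_uIcc :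
    IsCompact (Set.Icc (s-1) (s+1) ×ˢ Set.uIcc a b)).exists_bound_of_continuousOn hF.continuousOn
  exact ⟨max C 0, le_max_right _ _, fun r hr t ht => (hC (r,t) ⟨hr, ht⟩).trans (le_max_left _ _)⟩

theorem pf_deriv_int {F F' : ℝ → ℝ → ℝ}
    (hF : Continuous fun p : ℝ × ℝ => F p.1 p.2) (hF' : Continuous fun p : ℝ × ℝ => F' p.1 p.2)
    (hd : ∀ r t, HasDerivAt (fun r => F r t) (F' r t) r) (a b s : ℝ) :
    HasDerivAt (fun r => ∫ t in a..b, F r t) (∫ t in a..b, F' s t) s := by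
  obtain ⟨C, hC0, hC⟩ := pf_bound hF' s a b
  have hFc : ∀ r, Continuous (F r) := fun r => hF.comp (by fun_prop : Continuous fun t : ℝ => (r,t))
  have hFc' : ∀ r, Continuous (F' r) := fun r => hF'.comp (by fun_prop : Continuous fun t : ℝ => (r,t))
  refine (intervalIntegral.hasDerivAt_integral_of_dominated_loc_of_deriv_le (bound := fun _ => C)
    (Icc_mem_nhds (by linarith : s - 1 < s) (by linarith : s < s + 1))
    (Filter.Eventually.of_forall fun r => (hFc r).aestronglyMeasurable)
    ((hFc s).intervalIntegrable a b) (hFc' s).aestronglyMeasurable ?_ (by simp) ?_).2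
  · exact Filter.Eventually.of_forall fun t ht r hr => hC r hr t (Set.uIoc_subset_uIcc ht)
  · exact Filter.Eventually.of_forall fun t ht r hr => hd r t

theorem pf_re {f : ℝ → ℂ} {f' : ℂ} {x : ℝ} (h : HasDerivAt f f' x) :
    HasDerivAt (fun x => (f x).re) f'.re x :=
  Complex.reCLM.hasFDerivAt.comp_hasDerivAt x h

theorem pf_im {f : ℝ → ℂ} {f' : ℂ} {x : ℝ} (h : HasDerivAt f f' x) :
    HasDerivAt (fun x => (f x).im) f'.im x :=
  Complex.imCLM.hasFDerivAt.comp_hasDerivAt x h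

theorem pf_deriv_J {u ur ut : ℝ → ℝ → ℂ}
    (hur : Continuous fun p : ℝ × ℝ => ur p.1 p.2)
    (hut : Continuous fun p : ℝ × ℝ => ut p.1 p.2)
    (hdr : ∀ r t, HasDerivAt (fun r => u r t) (ur r t) r)
    (hdt : ∀ r t, HasDerivAt (fun t => u r t) (ut r t) t)
    (a b : ℝ) (hper : ∀ r, u r a = u r b) (s : ℝ) :
    HasDerivAt (fun r => ∫ t in a..b, (star (u r t) * ut r t).im)
      (∫ t in a..b, 2 * (star (ur s t) * ut s t).im) s := by
  have huc : ∀ r, Continuous (u r) := fun r =>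
    continuous_iff_continuousAt.2 fun x => (hdt r x).continuousAt
  have hutc : ∀ r, Continuous (ut r) := fun r => hut.comp (by fun_prop : Continuous fun t : ℝ => (r,t))
  have hurc : ∀ r, Continuous (ur r) := fun r => hur.comp (by fun_prop : Continuous fun t : ℝ => (r,t))
  have hutc' : ∀ t, Continuous (fun r => ut r t) := fun t => hut.comp (by fun_prop : Continuous fun r : ℝ => (r,t))
  have key : ∀ r, (∫ t in a..b, (star (u r t) * ut r t).im) - (∫ t in a..b, (star (u s t) * ut s t).im)
      = ∫ t in a..b, (star (u r t - u s t) * (ut r t + ut s t)).im := by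
    intro r
    have hI : ∀ t, HasDerivAt (fun t => (star (u s t) * u r t).im)
        ((star (ut s t) * u r t).im + (star (u s t) * ut r t).im) t := by
      intro t
      have h1 := ((pf_re (hdt s t)).mul (pf_im (hdt r t))).sub ((pf_im (hdt s t)).mul (pf_re (hdt r t)))
      refine HasDerivAt.congr_deriv
        (h1.congr_of_eventuallyEq (Filter.Eventually.of_forall fun t => ?_)) ?_
      · simp; ring
      · simp; ring
    have h2 := intervalIntegral.integral_eq_sub_of_hasDerivAt (fun t _ => hI t)
      (a := a) (b := b) (by apply Continuous.intervalIntegrable; fun_prop)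
    rw [hper r, hper s, sub_self] at h2
    have hIntg : ∀ g : ℝ → ℝ, Continuous g → IntervalIntegrable g volume a b :=
      fun g hg => hg.intervalIntegrable a b
    rw [← intervalIntegral.integral_sub (hIntg _ (by fun_prop)) (hIntg _ (by fun_prop)),
      ← sub_eq_zero, ← intervalIntegral.integral_sub (hIntg _ (by fun_prop)) (hIntg _ (by fun_prop)), ← h2]
    congr 1; ext t
    simp
    ring
  obtain ⟨C, hC0, hC⟩ := pf_bound hur s a b
  obtain ⟨D, hD0, hD⟩ := pf_bound hut s a b
  rw [hasDerivAt_iff_tendsto_slope]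
  have hsl : slope (fun r => ∫ t in a..b, (star (u r t) * ut r t).im) s = fun r =>
      ∫ t in a..b, (r - s)⁻¹ * (star (u r t - u s t) * (ut r t + ut s t)).im := by
    ext r
    rw [slope_def_field, key, intervalIntegral.integral_const_mul, div_eq_inv_mul]
  rw [hsl]
  refine intervalIntegral.tendsto_integral_filter_of_dominated_convergence (fun _ => C * (D + D)) ?_ ?_ (by simp) ?_
  · exact Filter.Eventually.of_forall fun r => Continuous.aestronglyMeasurable (by fun_prop)
  · have : Set.Icc (s-1) (s+1) ∈ nhdsWithin s {s}ᶜ := mem_nhdsWithin_of_mem_nhds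
      (Icc_mem_nhds (by linarith : s - 1 < s) (by linarith : s < s + 1))
    filter_upwards [this, self_mem_nhdsWithin] with r hr hrs
    refine Filter.Eventually.of_forall fun t ht => ?_
    have ht := Set.uIoc_subset_uIcc ht
    have hs : s ∈ Set.Icc (s-1) (s+1) := ⟨by linarith, by linarith⟩
    have h1 : ‖u r t - u s t‖ ≤ C * ‖r - s‖ :=
      (convex_Icc (s-1) (s+1)).norm_image_sub_le_of_norm_hasDerivWithin_le
        (fun x _ => (hdr x t).hasDerivWithinAt) (fun x hx => hC x hx t ht) hs hr
    have h2 : ‖ut r t + ut s t‖ ≤ D + D := (norm_add_le _ _).trans (add_le_add (hD r hr t ht) (hD s hs t ht))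
    have hrs' : 0 < ‖r - s‖ := norm_pos_iff.2 (sub_ne_zero.2 hrs)
    rw [norm_mul, norm_inv]
    calc ‖r - s‖⁻¹ * ‖(star (u r t - u s t) * (ut r t + ut s t)).im‖
        ≤ ‖r - s‖⁻¹ * (‖u r t - u s t‖ * ‖ut r t + ut s t‖) := by
          gcongr
          refine (Complex.abs_im_le_norm _).trans ?_
          rw [norm_mul, norm_star]
      _ ≤ ‖r - s‖⁻¹ * ((C * ‖r - s‖) * (D + D)) := by gcongr
      _ = C * (D + D) := by field_simp
  · refine Filter.Eventually.of_forall fun t ht => ?_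
    have h1 := hasDerivAt_iff_tendsto_slope.1 (hdr s t)
    have h2 : Filter.Tendsto (fun r => ut r t + ut s t) (nhdsWithin s {s}ᶜ) (nhds (ut s t + ut s t)) :=
      (((hutc' t).add continuous_const).tendsto s).mono_left nhdsWithin_le_nhds
    have h3 := (Complex.continuous_im.tendsto _).comp (((continuous_star.tendsto _).comp h1).mul h2)
    convert h3 using 1
    · ext r
      simp only [slope_def_module, Function.comp, star_smul, star_trivial, smul_mul_assoc, Complex.smul_im, smul_eq_mul]
    · congr 1; simp; ring

theorem pf_ptw (v w : ℂ) (l : ℝ) :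
    2 * l * (star v * w).im ≤ ‖w‖ ^ 2 + l ^ 2 * ‖v‖ ^ 2 := by
  rw [← Complex.normSq_eq_norm_sq, ← Complex.normSq_eq_norm_sq, Complex.normSq_apply, Complex.normSq_apply]
  simp
  nlinarith [sq_nonneg (w.im - l * v.re), sq_nonneg (w.re + l * v.im)]

theorem pf_J_bound {v w : ℝ → ℂ} (hv : Continuous v) (hw : Continuous w) {a b : ℝ} (hab : a ≤ b) (l : ℝ) :
    2 * l * ∫ t in a..b, (star (v t) * w t).im ≤
      (∫ t in a..b, ‖w t‖ ^ 2) + l ^ 2 * ∫ t in a..b, ‖v t‖ ^ 2 := by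
  have hIntg : ∀ g : ℝ → ℝ, Continuous g → IntervalIntegrable g volume a b :=
      fun g hg => hg.intervalIntegrable a b
  rw [← intervalIntegral.integral_const_mul, ← intervalIntegral.integral_const_mul,
    ← intervalIntegral.integral_add (hIntg _ (by fun_prop)) (hIntg _ (by fun_prop))]
  exact intervalIntegral.integral_mono_on hab (hIntg _ (by fun_prop)) (hIntg _ (by fun_prop))
    fun t _ => pf_ptw _ _ _

theorem pf_shift {E : Type*} [NormedAddCommGroup E] [NormedSpace ℝ E] (f : ℝ → E) :
    ∫ t in (-π)..0, f (t + π) = ∫ t in 0..π, f t := by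
  rw [intervalIntegral.integral_comp_add_right]; simp

theorem pf_odd {v w : ℝ → ℂ} (hd : ∀ t, HasDerivAt v (w t) t) (hw : Continuous w)
    (hodd : ∀ t, v (t + π) = - v t) :
    (∫ t in (-π)..π, ‖v t‖ ^ 2) ≤ ∫ t in (-π)..π, ‖w t‖ ^ 2 := by
  have hv : Continuous v := continuous_iff_continuousAt.2 fun x => (hd x).continuousAt
  have hm : ∫ t in (-π)..π, v t = 0 := by
    rw [← intervalIntegral.integral_add_adjacent_intervals (b := 0) (hv.intervalIntegrable _ _)
      (hv.intervalIntegrable _ _), ← pf_shift]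
    simp [hodd]
  have hper : v (-π) = v π := by
    have h1 := hodd (-π)
    have h2 := hodd 0
    simp at h1 h2
    rw [h2, h1]; simp
  have h := pf_wirtinger (by linarith [pi_pos] : -π < π) hd hw hper hm
  rw [show π - -π = 2 * π by ring] at h
  exact le_of_mul_le_mul_left h (by positivity)

theorem pf_even {v w : ℝ → ℂ} (hd : ∀ t, HasDerivAt v (w t) t) (hw : Continuous w)
    (heven : ∀ t, v (t + π) = v t) :
    2 * |∫ t in (-π)..π, (star (v t) * w t).im| ≤ ∫ t in (-π)..π, ‖w t‖ ^ 2 := by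
  have hv : Continuous v := continuous_iff_continuousAt.2 fun x => (hd x).continuousAt
  set m : ℂ := (π:ℂ)⁻¹ * ∫ t in 0..π, v t with hmdef
  have hπ : (π:ℂ) ≠ 0 := by exact_mod_cast pi_ne_zero
  have hm1 : ∫ t in 0..π, (v t - m) = 0 := by
    rw [intervalIntegral.integral_sub (hv.intervalIntegrable _ _) (by simp)]
    simp only [intervalIntegral.integral_const, sub_zero, Complex.real_smul]
    rw [hmdef]; field_simp; simp
  have hm2 : ∫ t in (-π)..0, (v t - m) = 0 := by
    rw [← hm1, ← pf_shift]; simp [heven]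
  have hd' : ∀ t, HasDerivAt (fun t => v t - m) (w t) t := fun t => (hd t).sub_const m
  have hp1 : v 0 = v π := by have := heven 0; simp at this; exact this.symm
  have hp2 : v (-π) = v 0 := by have := heven (-π); simp at this; exact this.symm
  have h1 := pf_wirtinger pi_pos hd' hw (by simp [hp1]) hm1
  have h2 := pf_wirtinger (by linarith [pi_pos] : -π < 0) hd' hw (by simp [hp2]) hm2
  have hIntg : ∀ (g : ℝ → ℝ) (a b : ℝ), Continuous g → IntervalIntegrable g volume a b :=
      fun g a b hg => hg.intervalIntegrable a b
  have hvm : Continuous fun t => v t - m := by fun_prop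
  have h3 : 4 * (∫ t in (-π)..π, ‖v t - m‖ ^ 2) ≤ ∫ t in (-π)..π, ‖w t‖ ^ 2 := by
    rw [← intervalIntegral.integral_add_adjacent_intervals (b := 0) (hIntg _ _ _ (by fun_prop))
      (hIntg _ _ _ (by fun_prop)), ← intervalIntegral.integral_add_adjacent_intervals (a := -π) (b := 0) (c := π) (f := fun t => ‖w t‖ ^ 2) (hIntg _ _ _ (by fun_prop))
      (hIntg _ _ _ (by fun_prop))]
    have hp : 0 < π ^ 2 := by positivity
    refine le_of_mul_le_mul_left (a := π ^ 2) ?_ hp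
    linarith
  have hw0 : ∫ t in (-π)..π, w t = 0 := by
    rw [intervalIntegral.integral_eq_sub_of_hasDerivAt (fun t _ => hd t) (hw.intervalIntegrable _ _)]
    rw [hp2, hp1, sub_self]
  have hJ : ∫ t in (-π)..π, (star (v t) * w t).im = ∫ t in (-π)..π, (star (v t - m) * w t).im := by
    rw [← sub_eq_zero, ← intervalIntegral.integral_sub (hIntg _ _ _ (by fun_prop)) (hIntg _ _ _ (by fun_prop))]
    have h5 : ∫ t in (-π)..π, (star m * w t) = 0 := by
      rw [intervalIntegral.integral_const_mul, hw0, mul_zero]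
    have h6 := Complex.imCLM.intervalIntegral_comp_comm (μ := volume) (a := -π) (b := π) (f := fun t => star m * w t)
      (Continuous.intervalIntegrable (by fun_prop) _ _)
    rw [h5, map_zero] at h6
    rw [← h6]
    congr 1; ext t; simp; ring
  have hle : -π ≤ π := by linarith [pi_pos]
  have h7 := pf_J_bound hvm hw hle 2
  have h8 := pf_J_bound hvm hw hle (-2)
  rw [hJ]
  have : |∫ t in (-π)..π, (star (v t - m) * w t).im| ≤ (∫ t in (-π)..π, ‖w t‖ ^ 2) / 2 := by
    rw [abs_le]; constructor <;> linarith
  linarith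

theorem pf_radial {u a b : ℝ → ℝ → ℂ} {β δ k R : ℝ} (hk : 0 ≤ k) (hR : 0 < R)
    (hac : Continuous fun p : ℝ × ℝ => a p.1 p.2)
    (hbc : Continuous fun p : ℝ × ℝ => b p.1 p.2)
    (huc : Continuous fun p : ℝ × ℝ => u p.1 p.2)
    (hdr : ∀ r t, HasDerivAt (fun r => u r t) (a r t) r)
    (hdt : ∀ r t, HasDerivAt (fun t => u r t) (r * b r t) t)
    (hper : ∀ r, u r (-π) = u r π)
    (huR : ∀ t, u R t = 0) (hu0 : δ = 0 ∨ ∀ t, u 0 t = 0)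
    (H : ∀ r, 0 < r → 0 ≤ k * ((∫ t in (-π)..π, ‖r * b r t‖ ^ 2) - δ ^ 2 * ∫ t in (-π)..π, ‖u r t‖ ^ 2)
      + 2 * β * (r / (1 + r)) * ((∫ t in (-π)..π, (star (u r t) * (r * b r t)).im)
        + k * δ * ∫ t in (-π)..π, ‖u r t‖ ^ 2)) :
    0 ≤ ∫ r in (0:ℝ)..R, (1 + r) ^ (2 * β) * r * ∫ t in (-π)..π,
      (k * (‖a r t‖ ^ 2 + ‖b r t‖ ^ 2) - 2 * (star (a r t) * b r t).im) := by
  have hle : -π ≤ π := by linarith [pi_pos]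
  have hI : ∀ g : ℝ → ℝ, Continuous g → IntervalIntegrable g volume (-π) π :=
      fun g hg => hg.intervalIntegrable _ _
  have hIc : ∀ g : ℝ → ℝ → ℝ, (Continuous fun p : ℝ × ℝ => g p.1 p.2) →
      Continuous fun r => ∫ t in (-π)..π, g r t := fun g hg =>
    intervalIntegral.continuous_parametric_intervalIntegral_of_continuous' hg _ _
  have hslice : ∀ {g : ℝ → ℝ → ℂ}, (Continuous fun p : ℝ × ℝ => g p.1 p.2) → ∀ r, Continuous (g r) :=
    fun hg r => hg.comp (by fun_prop : Continuous fun t : ℝ => (r,t))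
  have ha := hslice hac
  have hb := hslice hbc
  have hu := hslice huc
  set B : ℝ → ℝ := fun r => ∫ t in (-π)..π, ‖u r t‖ ^ 2 with hB
  set B' : ℝ → ℝ := fun r => ∫ t in (-π)..π, 2 * (star (u r t) * a r t).re with hB'
  set J : ℝ → ℝ := fun r => ∫ t in (-π)..π, (star (u r t) * (r * b r t)).im with hJ
  set J' : ℝ → ℝ := fun r => ∫ t in (-π)..π, 2 * (star (a r t) * (r * b r t)).im with hJ'
  set W : ℝ → ℝ := fun r => (1 + r) ^ (2 * β) with hW
  set W' : ℝ → ℝ := fun r => 2 * β * (1 + r) ^ (2 * β - 1) with hW'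
  have hBd : ∀ r, HasDerivAt B (B' r) r := by
    intro s
    apply pf_deriv_int (F := fun r t => ‖u r t‖ ^ 2) (F' := fun r t => 2 * (star (u r t) * a r t).re)
    · fun_prop
    · fun_prop
    · intro r t
      have h1 := ((pf_re (hdr r t)).mul (pf_re (hdr r t))).add ((pf_im (hdr r t)).mul (pf_im (hdr r t)))
      refine HasDerivAt.congr_deriv
        (h1.congr_of_eventuallyEq (Filter.Eventually.of_forall fun t => ?_)) ?_
      · simp [← Complex.normSq_eq_norm_sq, Complex.normSq_apply]
      · simp; ring
  have hJd : ∀ r, HasDerivAt J (J' r) r := by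
    intro s
    exact pf_deriv_J (ut := fun r t => r * b r t) hac (by fun_prop) hdr hdt _ _ hper s
  have hWd : ∀ r, 0 ≤ r → HasDerivAt W (W' r) r := by
    intro r hr
    have h1 := ((hasDerivAt_id r).const_add 1).rpow_const (p := 2 * β) (Or.inl (by simp; linarith))
    refine h1.congr_deriv ?_
    simp [hW']
  have hBc : Continuous B' := hIc (fun r t => 2 * (star (u r t) * a r t).re) (by fun_prop)
  have hJc : Continuous J' := hIc (fun r t => 2 * (star (a r t) * (r * b r t)).im) (by fun_prop)
  have hBc0 : Continuous B := continuous_iff_continuousAt.2 fun x => (hBd x).continuousAt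
  have hJc0 : Continuous J := continuous_iff_continuousAt.2 fun x => (hJd x).continuousAt
  set S : ℝ → ℝ := fun r => ∫ t in (-π)..π,
      (k * (‖a r t‖ ^ 2 + ‖b r t‖ ^ 2) - 2 * (star (a r t) * b r t).im) with hS
  have hSc : Continuous S := hIc (fun r t => k * (‖a r t‖ ^ 2 + ‖b r t‖ ^ 2) - 2 * (star (a r t) * b r t).im) (by fun_prop)
  set F' : ℝ → ℝ := fun r => W' r * (J r + k * δ * B r) + W r * (J' r + k * δ * B' r) with hF'
  have hFd : ∀ r ∈ Set.uIcc 0 R, HasDerivAt (fun r => W r * (J r + k * δ * B r)) (F' r) r := by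
    intro r hr
    rw [Set.uIcc_of_le hR.le] at hr
    exact (hWd r hr.1).mul ((hJd r).add ((hBd r).const_mul (k * δ)))
  have hpw : ∀ p : ℝ, ContinuousOn (fun r : ℝ => (1 + r) ^ p) (Set.uIcc 0 R) := by
    intro p
    rw [Set.uIcc_of_le hR.le]
    exact ContinuousOn.rpow_const (by fun_prop) fun x hx => Or.inl (by linarith [hx.1])
  have hWc : ContinuousOn W (Set.uIcc 0 R) := hpw _
  have hWc' : ContinuousOn W' (Set.uIcc 0 R) := continuousOn_const.mul (hpw _)
  have hF'i : IntervalIntegrable F' volume 0 R := by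
    apply ContinuousOn.intervalIntegrable
    fun_prop
  have hFTC := intervalIntegral.integral_eq_sub_of_hasDerivAt hFd hF'i
  have hBR : B R = 0 := by simp [hB, huR]
  have hJR : J R = 0 := by simp [hJ, huR]
  have hJ0 : J 0 = 0 := by simp [hJ]
  have hB0 : δ * B 0 = 0 := by
    rcases hu0 with h | h
    · simp [h]
    · simp [hB, h]
  rw [hBR, hJR, hJ0, mul_assoc k δ (B 0), hB0] at hFTC
  simp only [mul_zero, add_zero, sub_zero] at hFTC
  have hSi : IntervalIntegrable (fun r => W r * r * S r) volume 0 R := by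
    apply ContinuousOn.intervalIntegrable
    fun_prop
  have hsum : ∫ r in (0:ℝ)..R, W r * r * S r = ∫ r in (0:ℝ)..R, (W r * r * S r + F' r) := by
    rw [intervalIntegral.integral_add hSi hF'i, hFTC, add_zero]
  rw [hsum]
  rw [intervalIntegral.integral_of_le hR.le]
  refine setIntegral_nonneg measurableSet_Ioc fun r hr => ?_
  have hr0 : 0 < r := hr.1
  have hr1 : 0 < 1 + r := by linarith
  have hWpos : 0 < W r := rpow_pos_of_pos hr1 _
  have hWW : W' r * (1 + r) = 2 * β * W r := by
    simp only [hW', hW]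
    rw [mul_assoc, ← rpow_add_one hr1.ne']
    congr 2; ring
  have haI := ha r
  have hbI := hb r
  have huI := hu r
  set A := ∫ t in (-π)..π, ‖a r t‖ ^ 2 with hA
  set D := ∫ t in (-π)..π, ‖b r t‖ ^ 2 with hD
  set N := ∫ t in (-π)..π, (star (a r t) * b r t).im with hN
  have hSr : S r = k * (A + D) - 2 * N := by
    simp only [hS, hA, hD, hN]
    rw [intervalIntegral.integral_sub (hI _ (by fun_prop)) (hI _ (by fun_prop)),
      intervalIntegral.integral_const_mul, intervalIntegral.integral_const_mul,
      intervalIntegral.integral_add (hI _ (by fun_prop)) (hI _ (by fun_prop))]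
  have hJr : J' r = r * (2 * N) := by
    simp only [hJ', hN]
    rw [← intervalIntegral.integral_const_mul, ← intervalIntegral.integral_const_mul]
    congr 1; ext t; simp; ring
  have hA2 : (∫ t in (-π)..π, ‖r * b r t‖ ^ 2) = r ^ 2 * D := by
    simp only [hD]
    rw [← intervalIntegral.integral_const_mul]
    congr 1; ext t; simp [mul_pow]
  have hsq : 0 ≤ r ^ 2 * A + δ * r * B' r + δ ^ 2 * B r := by
    have h0 : 0 ≤ ∫ t in (-π)..π, (r ^ 2 * ‖a r t‖ ^ 2 + δ * r * (2 * (star (u r t) * a r t).re)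
        + δ ^ 2 * ‖u r t‖ ^ 2) := by
      refine intervalIntegral.integral_nonneg hle fun t _ => ?_
      rw [← Complex.normSq_eq_norm_sq, ← Complex.normSq_eq_norm_sq, Complex.normSq_apply,
        Complex.normSq_apply]
      simp
      nlinarith [sq_nonneg (r * (a r t).re + δ * (u r t).re), sq_nonneg (r * (a r t).im + δ * (u r t).im)]
    rw [intervalIntegral.integral_add (hI _ (by fun_prop)) (hI _ (by fun_prop)),
      intervalIntegral.integral_add (hI _ (by fun_prop)) (hI _ (by fun_prop))] at h0
    simp only [hB', hB, hA, intervalIntegral.integral_const_mul] at h0 ⊢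
    exact h0
  have hH := H r hr0
  rw [hA2] at hH
  change 0 ≤ k * (r ^ 2 * D - δ ^ 2 * B r) + 2 * β * (r / (1 + r)) * (J r + k * δ * B r) at hH
  have hW1 : W' r = 2 * β * W r / (1 + r) := by field_simp; linarith
  have hfin : r * (W r * r * S r + F' r) = W r * (k * (r ^ 2 * A + δ * r * B' r + δ ^ 2 * B r) +
      (k * (r ^ 2 * D - δ ^ 2 * B r) + 2 * β * (r / (1 + r)) * (J r + k * δ * B r))) := by
    simp only [hF']
    rw [hSr, hJr, hW1]
    ring
  have : 0 ≤ r * (W r * r * S r + F' r) := by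
    rw [hfin]; positivity
  exact nonneg_of_mul_nonneg_right this hr0

theorem pf_radial_even {u a b : ℝ → ℝ → ℂ} {β k R : ℝ} (hk : |β| ≤ k) (hR : 0 < R)
    (hac : Continuous fun p : ℝ × ℝ => a p.1 p.2)
    (hbc : Continuous fun p : ℝ × ℝ => b p.1 p.2)
    (huc : Continuous fun p : ℝ × ℝ => u p.1 p.2)
    (hdr : ∀ r t, HasDerivAt (fun r => u r t) (a r t) r)
    (hdt : ∀ r t, HasDerivAt (fun t => u r t) (r * b r t) t)
    (huR : ∀ t, u R t = 0) (hev : ∀ r t, u r (t + π) = u r t) :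
    0 ≤ ∫ r in (0:ℝ)..R, (1 + r) ^ (2 * β) * r * ∫ t in (-π)..π,
      (k * (‖a r t‖ ^ 2 + ‖b r t‖ ^ 2) - 2 * (star (a r t) * b r t).im) := by
  have hk0 : 0 ≤ k := (abs_nonneg _).trans hk
  refine pf_radial (δ := 0) hk0 hR hac hbc huc hdr hdt ?_ huR (Or.inl rfl) ?_
  · intro r
    have h1 := hev r (-π)
    have h2 := hev r 0
    simp at h1 h2
    rw [h2, h1]
  · intro r hr
    have hb : Continuous fun t => (r:ℂ) * b r t :=
      continuous_const.mul (hbc.comp (by fun_prop : Continuous fun t : ℝ => (r,t)))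
    have h := pf_even (hdt r) hb (hev r)
    set X := ∫ t in (-π)..π, ‖r * b r t‖ ^ 2
    set J := ∫ t in (-π)..π, (star (u r t) * (r * b r t)).im
    have ht : |r / (1 + r)| ≤ 1 := by
      rw [abs_of_pos (by positivity), div_le_one (by positivity)]; linarith
    have h2 : |2 * β * (r / (1 + r)) * J| ≤ k * X := by
      rw [abs_mul, abs_mul, abs_mul, abs_two]
      calc 2 * |β| * |r / (1 + r)| * |J| ≤ 2 * k * 1 * |J| := by gcongr
        _ = k * (2 * |J|) := by ring
        _ ≤ k * X := by gcongr
    have := neg_abs_le (2 * β * (r / (1 + r)) * J)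
    simp only [mul_zero, zero_mul, add_zero]
    norm_num
    linarith

theorem pf_radial_odd {u a b : ℝ → ℝ → ℂ} {β k R : ℝ} (hβ : |β| < 1)
    (hk0 : 0 ≤ k) (hk : 2 * |β| ≤ k * (1 + β ^ 2)) (hR : 0 < R)
    (hac : Continuous fun p : ℝ × ℝ => a p.1 p.2)
    (hbc : Continuous fun p : ℝ × ℝ => b p.1 p.2)
    (huc : Continuous fun p : ℝ × ℝ => u p.1 p.2)
    (hdr : ∀ r t, HasDerivAt (fun r => u r t) (a r t) r)
    (hdt : ∀ r t, HasDerivAt (fun t => u r t) (r * b r t) t)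
    (huR : ∀ t, u R t = 0) (hu0 : ∀ t, u 0 t = 0) (hod : ∀ r t, u r (t + π) = - u r t) :
    0 ≤ ∫ r in (0:ℝ)..R, (1 + r) ^ (2 * β) * r * ∫ t in (-π)..π,
      (k * (‖a r t‖ ^ 2 + ‖b r t‖ ^ 2) - 2 * (star (a r t) * b r t).im) := by
  refine pf_radial (δ := β) hk0 hR hac hbc huc hdr hdt ?_ huR (Or.inr hu0) ?_
  · intro r
    have h1 := hod r (-π)
    have h2 := hod r 0
    simp at h1 h2
    rw [h2, h1]; simp
  · intro r hr
    have hb : Continuous fun t => (r:ℂ) * b r t :=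
      continuous_const.mul (hbc.comp (by fun_prop : Continuous fun t : ℝ => (r,t)))
    have hu : Continuous (u r) := huc.comp (by fun_prop : Continuous fun t : ℝ => (r,t))
    have hle : -π ≤ π := by linarith [pi_pos]
    have h := pf_odd (hdt r) hb (hod r)
    have h7 := pf_J_bound hu hb hle 1
    have h8 := pf_J_bound hu hb hle (-1)
    have hB : 0 ≤ ∫ t in (-π)..π, ‖u r t‖ ^ 2 :=
      intervalIntegral.integral_nonneg hle fun t _ => by positivity
    set X := ∫ t in (-π)..π, ‖r * b r t‖ ^ 2
    set B := ∫ t in (-π)..π, ‖u r t‖ ^ 2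
    set J := ∫ t in (-π)..π, (star (u r t) * (r * b r t)).im
    have ht : r / (1 + r) ≤ 1 := by
      rw [div_le_one (by positivity)]; linarith
    have ht0 : 0 ≤ r / (1 + r) := by positivity
    set τ := r / (1 + r)
    have hJ : |J| ≤ (X + B) / 2 := by
      rw [abs_le]; constructor <;> linarith
    have hβ2 : β ^ 2 ≤ 1 := by
      rw [← sq_abs]; nlinarith [abs_nonneg β]
    have e0 : 0 ≤ k * (X - β ^ 2 * B) := by
      apply mul_nonneg hk0; nlinarith
    have e1 : 0 ≤ k * (X + β ^ 2 * B) + 2 * β * J := by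
      have h2 : |2 * β * J| ≤ k * (X + β ^ 2 * B) := by
        rw [abs_mul, abs_mul, abs_two]
        calc 2 * |β| * |J| ≤ (k * (1 + β ^ 2)) * ((X + B) / 2) := by gcongr
          _ = k * ((1 + β ^ 2) * ((X + B) / 2)) := by ring
          _ ≤ k * (X + β ^ 2 * B) := by
            gcongr
            nlinarith
      have := neg_abs_le (2 * β * J)
      linarith
    have : k * (X - β ^ 2 * B) + 2 * β * τ * (J + k * β * B) =
      (1 - τ) * (k * (X - β ^ 2 * B)) + τ * (k * (X + β ^ 2 * B) + 2 * β * J) := by ring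
    rw [this]
    have : 0 ≤ 1 - τ := by linarith
    positivity

/-- radial unit vector -/
noncomputable def pfEr (t : ℝ) : EuclideanSpace ℝ (Fin 2) :=
  Real.cos t • EuclideanSpace.single 0 1 + Real.sin t • EuclideanSpace.single 1 1

/-- angular unit vector -/
noncomputable def pfEt (t : ℝ) : EuclideanSpace ℝ (Fin 2) :=
  (-Real.sin t) • EuclideanSpace.single 0 1 + Real.cos t • EuclideanSpace.single 1 1

theorem pfEr_cont : Continuous pfEr := by unfold pfEr; fun_prop
theorem pfEt_cont : Continuous pfEt := by unfold pfEt; fun_prop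

theorem pfEr_deriv (t : ℝ) : HasDerivAt pfEr (pfEt t) t :=
  ((hasDerivAt_cos t).smul_const _).add ((hasDerivAt_sin t).smul_const _)

theorem pfEr_norm (t : ℝ) : ‖pfEr t‖ = 1 := by
  rw [EuclideanSpace.norm_eq, Real.sqrt_eq_one]
  simp [pfEr]

theorem pfEr_add_pi (t : ℝ) : pfEr (t + π) = - pfEr t := by
  simp [pfEr, Real.cos_add_pi, Real.sin_add_pi]
  abel

theorem pf_polar (f : EuclideanSpace ℝ (Fin 2) → ℝ) (hf : Continuous f) {R : ℝ} (hR : 0 < R)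
    (hfR : ∀ x, R ≤ ‖x‖ → f x = 0) :
    ∫ x, f x = ∫ r in (0:ℝ)..R, ∫ t in (-π)..π, r * f (r • pfEr t) := by
  have hle : -π ≤ π := by linarith [pi_pos]
  have h1 : ∫ x, f x = ∫ p : ℝ × ℝ, f (WithLp.toLp 2 ![p.1, p.2]) := by
    rw [← (PiLp.volume_preserving_toLp (Fin 2)).integral_comp
      (MeasurableEquiv.toLp 2 (Fin 2 → ℝ)).measurableEmbedding,
      ← ((volume_preserving_finTwoArrow ℝ).symm).integral_comp
      (MeasurableEquiv.finTwoArrow.symm).measurableEmbedding]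
    rfl
  have h2 : ∀ p : ℝ × ℝ, (WithLp.toLp 2 ![(polarCoord.symm p).1, (polarCoord.symm p).2] : EuclideanSpace ℝ (Fin 2))
      = p.1 • pfEr p.2 := by
    intro p
    ext i
    fin_cases i <;> simp [pfEr]
  have hc : Continuous fun p : ℝ × ℝ => p.1 * f (p.1 • pfEr p.2) := by
    have := pfEr_cont
    fun_prop
  rw [h1, ← integral_comp_polarCoord_symm]
  simp_rw [h2, smul_eq_mul]
  rw [polarCoord_target, setIntegral_eq_of_subset_of_forall_sdiff_eq_zero
    (s := Set.Ioc 0 R ×ˢ Set.Ioo (-π) π) (t := Set.Ioi 0 ×ˢ Set.Ioo (-π) π)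
    (measurableSet_Ioi.prod measurableSet_Ioo)
    (Set.prod_mono_left Set.Ioc_subset_Ioi_self)]
  · rw [Measure.volume_eq_prod, setIntegral_prod, intervalIntegral.integral_of_le hR.le]
    · simp_rw [intervalIntegral.integral_of_le hle, integral_Ioc_eq_integral_Ioo]
    · refine (hc.continuousOn.integrableOn_compact
        (isCompact_Icc.prod isCompact_Icc : IsCompact (Set.Icc 0 R ×ˢ Set.Icc (-π) π))).mono_set ?_
      exact Set.prod_mono Set.Ioc_subset_Icc_self Set.Ioo_subset_Icc_self
  · rintro ⟨r, t⟩ ⟨⟨h1, h2⟩, h3⟩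
    have h1 : 0 < r := h1
    have hr : R ≤ r := by
      by_contra hlt
      exact h3 ⟨⟨h1, by simp at hlt; exact hlt.le⟩, h2⟩
    have : f (r • pfEr t) = 0 := by
      apply hfR
      rw [norm_smul, pfEr_norm, mul_one, Real.norm_of_nonneg h1.le]
      exact hr
    simp [this]

/-- The integrand. -/
noncomputable def pfG (k : ℝ) (φ : EuclideanSpace ℝ (Fin 2) → ℂ) (x : EuclideanSpace ℝ (Fin 2)) : ℝ :=
  ‖fderiv ℝ φ x (EuclideanSpace.single 0 1) +
            Complex.I * fderiv ℝ φ x (EuclideanSpace.single 1 1)‖ ^ 2 - (1 - k) *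
      (‖fderiv ℝ φ x (EuclideanSpace.single 0 1)‖ ^ 2 +
              ‖fderiv ℝ φ x (EuclideanSpace.single 1 1)‖ ^ 2)

theorem pf_wcont (p : ℝ) : Continuous fun x : EuclideanSpace ℝ (Fin 2) => (1 + ‖x‖) ^ p :=
  Continuous.rpow_const (by fun_prop) fun x => Or.inl (by positivity)

theorem pfG_cont (k : ℝ) {φ : EuclideanSpace ℝ (Fin 2) → ℂ} (hφ : ContDiff ℝ 1 φ) :
    Continuous (pfG k φ) := by
  have := hφ.continuous_fderiv one_ne_zero
  unfold pfG
  fun_prop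

theorem pfG_polar (k : ℝ) (φ : EuclideanSpace ℝ (Fin 2) → ℂ) (x : EuclideanSpace ℝ (Fin 2)) (t : ℝ) :
    pfG k φ x = k * (‖fderiv ℝ φ x (pfEr t)‖ ^ 2 + ‖fderiv ℝ φ x (pfEt t)‖ ^ 2)
      - 2 * (star (fderiv ℝ φ x (pfEr t)) * fderiv ℝ φ x (pfEt t)).im := by
  unfold pfG pfEr pfEt
  simp only [map_add, map_smul]
  generalize fderiv ℝ φ x (EuclideanSpace.single 0 1) = z
  generalize fderiv ℝ φ x (EuclideanSpace.single 1 1) = w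
  simp only [← Complex.normSq_eq_norm_sq, Complex.normSq_apply]
  simp
  have h := Real.sin_sq_add_cos_sq t
  simp only [← Complex.ofReal_cos, ← Complex.ofReal_sin, Complex.ofReal_re]
  linear_combination (-(k * (z.re ^ 2 + z.im ^ 2 + w.re ^ 2 + w.im ^ 2)
    - 2 * (z.re * w.im - z.im * w.re))) * h

theorem pf_polar_nonneg {k β R : ℝ} (hR : 0 < R) {φ : EuclideanSpace ℝ (Fin 2) → ℂ} (hφ : ContDiff ℝ 1 φ)
    (hφR : ∀ x, R ≤ ‖x‖ → x ∉ tsupport φ) (hβ : |β| < 1) (hk : |β| ≤ k)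
    (hk2 : 2 * |β| ≤ k * (1 + β ^ 2)) (hpar : (∀ x, φ (-x) = φ x) ∨ (∀ x, φ (-x) = - φ x)) :
    0 ≤ ∫ x, (1 + ‖x‖) ^ (2 * β) * pfG k φ x := by
  have hk0 : 0 ≤ k := (abs_nonneg _).trans hk
  have hfd : ∀ x, R ≤ ‖x‖ → fderiv ℝ φ x = 0 := fun x hx => by
    have h1 : x ∉ tsupport (fderiv ℝ φ) := fun h => hφR x hx (tsupport_fderiv_subset ℝ h)
    exact image_eq_zero_of_notMem_tsupport h1
  rw [pf_polar (fun x => (1 + ‖x‖) ^ (2 * β) * pfG k φ x) ((pf_wcont _).mul (pfG_cont k hφ)) hR (fun x hx => by simp [pfG, hfd x hx])]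
  have hcd := hφ.continuous_fderiv one_ne_zero
  have hEr := pfEr_cont
  have hEt := pfEt_cont
  have hφc := hφ.continuous
  have hdiff : Differentiable ℝ φ := hφ.differentiable one_ne_zero
  have hac : Continuous fun p : ℝ × ℝ => fderiv ℝ φ (p.1 • pfEr p.2) (pfEr p.2) := by fun_prop
  have hbc : Continuous fun p : ℝ × ℝ => fderiv ℝ φ (p.1 • pfEr p.2) (pfEt p.2) := by fun_prop
  have huc : Continuous fun p : ℝ × ℝ => φ (p.1 • pfEr p.2) := by fun_prop
  have hdr : ∀ r t, HasDerivAt (fun r : ℝ => φ (r • pfEr t)) (fderiv ℝ φ (r • pfEr t) (pfEr t)) r := by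
    intro r t
    have h1 : HasDerivAt (fun r : ℝ => r • pfEr t) (pfEr t) r := by
      simpa using (hasDerivAt_id r).smul_const (pfEr t)
    exact (hdiff _).hasFDerivAt.comp_hasDerivAt r h1
  have hdt : ∀ r t : ℝ, HasDerivAt (fun t : ℝ => φ (r • pfEr t)) (r * fderiv ℝ φ (r • pfEr t) (pfEt t)) t := by
    intro r t
    have h1 : HasDerivAt (fun t : ℝ => r • pfEr t) (r • pfEt t) t := (pfEr_deriv t).const_smul r
    have h2 := (hdiff (r • pfEr t)).hasFDerivAt.comp_hasDerivAt t h1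
    rw [map_smul, Complex.real_smul] at h2
    exact h2
  have huR : ∀ t, φ (R • pfEr t) = 0 := by
    intro t
    apply image_eq_zero_of_notMem_tsupport
    apply hφR
    rw [norm_smul, pfEr_norm, mul_one, Real.norm_of_nonneg hR.le]
  have hgoal : (∫ r in (0:ℝ)..R, ∫ t in (-π)..π, r * ((1 + ‖r • pfEr t‖) ^ (2 * β) * pfG k φ (r • pfEr t)))
    = ∫ r in (0:ℝ)..R, (1 + r) ^ (2 * β) * r * ∫ t in (-π)..π,
      (k * (‖fderiv ℝ φ (r • pfEr t) (pfEr t)‖ ^ 2 + ‖fderiv ℝ φ (r • pfEr t) (pfEt t)‖ ^ 2) -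
        2 * (star (fderiv ℝ φ (r • pfEr t) (pfEr t)) * fderiv ℝ φ (r • pfEr t) (pfEt t)).im) := by
    refine intervalIntegral.integral_congr fun r hr => ?_
    rw [Set.uIcc_of_le hR.le] at hr
    rw [← intervalIntegral.integral_const_mul]
    congr 1
    ext t
    rw [norm_smul, pfEr_norm, mul_one, Real.norm_of_nonneg hr.1, pfG_polar k φ _ t]
    ring
  rw [hgoal]
  rcases hpar with hev | hod
  · exact pf_radial_even (u := fun r t => φ (r • pfEr t)) hk hR hac hbc huc hdr hdt huR
      (fun r t => by rw [pfEr_add_pi, smul_neg, hev])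
  · exact pf_radial_odd (u := fun r t => φ (r • pfEr t)) hβ hk0 hk2 hR hac hbc huc hdr hdt huR
      (fun t => by
        have := hod 0
        simp only [neg_zero] at this
        simpa using self_eq_neg.1 this)
      (fun r t => by rw [pfEr_add_pi, smul_neg, hod])

theorem pfG_neg_fderiv {φ : EuclideanSpace ℝ (Fin 2) → ℂ} (hd : Differentiable ℝ φ)
    (x v : EuclideanSpace ℝ (Fin 2)) :
    fderiv ℝ (fun x => φ x + φ (-x)) x v = fderiv ℝ φ x v - fderiv ℝ φ (-x) v ∧
    fderiv ℝ (fun x => φ x - φ (-x)) x v = fderiv ℝ φ x v + fderiv ℝ φ (-x) v := by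
  have h1 : HasFDerivAt (fun x => φ (-x)) (-(fderiv ℝ φ (-x))) x := by
    have h2 : HasFDerivAt (fun x : EuclideanSpace ℝ (Fin 2) => -x) (-(ContinuousLinearMap.id ℝ _)) x :=
      (hasFDerivAt_id x).neg
    have h3 := (hd (-x)).hasFDerivAt.comp x h2
    refine h3.congr_fderiv ?_
    ext v; simp
  constructor
  · rw [((hd x).hasFDerivAt.fun_add h1).fderiv]; simp [sub_eq_add_neg]
  · rw [((hd x).hasFDerivAt.fun_sub h1).fderiv]; simp

theorem pf_parallelogram (k : ℝ) (z w z' w' : ℂ) :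
    (‖(z - z') + Complex.I * (w - w')‖ ^ 2 - (1 - k) * (‖z - z'‖ ^ 2 + ‖w - w'‖ ^ 2)) +
    (‖(z + z') + Complex.I * (w + w')‖ ^ 2 - (1 - k) * (‖z + z'‖ ^ 2 + ‖w + w'‖ ^ 2)) =
    2 * ((‖z + Complex.I * w‖ ^ 2 - (1 - k) * (‖z‖ ^ 2 + ‖w‖ ^ 2)) +
      (‖z' + Complex.I * w'‖ ^ 2 - (1 - k) * (‖z'‖ ^ 2 + ‖w'‖ ^ 2))) := by
  simp only [← Complex.normSq_eq_norm_sq, Complex.normSq_apply]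
  simp
  ring

theorem pf_integrable {φ : EuclideanSpace ℝ (Fin 2) → ℂ} (hsupp : HasCompactSupport φ)
    {f : EuclideanSpace ℝ (Fin 2) → ℝ} (hf : Continuous f)
    (h0 : ∀ x, fderiv ℝ φ x = 0 → f x = 0) : Integrable f := by
  refine hf.integrable_of_hasCompactSupport ?_
  refine (hsupp.fderiv ℝ).mono fun x hx hx0 => hx (h0 x hx0)

theorem pf_core {k β : ℝ} {φ : EuclideanSpace ℝ (Fin 2) → ℂ} (hφ : ContDiff ℝ 1 φ)
    (hsupp : HasCompactSupport φ) (hβ : |β| < 1) (hk : |β| ≤ k)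
    (hk2 : 2 * |β| ≤ k * (1 + β ^ 2)) :
    0 ≤ ∫ x, (1 + ‖x‖) ^ (2 * β) * pfG k φ x := by
  have hd : Differentiable ℝ φ := hφ.differentiable one_ne_zero
  obtain ⟨R, hR0, hR⟩ := hsupp.isCompact.isBounded.subset_closedBall_lt 0 0
  have hz : ∀ x, R < ‖x‖ → φ x = 0 := fun x hx => by
    apply image_eq_zero_of_notMem_tsupport
    intro h
    have := hR h
    simp at this
    linarith
  have hts : ∀ g : EuclideanSpace ℝ (Fin 2) → ℂ, (∀ x, R < ‖x‖ → g x = 0) →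
      ∀ x, R + 1 ≤ ‖x‖ → x ∉ tsupport g := by
    intro g hg x hx hxt
    have h1 : tsupport g ⊆ Metric.closedBall 0 R := by
      apply closure_minimal _ Metric.isClosed_closedBall
      intro y hy
      by_contra hyn
      simp at hyn
      exact hy (hg y hyn)
    have := h1 hxt
    simp at this
    linarith
  have he := pf_polar_nonneg (k := k) (β := β) (R := R + 1) (φ := fun x => φ x + φ (-x)) (by linarith)
    (hφ.add (hφ.comp contDiff_neg)) (hts _ fun x hx => by simp [hz x hx, hz (-x) (by simpa using hx)])
    hβ hk hk2 (Or.inl fun x => by simp [add_comm])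
  have ho := pf_polar_nonneg (k := k) (β := β) (R := R + 1) (φ := fun x => φ x - φ (-x)) (by linarith)
    (hφ.sub (hφ.comp contDiff_neg)) (hts _ fun x hx => by simp [hz x hx, hz (-x) (by simpa using hx)])
    hβ hk hk2 (Or.inr fun x => by simp)
  have hpt : ∀ x, pfG k (fun x => φ x + φ (-x)) x + pfG k (fun x => φ x - φ (-x)) x =
      2 * (pfG k φ x + pfG k φ (-x)) := by
    intro x
    simp only [pfG, (pfG_neg_fderiv hd x _).1, (pfG_neg_fderiv hd x _).2]
    exact pf_parallelogram k _ _ _ _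
  have hi : Integrable fun x => (1 + ‖x‖) ^ (2 * β) * pfG k φ x :=
    pf_integrable hsupp ((pf_wcont _).mul (pfG_cont k hφ)) fun x hx => by simp [pfG, hx]
  have hi' : Integrable fun x => (1 + ‖x‖) ^ (2 * β) * pfG k φ (-x) := by
    have := hi.comp_neg
    simpa using this
  have hs : ∀ g : EuclideanSpace ℝ (Fin 2) → ℂ, ContDiff ℝ 1 g → (∀ x, R < ‖x‖ → g x = 0) →
      Integrable fun x => (1 + ‖x‖) ^ (2 * β) * pfG k g x := by
    intro g hg hg0
    refine pf_integrable (φ := g) ?_ ((pf_wcont _).mul (pfG_cont k hg)) fun x hx => by simp [pfG, hx]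
    exact HasCompactSupport.of_support_subset_isCompact (isCompact_closedBall 0 R) fun y hy => by
      by_contra hyn
      simp at hyn
      exact hy (hg0 y hyn)
  have hie := hs (fun x => φ x + φ (-x)) (hφ.add (hφ.comp contDiff_neg))
    (fun x hx => by simp [hz x hx, hz (-x) (by simpa using hx)])
  have hiOdd := hs (fun x => φ x - φ (-x)) (hφ.sub (hφ.comp contDiff_neg))
    (fun x hx => by simp [hz x hx, hz (-x) (by simpa using hx)])
  have hsum : (∫ x, (1 + ‖x‖) ^ (2 * β) * pfG k (fun x => φ x + φ (-x)) x) +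
      (∫ x, (1 + ‖x‖) ^ (2 * β) * pfG k (fun x => φ x - φ (-x)) x) =
      2 * ((∫ x, (1 + ‖x‖) ^ (2 * β) * pfG k φ x) + ∫ x, (1 + ‖x‖) ^ (2 * β) * pfG k φ (-x)) := by
    rw [← integral_add hie hiOdd, ← integral_add hi hi', ← integral_const_mul]
    congr 1; ext x
    rw [← mul_add, hpt]; ring
  have hneg : ∫ x, (1 + ‖x‖) ^ (2 * β) * pfG k φ (-x) = ∫ x, (1 + ‖x‖) ^ (2 * β) * pfG k φ x := by
    rw [← integral_neg_eq_self (fun x => (1 + ‖x‖) ^ (2 * β) * pfG k φ x)]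
    simp
  rw [hneg] at hsum
  linarith

theorem pf_final {α β : ℝ} (hβα : |β| = α) (hα1 : α < 1)
    (h : EuclideanSpace ℝ (Fin 2) → ℝ) (hmeas : Measurable h) (M m : ℝ)
    (hM : ∀ᵐ x : EuclideanSpace ℝ (Fin 2) ∂volume, Real.exp (h x) / (1 + ‖x‖) ^ β ≤ M)
    (hm : ∀ᵐ x : EuclideanSpace ℝ (Fin 2) ∂volume, Real.exp (-h x) / (1 + ‖x‖) ^ (-β) ≤ m)
    (φ : EuclideanSpace ℝ (Fin 2) → ℂ)
    (hφ : ContDiff ℝ 1 φ) (hsupp : HasCompactSupport φ) :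
    ∫ x : EuclideanSpace ℝ (Fin 2),
        Real.exp (2 * h x) *
          ‖fderiv ℝ φ x (EuclideanSpace.single 0 1) +
            Complex.I * fderiv ℝ φ x (EuclideanSpace.single 1 1)‖ ^ 2 ≥
      (2 : ℝ) ^ (-2 * α - 1) * (1 - α) ^ 2 /
          (2 * α + (2 : ℝ) ^ (-2 * α - 1) * (1 - α) ^ 2) / m ^ 2 *
        ∫ x : EuclideanSpace ℝ (Fin 2),
          (1 + ‖x‖) ^ (2 * β) *
            (‖fderiv ℝ φ x (EuclideanSpace.single 0 1)‖ ^ 2 +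
              ‖fderiv ℝ φ x (EuclideanSpace.single 1 1)‖ ^ 2) := by
  have hα0 : 0 ≤ α := hβα ▸ abs_nonneg β
  have hm0 : 0 < m := by
    obtain ⟨x, hx⟩ := hm.exists
    exact lt_of_lt_of_le (by positivity) hx
  have hpos : ∀ x : EuclideanSpace ℝ (Fin 2), 0 < 1 + ‖x‖ := fun x => by positivity
  have hsq : ∀ x : EuclideanSpace ℝ (Fin 2), (1 + ‖x‖) ^ (2 * β) = ((1 + ‖x‖) ^ β) ^ 2 := fun x => by
    rw [mul_comm, Real.rpow_mul (hpos x).le]; norm_cast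
  have hesq : ∀ x, Real.exp (2 * h x) = Real.exp (h x) ^ 2 := fun x => by
    rw [← Real.exp_nat_mul]; norm_cast
  have hM' : ∀ᵐ x : EuclideanSpace ℝ (Fin 2) ∂volume, Real.exp (2 * h x) ≤ M ^ 2 * (1 + ‖x‖) ^ (2 * β) := by
    filter_upwards [hM] with x hx
    rw [hsq, hesq, ← mul_pow]
    have hw : 0 < (1 + ‖x‖) ^ β := rpow_pos_of_pos (hpos x) _
    rw [div_le_iff₀ hw] at hx
    exact pow_le_pow_left₀ (by positivity) hx 2
  have hm' : ∀ᵐ x : EuclideanSpace ℝ (Fin 2) ∂volume, (1 + ‖x‖) ^ (2 * β) / m ^ 2 ≤ Real.exp (2 * h x) := by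
    filter_upwards [hm] with x hx
    have hw : 0 < (1 + ‖x‖) ^ β := rpow_pos_of_pos (hpos x) _
    rw [hsq, hesq, ← div_pow]
    refine pow_le_pow_left₀ (by positivity) ?_ 2
    rw [Real.rpow_neg (hpos x).le, Real.exp_neg] at hx
    rw [div_le_iff₀ hm0]
    have he := Real.exp_pos (h x)
    field_simp at hx
    linarith
  have hcd := hφ.continuous_fderiv one_ne_zero
  set c : ℝ := (2 : ℝ) ^ (-2 * α - 1) * (1 - α) ^ 2 with hc
  have h1α : 0 < 1 - α := by linarith
  have hc0 : 0 < c := by positivity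
  have hc1 : c ≤ (1 - α) ^ 2 := by
    have : (2 : ℝ) ^ (-2 * α - 1) ≤ 1 := Real.rpow_le_one_of_one_le_of_nonpos (by norm_num) (by linarith)
    nlinarith [sq_nonneg (1 - α)]
  set q : ℝ := c / (2 * α + c) with hq
  have hqk : 1 - q = 2 * α / (2 * α + c) := by rw [hq]; field_simp; ring
  have hden : 0 < 2 * α + c := by linarith
  have hcore := pf_core (k := 1 - q) (β := β) hφ hsupp (by rw [hβα]; exact hα1)
    (by
      rw [hβα, hqk, le_div_iff₀ hden]
      have h3 : 2 * α + c ≤ 2 := by nlinarith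
      nlinarith [mul_le_mul_of_nonneg_left h3 hα0])
    (by
      rw [hβα, hqk, ← sq_abs, hβα, div_mul_eq_mul_div, le_div_iff₀ hden]
      nlinarith)
  set D : EuclideanSpace ℝ (Fin 2) → ℝ := fun x => ‖fderiv ℝ φ x (EuclideanSpace.single 0 1) +
            Complex.I * fderiv ℝ φ x (EuclideanSpace.single 1 1)‖ ^ 2 with hD
  set N : EuclideanSpace ℝ (Fin 2) → ℝ := fun x => ‖fderiv ℝ φ x (EuclideanSpace.single 0 1)‖ ^ 2 +
              ‖fderiv ℝ φ x (EuclideanSpace.single 1 1)‖ ^ 2 with hN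
  have hDc : Continuous D := by fun_prop
  have hNc : Continuous N := by fun_prop
  have hWc := pf_wcont (2 * β)
  have hD0 : ∀ x, 0 ≤ D x := fun x => by positivity
  have hWD : Integrable fun x => (1 + ‖x‖) ^ (2 * β) * D x :=
    pf_integrable hsupp (hWc.mul hDc) fun x hx => by simp [hD, hx]
  have hWN : Integrable fun x => (1 + ‖x‖) ^ (2 * β) * N x :=
    pf_integrable hsupp (hWc.mul hNc) fun x hx => by simp [hN, hx]
  have hED : Integrable fun x => Real.exp (2 * h x) * D x := by
    refine (hWD.const_mul (M ^ 2)).mono' ?_ ?_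
    · exact (Measurable.mul (by fun_prop) hDc.measurable).aestronglyMeasurable
    · filter_upwards [hM'] with x hx
      rw [Real.norm_of_nonneg (mul_nonneg (Real.exp_pos _).le (hD0 x)), ← mul_assoc]
      exact mul_le_mul_of_nonneg_right hx (hD0 x)
  have h1 : q * ∫ x, (1 + ‖x‖) ^ (2 * β) * N x ≤ ∫ x, (1 + ‖x‖) ^ (2 * β) * D x := by
    have h2 : ∫ x, (1 + ‖x‖) ^ (2 * β) * pfG (1 - q) φ x =
        (∫ x, (1 + ‖x‖) ^ (2 * β) * D x) - q * ∫ x, (1 + ‖x‖) ^ (2 * β) * N x := by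
      rw [← integral_const_mul, ← integral_sub hWD (hWN.const_mul q)]
      congr 1; ext x
      simp only [pfG, hD, hN]; ring
    linarith
  have h2 : (∫ x, (1 + ‖x‖) ^ (2 * β) * D x) / m ^ 2 ≤ ∫ x, Real.exp (2 * h x) * D x := by
    rw [← integral_div]
    refine integral_mono_ae (hWD.div_const _) hED ?_
    filter_upwards [hm'] with x hx
    rw [mul_div_right_comm]
    exact mul_le_mul_of_nonneg_right hx (hD0 x)
  refine le_trans ?_ h2
  rw [div_mul_eq_mul_div]
  gcongr

/-- Proposition 2.1: lower bounds for the quadratic forms `Q^±[e^{±h}φ]` in terms of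
weighted Dirichlet integrals, under the essential-supremum bounds `m⁺, m⁻` on
`e^{±h(x)}(1+|x|)^{∓α}`. -/
theorem pauli_form_lower_bound
    (α : ℝ) (hα0 : 0 ≤ α) (hα1 : α < 1)
    (h : EuclideanSpace ℝ (Fin 2) → ℝ) (hmeas : Measurable h)
    (mp mm : ℝ)
    (hmp : ∀ᵐ x : EuclideanSpace ℝ (Fin 2) ∂volume,
      Real.exp (h x) / (1 + ‖x‖) ^ α ≤ mp)
    (hmm : ∀ᵐ x : EuclideanSpace ℝ (Fin 2) ∂volume,
      Real.exp (-h x) / (1 + ‖x‖) ^ (-α) ≤ mm)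
    (φ : EuclideanSpace ℝ (Fin 2) → ℂ)
    (hφ : ContDiff ℝ 1 φ) (hsupp : HasCompactSupport φ) :
    (∫ x : EuclideanSpace ℝ (Fin 2),
        Real.exp (2 * h x) *
          ‖fderiv ℝ φ x (EuclideanSpace.single 0 1) +
            Complex.I * fderiv ℝ φ x (EuclideanSpace.single 1 1)‖ ^ 2 ≥
      (2 : ℝ) ^ (-2 * α - 1) * (1 - α) ^ 2 /
          (2 * α + (2 : ℝ) ^ (-2 * α - 1) * (1 - α) ^ 2) / mm ^ 2 *
        ∫ x : EuclideanSpace ℝ (Fin 2),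
          (1 + ‖x‖) ^ (2 * α) *
            (‖fderiv ℝ φ x (EuclideanSpace.single 0 1)‖ ^ 2 +
              ‖fderiv ℝ φ x (EuclideanSpace.single 1 1)‖ ^ 2)) ∧
    (∫ x : EuclideanSpace ℝ (Fin 2),
        Real.exp (-(2 * h x)) *
          ‖fderiv ℝ φ x (EuclideanSpace.single 0 1) -
            Complex.I * fderiv ℝ φ x (EuclideanSpace.single 1 1)‖ ^ 2 ≥
      (2 : ℝ) ^ (-2 * α - 1) * (1 - α) ^ 2 /
          (2 * α + (2 : ℝ) ^ (-2 * α - 1) * (1 - α) ^ 2) / mp ^ 2 *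
        ∫ x : EuclideanSpace ℝ (Fin 2),
          (1 + ‖x‖) ^ (-(2 * α)) *
            (‖fderiv ℝ φ x (EuclideanSpace.single 0 1)‖ ^ 2 +
              ‖fderiv ℝ φ x (EuclideanSpace.single 1 1)‖ ^ 2)) := by
  have hα : |α| = α := abs_of_nonneg hα0
  refine ⟨pf_final hα hα1 h hmeas mp mm hmp hmm φ hφ hsupp, ?_⟩
  have hd : Differentiable ℝ φ := hφ.differentiable one_ne_zero
  have hfd : ∀ x v, fderiv ℝ (fun x => star (φ x)) x v = star (fderiv ℝ φ x v) := by
    intro x v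
    have h1 := Complex.conjCLE.toContinuousLinearMap.hasFDerivAt.comp x (hd x).hasFDerivAt
    have h2 : HasFDerivAt (fun x => star (φ x))
      (Complex.conjCLE.toContinuousLinearMap.comp (fderiv ℝ φ x)) x := h1
    rw [h2.fderiv]
    rfl
  have hcs : ContDiff ℝ 1 fun x => star (φ x) :=
    Complex.conjCLE.toContinuousLinearMap.contDiff.comp hφ
  have hss : HasCompactSupport fun x => star (φ x) :=
    hsupp.comp_left (g := fun z : ℂ => star z) (by simp)
  have key := pf_final (β := -α) (by rw [abs_neg, hα]) hα1 (fun x => - h x) hmeas.neg mm mp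
    hmm (by simpa using hmp) (fun x => star (φ x)) hcs hss
  simp only [hfd, norm_star] at key
  have hn : ∀ z w : ℂ, ‖star z + Complex.I * star w‖ = ‖z - Complex.I * w‖ := by
    intro z w
    rw [← norm_star (z - Complex.I * w)]
    congr 1
    simp
  simp only [hn, mul_neg] at key
  exact key
end

section
/- Let 0 < α < 1 and let m ≤ -1 be an integer. Then for every continuously differentiable compactly supported function φ : (0,∞) → ℂ one has ∫₀^∞ (1+r)^{2α} |φ'(r) - m φ(r)/r|² r dr ≥ 2^{-2α-1}(1-α)² m² ∫₀^∞ (1+r)^{2α} r^{-2} |φ(r)|² r dr. -/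
open MeasureTheory Real Set

lemma hardy_aux_int (φ : ℝ → ℂ) (hsupp : HasCompactSupport φ)
    (hsupp' : tsupport φ ⊆ Ioi 0) (f : ℝ → ℝ) (hf : ContinuousOn f (Ioi 0))
    (h0 : ∀ r, r ∉ tsupport φ → f r = 0) : IntegrableOn f (Ioi 0) := by
  have h1 : IntegrableOn f (tsupport φ) :=
    (hf.mono hsupp').integrableOn_compact hsupp
  have h2 : Integrable f :=
    (integrableOn_iff_integrable_of_support_subset (by
      intro r hr
      by_contra h
      exact hr (h0 r h))).1 h1
  exact h2.integrableOn

lemma hardy_aux_alg (w r n α a b p q : ℝ) (hw : 0 ≤ w) (hr : 0 < r) (hα0 : 0 < α)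
    (hc : 0 ≤ n - α) :
    (n - α) * (w * (2 * α) / (1 + r) * (a ^ 2 + b ^ 2) + w * (2 * (a * p + b * q)))
      + (n - α) ^ 2 * (w * ((a ^ 2 + b ^ 2) / r ^ 2) * r)
      ≤ w * ((p + n * a / r) ^ 2 + (q + n * b / r) ^ 2) * r := by
  have h1 : w * (2 * α) / (1 + r) ≤ w * (2 * α) / r := by
    apply div_le_div_of_nonneg_left (by positivity) hr (by linarith)
  have h2 : (n - α) * (w * (2 * α) / (1 + r) * (a ^ 2 + b ^ 2)) ≤
      (n - α) * (w * (2 * α) / r * (a ^ 2 + b ^ 2)) := by gcongr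
  have h3 : w * ((p + n * a / r) ^ 2 + (q + n * b / r) ^ 2) * r -
     ((n - α) * (w * (2 * α) / r * (a ^ 2 + b ^ 2) + w * (2 * (a * p + b * q)))
      + (n - α) ^ 2 * (w * ((a ^ 2 + b ^ 2) / r ^ 2) * r))
      = w / r * ((r * p + α * a) ^ 2 + (r * q + α * b) ^ 2) := by
    field_simp
    ring
  have h4 : 0 ≤ w / r * ((r * p + α * a) ^ 2 + (r * q + α * b) ^ 2) := by positivity
  linarith

/-- Hardy-type inequality (5.6)/(2.10) of the paper: angular mode `m ≤ -1`,
weight `(1+r)^{2α}`, `0 < α < 1`. -/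
theorem hardy_mode_upper_sign
    (α : ℝ) (hα0 : 0 < α) (hα1 : α < 1) (m : ℤ) (hm : m ≤ -1)
    (φ : ℝ → ℂ) (hφ : ContDiff ℝ 1 φ) (hsupp : HasCompactSupport φ)
    (hsupp' : tsupport φ ⊆ Ioi 0) :
    ∫ r in Ioi (0:ℝ),
        (1 + r) ^ (2 * α) * ‖deriv φ r - (m : ℂ) * φ r / (r : ℂ)‖ ^ 2 * r ≥
      (2 : ℝ) ^ (-2 * α - 1) * (1 - α) ^ 2 * (m : ℝ) ^ 2 *
        ∫ r in Ioi (0:ℝ), (1 + r) ^ (2 * α) * (‖φ r‖ ^ 2 / r ^ 2) * r := by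
  have hmr : (m : ℝ) ≤ -1 := by exact_mod_cast hm
  have hc : 0 ≤ -(m : ℝ) - α := by linarith
  have hφc : Continuous φ := hφ.continuous
  have hdc : Continuous (deriv φ) := hφ.continuous_deriv le_rfl
  have z0 : ∀ r, r ∉ tsupport φ → φ r = 0 := fun r h => image_eq_zero_of_notMem_tsupport h
  have z1 : ∀ r, r ∉ tsupport φ → deriv φ r = 0 := fun r h => by
    by_contra h'
    exact h (support_deriv_subset h')
  have hwc : ContinuousOn (fun r : ℝ => (1 + r) ^ (2 * α)) (Ioi 0) := by
    apply ContinuousOn.rpow_const (by fun_prop)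
    intro r hr
    right; positivity
  have hn0 : ∀ r ∈ Ioi (0:ℝ), r ≠ 0 := fun r hr => ne_of_gt hr
  have hn1 : ∀ r ∈ Ioi (0:ℝ), (r:ℂ) ≠ 0 := fun r hr => by
    exact_mod_cast hn0 r hr
  have hn2 : ∀ r ∈ Ioi (0:ℝ), r ^ 2 ≠ 0 := fun r hr => pow_ne_zero 2 (hn0 r hr)
  have hn3 : ∀ r ∈ Ioi (0:ℝ), 1 + r ≠ 0 := fun r hr => by
    have : 0 < r := hr
    positivity
  have I1 : IntegrableOn (fun r : ℝ =>
      (1 + r) ^ (2 * α) * ‖deriv φ r - (m : ℂ) * φ r / (r : ℂ)‖ ^ 2 * r) (Ioi 0) := by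
    apply hardy_aux_int φ hsupp hsupp'
    · refine (hwc.mul (ContinuousOn.pow (ContinuousOn.norm ?_) 2)).mul continuousOn_id
      exact hdc.continuousOn.sub (ContinuousOn.div (by fun_prop) (by fun_prop) hn1)
    · intro r h
      simp [z0 r h, z1 r h]
  have I2 : IntegrableOn (fun r : ℝ =>
      (1 + r) ^ (2 * α) * (‖φ r‖ ^ 2 / r ^ 2) * r) (Ioi 0) := by
    apply hardy_aux_int φ hsupp hsupp'
    · exact (hwc.mul (ContinuousOn.div (by fun_prop) (by fun_prop) hn2)).mul continuousOn_id
    · intro r h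
      simp [z0 r h]
  have I3 : IntegrableOn (fun r : ℝ =>
      (1 + r) ^ (2 * α) * (2 * α) / (1 + r) * ‖φ r‖ ^ 2
        + (1 + r) ^ (2 * α) * (2 * inner ℝ (φ r) (deriv φ r))) (Ioi 0) := by
    apply hardy_aux_int φ hsupp hsupp'
    · refine ContinuousOn.add (ContinuousOn.mul (ContinuousOn.div (hwc.mul (by fun_prop))
        (by fun_prop) hn3) (by fun_prop)) (hwc.mul (by fun_prop))
    · intro r h
      simp [z0 r h]
  have hzero : ∫ r in Ioi (0:ℝ), ((1 + r) ^ (2 * α) * (2 * α) / (1 + r) * ‖φ r‖ ^ 2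
        + (1 + r) ^ (2 * α) * (2 * inner ℝ (φ r) (deriv φ r))) = 0 := by
    have := integral_Ioi_of_hasDerivAt_of_tendsto (a := (0:ℝ)) (m := (0:ℝ))
      (f := fun r : ℝ => (1 + r) ^ (2 * α) * ‖φ r‖ ^ 2) ?_ ?_ I3 ?_
    · rw [this]
      have h : φ 0 = 0 := z0 0 (fun h => lt_irrefl (0:ℝ) (mem_Ioi.1 (hsupp' h)))
      simp [h]
    · apply ContinuousAt.continuousWithinAt
      refine ContinuousAt.mul (ContinuousAt.rpow_const (by fun_prop) (by simp)) (by fun_prop)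
    · intro r hr
      have e1 : HasDerivAt (fun r : ℝ => (1 + r) ^ (2 * α))
          ((1 + r) ^ (2 * α) * (2 * α) / (1 + r)) r := by
        have := ((hasDerivAt_id r).const_add 1).rpow_const (p := 2 * α) (Or.inl (hn3 r hr))
        have e : (1 + r) ^ (2 * α) * (2 * α) / (1 + r)
            = 1 * (2 * α) * (1 + r) ^ (2 * α - 1) := by
          rw [rpow_sub_one (hn3 r hr)]
          ring
        rw [e]
        exact this
      have e2 := (hφ.differentiable one_ne_zero r).hasDerivAt.norm_sq
      exact e1.mul e2
    · apply tendsto_const_nhds.congr'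
      obtain ⟨R, hR⟩ := hsupp.isCompact.bddAbove
      filter_upwards [Filter.eventually_gt_atTop R] with r hr
      have : φ r = 0 := z0 r (fun h => absurd (hR h) (not_le.2 hr))
      simp [this]
  have key : (-(m:ℝ) - α) ^ 2 *
        ∫ r in Ioi (0:ℝ), (1 + r) ^ (2 * α) * (‖φ r‖ ^ 2 / r ^ 2) * r ≤
      ∫ r in Ioi (0:ℝ),
        (1 + r) ^ (2 * α) * ‖deriv φ r - (m : ℂ) * φ r / (r : ℂ)‖ ^ 2 * r := by
    have hmono := setIntegral_mono_on ((I3.const_mul (-(m:ℝ) - α)).add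
      (I2.const_mul ((-(m:ℝ) - α) ^ 2))) I1 measurableSet_Ioi (by
      intro r hr
      have hr' : 0 < r := hr
      have := hardy_aux_alg ((1 + r) ^ (2 * α)) r (-(m:ℝ)) α (φ r).re (φ r).im
        (deriv φ r).re (deriv φ r).im (by positivity) hr' hα0 hc
      have n1 : ‖φ r‖ ^ 2 = (φ r).re ^ 2 + (φ r).im ^ 2 := by
        rw [← Complex.normSq_eq_norm_sq, Complex.normSq_apply]; ring
      have n2 : ‖deriv φ r - (m : ℂ) * φ r / (r : ℂ)‖ ^ 2 =
          ((deriv φ r).re + -(m:ℝ) * (φ r).re / r) ^ 2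
            + ((deriv φ r).im + -(m:ℝ) * (φ r).im / r) ^ 2 := by
        rw [← Complex.normSq_eq_norm_sq, Complex.normSq_apply]
        simp only [Complex.sub_re, Complex.sub_im, Complex.div_ofReal_re, Complex.div_ofReal_im,
          Complex.mul_re, Complex.mul_im, Complex.intCast_re, Complex.intCast_im]
        ring
      have n3 : inner ℝ (φ r) (deriv φ r) =
          (φ r).re * (deriv φ r).re + (φ r).im * (deriv φ r).im := by
        rw [Complex.inner]
        simp
        ring
      simp only [Pi.add_apply, n1, n2, n3]
      exact this)
    simp only [Pi.add_apply] at hmono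
    rw [integral_add (I3.const_mul _) (I2.const_mul _), integral_const_mul,
      integral_const_mul, hzero] at hmono
    linarith
  refine ge_iff_le.2 (le_trans ?_ key)
  apply mul_le_mul_of_nonneg_right
  · have t1 : (2 : ℝ) ^ (-2 * α - 1) ≤ 1 :=
      rpow_le_one_of_one_le_of_nonpos (by norm_num) (by linarith)
    have t2 : ((1 - α) * (-(m:ℝ))) ^ 2 ≤ (-(m:ℝ) - α) ^ 2 := by
      apply pow_le_pow_left₀
      · apply mul_nonneg <;> linarith
      · nlinarith
    have t3 : 0 ≤ (1 - α) ^ 2 * (m:ℝ) ^ 2 := by positivity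
    nlinarith
  · apply setIntegral_nonneg measurableSet_Ioi
    intro r hr
    have : 0 < r := hr
    positivity
end

section
/- Let 0 < α < 1 and let m ≤ -1 be an integer. Then for every continuously differentiable compactly supported function φ : (0,∞) → ℂ one has ∫₀^∞ (1+r)^{-2α} |φ'(r) + m φ(r)/r|² r dr ≥ 2^{-2α-1}(1-α)² m² ∫₀^∞ (1+r)^{-2α} r^{-2} |φ(r)|² r dr. -/
open MeasureTheory Real Set

lemma hardy_aux_integrable (K : Set ℝ) (hK : IsCompact K) (hK0 : K ⊆ Ioi 0) (f : ℝ → ℝ)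
    (hf : ContinuousOn f (Ioi 0)) (hs : ∀ x, x ∉ K → f x = 0) : IntegrableOn f (Ioi 0) := by
  have h1 : IntegrableOn f K := (hf.mono hK0).integrableOn_compact hK
  have h2 : Integrable f := (integrableOn_iff_integrable_of_support_subset (by
    intro x hx
    by_contra h
    exact hx (hs x h))).1 h1
  exact h2.integrableOn

lemma hardy_aux_pointwise (α m c w r : ℝ) (hα0 : 0 < α) (hc : c = -m - α) (hc0 : 0 < c)
    (hw : 0 < w) (hr : 0 < r) (a b : ℂ) :
    c ^ 2 * (w * (‖a‖ ^ 2 / r ^ 2) * r) ≤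
      w * ‖b + (m : ℂ) * a / (r : ℂ)‖ ^ 2 * r +
        c * (-(2 * α) * (w / (1 + r)) * ‖a‖ ^ 2 + w * (2 * inner ℝ a b)) := by
  have e1 : (m : ℂ) * a / (r : ℂ) = ((m / r : ℝ) : ℂ) * a := by push_cast; ring
  rw [e1]
  simp only [Complex.sq_norm, Complex.normSq_apply, Complex.inner, Complex.add_re,
    Complex.add_im, Complex.mul_re, Complex.mul_im, Complex.ofReal_re, Complex.ofReal_im,
    Complex.conj_re, Complex.conj_im]
  obtain ⟨a1, a2⟩ := a
  obtain ⟨b1, b2⟩ := b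
  simp only
  have h1 : 1 / (1 + r) ≤ 1 / r := one_div_le_one_div_of_le hr (by linarith)
  have h2 : 0 ≤ w * (c * (2 * α) * (a1 ^ 2 + a2 ^ 2) * (1 / r - 1 / (1 + r))) := by
    have := sub_nonneg.2 h1
    positivity
  have h3 : 0 ≤ w * r * ((b1 + m / r * a1 + c / r * a1) ^ 2
      + (b2 + m / r * a2 + c / r * a2) ^ 2) := by positivity
  have hm : m = -c - α := by linarith
  subst hm
  refine le_of_sub_nonneg ?_
  refine le_of_le_of_eq (add_nonneg h2 h3) ?_
  field_simp
  ring

/-- Hardy-type inequality (2.11) of the paper: angular mode `m ≤ -1`,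
weight `(1+r)^{-2α}`, `0 < α < 1`. -/
theorem hardy_mode_lower_sign
    (α : ℝ) (hα0 : 0 < α) (hα1 : α < 1) (m : ℤ) (hm : m ≤ -1)
    (φ : ℝ → ℂ) (hφ : ContDiff ℝ 1 φ) (hsupp : HasCompactSupport φ)
    (hsupp' : tsupport φ ⊆ Ioi 0) :
    ∫ r in Ioi (0:ℝ),
        (1 + r) ^ (-(2 * α)) * ‖deriv φ r + (m : ℂ) * φ r / (r : ℂ)‖ ^ 2 * r ≥
      (2 : ℝ) ^ (-2 * α - 1) * (1 - α) ^ 2 * (m : ℝ) ^ 2 *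
        ∫ r in Ioi (0:ℝ), (1 + r) ^ (-(2 * α)) * (‖φ r‖ ^ 2 / r ^ 2) * r := by
  have hm' : (m : ℝ) ≤ -1 := by exact_mod_cast hm
  obtain ⟨c, hc⟩ : ∃ c : ℝ, c = -(m : ℝ) - α := ⟨_, rfl⟩
  have hc0 : 0 < c := by linarith
  have hz : ∀ x, x ∉ tsupport φ → φ x = 0 := fun x hx => image_eq_zero_of_notMem_tsupport hx
  have hz' : ∀ x, x ∉ tsupport φ → deriv φ x = 0 := fun x hx => by
    by_contra h
    exact hx (support_deriv_subset h)
  have hcφ : Continuous φ := hφ.continuous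
  have hcd : Continuous (deriv φ) := hφ.continuous_deriv le_rfl
  have hW : ∀ p : ℝ, ContinuousOn (fun r : ℝ => (1 + r) ^ p) (Ioi 0) := fun p =>
    ContinuousOn.rpow_const (by fun_prop) (fun x hx => Or.inl (by
      have : (0:ℝ) < x := hx
      positivity))
  have hne : ∀ x ∈ Ioi (0:ℝ), x ≠ 0 := fun x hx => ne_of_gt hx
  let A : ℝ → ℝ := fun r => (1 + r) ^ (-(2 * α)) * ‖deriv φ r + (m : ℂ) * φ r / (r : ℂ)‖ ^ 2 * r
  let B : ℝ → ℝ := fun r => (1 + r) ^ (-(2 * α)) * (‖φ r‖ ^ 2 / r ^ 2) * r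
  let F : ℝ → ℝ := fun r => c * ((1 + r) ^ (-(2 * α)) * ‖φ r‖ ^ 2)
  let G : ℝ → ℝ := fun r => c * (-(2 * α) * (1 + r) ^ (-(2 * α) - 1) * ‖φ r‖ ^ 2
    + (1 + r) ^ (-(2 * α)) * (2 * inner ℝ (φ r) (deriv φ r)))
  have hA : IntegrableOn A (Ioi 0) := by
    refine hardy_aux_integrable _ hsupp hsupp' _ ?_ ?_
    · refine ((hW _).mul (ContinuousOn.pow (ContinuousOn.norm ?_) 2)).mul continuousOn_id
      refine hcd.continuousOn.add (ContinuousOn.div (by fun_prop) (by fun_prop) ?_)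
      intro x hx
      exact_mod_cast hne x hx
    · intro x hx
      simp [A, hz x hx, hz' x hx]
  have hB : IntegrableOn B (Ioi 0) := by
    refine hardy_aux_integrable _ hsupp hsupp' _ ?_ ?_
    · refine ((hW _).mul (ContinuousOn.div (by fun_prop) (by fun_prop) ?_)).mul continuousOn_id
      intro x hx
      exact pow_ne_zero 2 (hne x hx)
    · intro x hx
      simp [B, hz x hx]
  have hG : IntegrableOn G (Ioi 0) := by
    refine hardy_aux_integrable _ hsupp hsupp' _ ?_ ?_
    · have h1 := hW (-(2 * α))
      have h2 := hW (-(2 * α) - 1)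
      have h3 : Continuous fun r => (2 * inner ℝ (φ r) (deriv φ r) : ℝ) := by fun_prop
      have h4 : Continuous fun r => ‖φ r‖ ^ 2 := by fun_prop
      exact continuousOn_const.mul
        (((continuousOn_const.mul h2).mul h4.continuousOn).add (h1.mul h3.continuousOn))
    · intro x hx
      simp [G, hz x hx]
  have hFd : ∀ x ∈ Ici (0:ℝ), HasDerivAt F (G x) x := by
    intro x hx
    have hx' : (0:ℝ) ≤ x := hx
    have h1 : HasDerivAt (fun r : ℝ => (1 + r) ^ (-(2 * α))) (-(2 * α) * (1 + x) ^ (-(2 * α) - 1)) x := by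
      have := ((hasDerivAt_id x).const_add 1).rpow_const (p := -(2 * α))
        (Or.inl (by simp only [id]; positivity))
      simpa using this
    have h2 := ((hφ.differentiable one_ne_zero) x).hasDerivAt.norm_sq
    exact (h1.mul h2).const_mul c
  have hF0 : F 0 = 0 := by
    have : φ 0 = 0 := hz 0 (fun h => lt_irrefl (0:ℝ) (mem_Ioi.1 (hsupp' h)))
    simp [F, this]
  have hFt : Filter.Tendsto F Filter.atTop (nhds 0) := by
    obtain ⟨R, hR⟩ := hsupp.isCompact.bddAbove
    refine tendsto_const_nhds.congr' ?_
    filter_upwards [Filter.eventually_gt_atTop R] with x hx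
    have : φ x = 0 := hz x (fun h => absurd (hR h) (not_le.2 hx))
    simp [F, this]
  have hGi : ∫ r in Ioi (0:ℝ), G r = 0 := by
    rw [integral_Ioi_of_hasDerivAt_of_tendsto' hFd hG hFt, hF0, sub_zero]
  have key : c ^ 2 * ∫ r in Ioi (0:ℝ), B r ≤ ∫ r in Ioi (0:ℝ), A r := by
    have hAG : ∫ r in Ioi (0:ℝ), A r = ∫ r in Ioi (0:ℝ), (A r + G r) := by
      rw [integral_add hA hG, hGi, add_zero]
    rw [hAG, ← integral_const_mul]
    refine setIntegral_mono_on (hB.const_mul _) (hA.add hG) measurableSet_Ioi ?_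
    intro r hr
    have hr' : (0:ℝ) < r := hr
    have := hardy_aux_pointwise α m c ((1 + r) ^ (-(2 * α))) r hα0 hc hc0 (by positivity) hr'
      (φ r) (deriv φ r)
    simp only [A, B, G]
    rw [rpow_sub_one (by positivity)]
    simpa using this
  have hB0 : 0 ≤ ∫ r in Ioi (0:ℝ), B r := by
    refine setIntegral_nonneg measurableSet_Ioi ?_
    intro r hr
    have hr' : (0:ℝ) < r := hr
    simp only [B]
    positivity
  refine le_trans (mul_le_mul_of_nonneg_right ?_ hB0) key
  have h2 : (2 : ℝ) ^ (-2 * α - 1) ≤ 1 := rpow_le_one_of_one_le_of_nonpos (by norm_num) (by linarith)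
  have h3 : (1 - α) * (-(m : ℝ)) ≤ c := by nlinarith
  have h4 : ((1 - α) * (-(m : ℝ))) ^ 2 ≤ c ^ 2 :=
    pow_le_pow_left₀ (mul_nonneg (by linarith) (by linarith)) h3 2
  calc (2 : ℝ) ^ (-2 * α - 1) * (1 - α) ^ 2 * (m : ℝ) ^ 2
      = (2 : ℝ) ^ (-2 * α - 1) * ((1 - α) * (-(m : ℝ))) ^ 2 := by ring
    _ ≤ 1 * ((1 - α) * (-(m : ℝ))) ^ 2 := mul_le_mul_of_nonneg_right h2 (sq_nonneg _)
    _ ≤ c ^ 2 := by linarith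
end

section
/- Let 0 ≤ α < 1 and set q_α = 2^{-2α-1}(1-α)² / (2α + 2^{-2α-1}(1-α)²). Then for every integer m and every continuously differentiable compactly supported function φ : (0,∞) → ℂ one has ∫₀^∞ (1+r)^{2α} |φ'(r) - m φ(r)/r|² r dr ≥ q_α ∫₀^∞ (1+r)^{2α} ( |φ'(r)|² + m² r^{-2} |φ(r)|² ) r dr. -/
open MeasureTheory Real Set

/-- Integrability of a function vanishing off the compact support of `φ`. -/
lemma aux_integrable (φ : ℝ → ℂ) (hsupp : HasCompactSupport φ)
    (hsupp' : tsupport φ ⊆ Ioi 0) (f : ℝ → ℝ) (hf : ContinuousOn f (Ioi 0))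
    (h0 : ∀ x, x ∉ tsupport φ → f x = 0) : IntegrableOn f (Ioi 0) := by
  have h1 : IntegrableOn f (tsupport φ) :=
    (hf.mono hsupp').integrableOn_compact hsupp
  have h2 : Integrable f := by
    rwa [integrableOn_iff_integrable_of_support_subset] at h1
    intro x hx
    by_contra hc
    exact hx (h0 x hc)
  exact h2.integrableOn

/-- The constant in the statement is admissible for some multiple of the exact derivative. -/
lemma aux_const (α : ℝ) (hα0 : 0 ≤ α) (hα1 : α < 1) (m : ℤ) (c : ℝ) (hc0 : 0 < c)
    (hc : c ≤ (1 - α) ^ 2) :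
    ∃ K : ℝ, ∀ r a b s : ℝ, 0 < r → 0 ≤ a → 0 ≤ b → 0 ≤ a + 2 * (α / r) * s + (α / r) ^ 2 * b →
      K * (2 * s + 2 * α / (1 + r) * b) ≤
        (a - 2 * (m / r) * s + (m / r) ^ 2 * b) * r -
          c / (2 * α + c) * ((a + (m : ℝ) ^ 2 * (b / r ^ 2)) * r) := by
  have hd : 0 < 2 * α + c := by positivity
  obtain ⟨p, hp⟩ : ∃ p, p = 2 * α / (2 * α + c) := ⟨_, rfl⟩
  have hq : c / (2 * α + c) = 1 - p := by rw [hp]; field_simp; ring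
  have hp0 : 0 ≤ p := by rw [hp]; positivity
  have hpd : p * (2 * α + c) = 2 * α := by rw [hp]; field_simp
  rw [hq]
  rcases le_or_gt 0 m with hm | hm
  · have hm' : (0 : ℝ) ≤ m := by exact_mod_cast hm
    refine ⟨-m, fun r a b s hr ha hb _ => ?_⟩
    have e : (a - 2 * (m / r) * s + (m / r) ^ 2 * b) * r -
          (1 - p) * ((a + (m : ℝ) ^ 2 * (b / r ^ 2)) * r) - -m * (2 * s + 2 * α / (1 + r) * b)
        = p * ((a + (m : ℝ) ^ 2 * (b / r ^ 2)) * r) + m * (2 * α / (1 + r) * b) := by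
      field_simp; ring
    have : 0 ≤ p * ((a + (m : ℝ) ^ 2 * (b / r ^ 2)) * r) + m * (2 * α / (1 + r) * b) := by
      positivity
    linarith
  · obtain ⟨n, hn⟩ : ∃ n : ℝ, (m : ℝ) = -n := ⟨-m, by ring⟩
    have hn1 : 1 ≤ n := by
      have : (m : ℝ) ≤ -1 := by exact_mod_cast (by omega : m ≤ -1)
      linarith
    rw [hn]
    have h1 : c * n ≤ (n - α) ^ 2 := by
      have : (1 - α) ^ 2 * n ≤ (n - α) ^ 2 := by
        nlinarith [mul_nonneg (sub_nonneg.2 hn1) (by nlinarith : 0 ≤ n - α ^ 2)]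
      nlinarith
    have h2 : 2 * α * n ≤ p * (n ^ 2 + α ^ 2) := by
      rw [← hpd]
      nlinarith
    refine ⟨n - p * α, fun r a b s hr ha hb h => ?_⟩
    have e : (a - 2 * (-n / r) * s + (-n / r) ^ 2 * b) * r -
          (1 - p) * ((a + (-n) ^ 2 * (b / r ^ 2)) * r) - (n - p * α) * (2 * s + 2 * α / (1 + r) * b)
        = p * r * (a + 2 * (α / r) * s + (α / r) ^ 2 * b)
          + (p * (n ^ 2 - α ^ 2)) * (1 / (r * (1 + r))) * b
          + (p * (n ^ 2 + α ^ 2) - 2 * α * n) * (1 / (1 + r)) * b := by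
      field_simp; ring
    have i1 : 0 ≤ p * r * (a + 2 * (α / r) * s + (α / r) ^ 2 * b) := by positivity
    have i2 : 0 ≤ (p * (n ^ 2 - α ^ 2)) * (1 / (r * (1 + r))) * b := by
      have : 0 ≤ n ^ 2 - α ^ 2 := by nlinarith
      positivity
    have i3 : 0 ≤ (p * (n ^ 2 + α ^ 2) - 2 * α * n) * (1 / (1 + r)) * b := by
      have := sub_nonneg.2 h2
      positivity
    linarith

lemma aux_norm (z w : ℂ) (t : ℝ) :
    ‖z + (t : ℂ) * w‖ ^ 2 = ‖z‖ ^ 2 + 2 * t * inner ℝ w z + t ^ 2 * ‖w‖ ^ 2 := by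
  simp only [← Complex.normSq_eq_norm_sq, Complex.normSq_apply, Complex.inner]
  simp
  ring

/-- Inequality (2.9) of the paper, case of the upper sign: for each angular mode `m ∈ ℤ`,
with weight `(1+r)^{2α}`, `0 ≤ α < 1`, and constant `q_α`. -/
theorem weighted_mode_lower_bound_upper_sign
    (α : ℝ) (hα0 : 0 ≤ α) (hα1 : α < 1) (m : ℤ)
    (φ : ℝ → ℂ) (hφ : ContDiff ℝ 1 φ) (hsupp : HasCompactSupport φ)
    (hsupp' : tsupport φ ⊆ Ioi 0) :
    ∫ r in Ioi (0:ℝ),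
        (1 + r) ^ (2 * α) * ‖deriv φ r - (m : ℂ) * φ r / (r : ℂ)‖ ^ 2 * r ≥
      (2 : ℝ) ^ (-2 * α - 1) * (1 - α) ^ 2 /
          (2 * α + (2 : ℝ) ^ (-2 * α - 1) * (1 - α) ^ 2) *
        ∫ r in Ioi (0:ℝ),
          (1 + r) ^ (2 * α) *
            (‖deriv φ r‖ ^ 2 + (m : ℝ) ^ 2 * (‖φ r‖ ^ 2 / r ^ 2)) * r := by
  have hc0 : 0 < (2 : ℝ) ^ (-2 * α - 1) * (1 - α) ^ 2 := by
    have : 0 < 1 - α := by linarith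
    positivity
  have hc : (2 : ℝ) ^ (-2 * α - 1) * (1 - α) ^ 2 ≤ (1 - α) ^ 2 := by
    have : (2 : ℝ) ^ (-2 * α - 1) ≤ 1 :=
      Real.rpow_le_one_of_one_le_of_nonpos (by norm_num) (by linarith)
    nlinarith [sq_nonneg (1 - α)]
  obtain ⟨K, hK⟩ := aux_const α hα0 hα1 m _ hc0 hc
  set q := (2 : ℝ) ^ (-2 * α - 1) * (1 - α) ^ 2 /
          (2 * α + (2 : ℝ) ^ (-2 * α - 1) * (1 - α) ^ 2) with hq
  have cφ : Continuous φ := hφ.continuous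
  have cφ' : Continuous (deriv φ) := hφ.continuous_deriv le_rfl
  have dφ : ∀ r, HasDerivAt φ (deriv φ r) r := fun r =>
    (hφ.differentiable one_ne_zero r).hasDerivAt
  have z1 : ∀ x, x ∉ tsupport φ → φ x = 0 := fun x hx => image_eq_zero_of_notMem_tsupport hx
  have z2 : ∀ x, x ∉ tsupport φ → deriv φ x = 0 := fun x hx => by
    by_contra hc
    exact hx (support_deriv_subset hc)
  have cw : ContinuousOn (fun r : ℝ => (1 + r) ^ (2 * α)) (Ioi 0) := by
    apply ContinuousOn.rpow_const (by fun_prop)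
    intro x hx
    left
    have : (0:ℝ) < x := hx
    positivity
  set F : ℝ → ℝ := fun r => (1 + r) ^ (2 * α) * ‖φ r‖ ^ 2 with hF
  set G : ℝ → ℝ := fun r => (1 + r) ^ (2 * α) *
    (2 * inner ℝ (φ r) (deriv φ r) + 2 * α / (1 + r) * ‖φ r‖ ^ 2) with hG
  have ne0 : ∀ x ∈ Ioi (0:ℝ), x ≠ 0 := fun x hx => ne_of_gt hx
  have ne1 : ∀ x ∈ Ioi (0:ℝ), 1 + x ≠ 0 := fun x hx => by
    have : (0:ℝ) < x := hx
    positivity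
  have iG : IntegrableOn G (Ioi 0) := by
    refine aux_integrable φ hsupp hsupp' G ?_ ?_
    · refine cw.mul (ContinuousOn.add (Continuous.continuousOn (by fun_prop)) ?_)
      exact (ContinuousOn.div (by fun_prop) (by fun_prop) ne1).mul
        (Continuous.continuousOn (by fun_prop))
    · intro x hx
      simp [hG, z1 x hx]
  have i1 : IntegrableOn (fun r : ℝ =>
      (1 + r) ^ (2 * α) * ‖deriv φ r - (m : ℂ) * φ r / (r : ℂ)‖ ^ 2 * r) (Ioi 0) := by
    refine aux_integrable φ hsupp hsupp' _ ?_ ?_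
    · refine (cw.mul (ContinuousOn.pow (ContinuousOn.norm (ContinuousOn.sub
        cφ'.continuousOn (ContinuousOn.div (Continuous.continuousOn (by fun_prop))
          (Continuous.continuousOn (by fun_prop)) ?_))) 2)).mul continuousOn_id
      intro x hx
      exact_mod_cast ne0 x hx
    · intro x hx
      simp [z1 x hx, z2 x hx]
  have i2 : IntegrableOn (fun r : ℝ => (1 + r) ^ (2 * α) *
      (‖deriv φ r‖ ^ 2 + (m : ℝ) ^ 2 * (‖φ r‖ ^ 2 / r ^ 2)) * r) (Ioi 0) := by
    refine aux_integrable φ hsupp hsupp' _ ?_ ?_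
    · refine (cw.mul (ContinuousOn.add (Continuous.continuousOn (by fun_prop))
        (continuousOn_const.mul (ContinuousOn.div (Continuous.continuousOn (by fun_prop))
          (Continuous.continuousOn (by fun_prop)) ?_)))).mul continuousOn_id
      intro x hx
      exact pow_ne_zero 2 (ne0 x hx)
    · intro x hx
      simp [z1 x hx, z2 x hx]
  have hG0 : ∫ r in Ioi (0:ℝ), G r = 0 := by
    have h00 : φ 0 = 0 := z1 0 fun h => lt_irrefl (0:ℝ) (hsupp' h)
    have hF0 : F 0 = 0 := by simp [hF, h00]
    have := integral_Ioi_of_hasDerivAt_of_tendsto (a := 0) (f := F) (f' := G) (m := 0) ?_ ?_ iG ?_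
    · rw [this, hF0, sub_zero]
    · apply ContinuousAt.continuousWithinAt
      refine ContinuousAt.mul (ContinuousAt.rpow_const (by fun_prop) (by norm_num)) ?_
      exact Continuous.continuousAt (by fun_prop)
    · intro x hx
      have hx1 := ne1 x hx
      have h1 : HasDerivAt (fun r : ℝ => (1 + r) ^ (2 * α))
          (1 * (2 * α) * (1 + x) ^ (2 * α - 1)) x :=
        ((hasDerivAt_id x).const_add 1).rpow_const (Or.inl hx1)
      have h2 := h1.mul (dφ x).norm_sq
      have e : G x = 1 * (2 * α) * (1 + x) ^ (2 * α - 1) * ‖φ x‖ ^ 2 +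
          (1 + x) ^ (2 * α) * (2 * inner ℝ (φ x) (deriv φ x)) := by
        simp only [hG]
        rw [Real.rpow_sub_one hx1]
        field_simp
        ring
      rw [e]
      exact h2
    · have : F =ᶠ[Filter.atTop] fun _ => 0 := by
        obtain ⟨R, hR⟩ := hsupp.isBounded.bddAbove
        filter_upwards [Filter.eventually_gt_atTop R] with x hx
        simp [hF, z1 x fun h => absurd (hR h) (not_le.2 hx)]
      exact tendsto_const_nhds.congr' this.symm
  have key : ∫ r in Ioi (0:ℝ), K * G r ≤ ∫ r in Ioi (0:ℝ),
      ((1 + r) ^ (2 * α) * ‖deriv φ r - (m : ℂ) * φ r / (r : ℂ)‖ ^ 2 * r -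
        q * ((1 + r) ^ (2 * α) *
          (‖deriv φ r‖ ^ 2 + (m : ℝ) ^ 2 * (‖φ r‖ ^ 2 / r ^ 2)) * r)) := by
    refine setIntegral_mono_on (iG.const_mul K) (i1.sub (i2.const_mul q)) measurableSet_Ioi ?_
    intro r hr
    have hr0 : (0:ℝ) < r := hr
    have hw : 0 ≤ (1 + r) ^ (2 * α) := by positivity
    have h := hK r (‖deriv φ r‖ ^ 2) (‖φ r‖ ^ 2) (inner ℝ (φ r) (deriv φ r)) hr0
      (by positivity) (by positivity) (by rw [← aux_norm]; positivity)
    have e : deriv φ r - (m : ℂ) * φ r / (r : ℂ) = deriv φ r + ((-(m / r) : ℝ) : ℂ) * φ r := by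
      push_cast; ring
    rw [e, aux_norm]
    have h' := mul_le_mul_of_nonneg_left h hw
    simp only [hG]
    linarith
  rw [integral_const_mul, hG0, mul_zero, integral_sub i1 (i2.const_mul q),
    integral_const_mul] at key
  linarith
end

section
/- Let 0 ≤ α < 1 and set q_α = 2^{-2α-1}(1-α)² / (2α + 2^{-2α-1}(1-α)²). Then for every integer m and every continuously differentiable compactly supported function φ : (0,∞) → ℂ one has ∫₀^∞ (1+r)^{-2α} |φ'(r) + m φ(r)/r|² r dr ≥ q_α ∫₀^∞ (1+r)^{-2α} ( |φ'(r)|² + m² r^{-2} |φ(r)|² ) r dr. -/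
open MeasureTheory Real Set

/-- The constant `q_α` satisfies `0 ≤ q ≤ 1` and `(1-q)(n²+α²) ≥ 2αn` for integers `n ≥ 1`. -/
lemma q_bounds (α : ℝ) (hα0 : 0 ≤ α) (hα1 : α < 1) (q : ℝ)
    (hq : q = (2 : ℝ) ^ (-2 * α - 1) * (1 - α) ^ 2 /
          (2 * α + (2 : ℝ) ^ (-2 * α - 1) * (1 - α) ^ 2)) :
    q ≤ 1 ∧ ∀ n : ℝ, 1 ≤ n → 0 ≤ (1 - q) * (n ^ 2 + α ^ 2) - 2 * α * n := by
  set t : ℝ := (2 : ℝ) ^ (-2 * α - 1) with ht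
  have ht0 : 0 < t := by positivity
  have ht1 : t ≤ 1 := Real.rpow_le_one_of_one_le_of_nonpos (by norm_num) (by linarith)
  have h1 : 0 < (1 - α) ^ 2 := by nlinarith
  have hc : 0 < t * (1 - α) ^ 2 := by positivity
  have hc1 : t * (1 - α) ^ 2 ≤ (1 - α) ^ 2 := by nlinarith
  have hd : 0 < 2 * α + t * (1 - α) ^ 2 := by positivity
  have h1q : 1 - q = 2 * α / (2 * α + t * (1 - α) ^ 2) := by
    rw [hq]; field_simp; ring
  refine ⟨?_, fun n hn => ?_⟩
  · have : 0 ≤ 1 - q := by rw [h1q]; positivity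
    linarith
  · have h2 : n * (2 * α + t * (1 - α) ^ 2) ≤ n ^ 2 + α ^ 2 := by
      have : n * (t * (1 - α) ^ 2) ≤ n * (1 - α) ^ 2 := by gcongr
      have h3 : n * (1 - α) ^ 2 ≤ (n - α) ^ 2 := by
        have : (n - α) ^ 2 - n * (1 - α) ^ 2 = (n - 1) * (n - α ^ 2) := by ring
        have h4 : 0 ≤ (n - 1) * (n - α ^ 2) := mul_nonneg (by linarith) (by nlinarith)
        linarith
      nlinarith
    have h5 : (1 - q) * (n ^ 2 + α ^ 2) - 2 * α * n =
        2 * α * ((n ^ 2 + α ^ 2) - n * (2 * α + t * (1 - α) ^ 2)) /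
          (2 * α + t * (1 - α) ^ 2) := by
      rw [h1q]; field_simp
    rw [h5]
    apply div_nonneg _ hd.le
    exact mul_nonneg (by linarith) (by linarith)

lemma pointwise_ineq (α : ℝ) (hα0 : 0 ≤ α) (hα1 : α < 1) (m : ℤ) (q : ℝ) (hq1 : q ≤ 1)
    (hq : ∀ n : ℝ, 1 ≤ n → 0 ≤ (1 - q) * (n ^ 2 + α ^ 2) - 2 * α * n) :
    ∃ κ : ℝ, ∀ r : ℝ, 0 < r → ∀ a b : ℂ,
      0 ≤ ‖b + (m : ℂ) * a / (r : ℂ)‖ ^ 2 * r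
        - q * ((‖b‖ ^ 2 + (m : ℝ) ^ 2 * (‖a‖ ^ 2 / r ^ 2)) * r)
        - κ * (2 * inner ℝ a b - 2 * α / (1 + r) * ‖a‖ ^ 2) := by
  have key : ∀ (c r : ℝ) (a b : ℂ), ‖b + (c / r : ℝ) • a‖ ^ 2 =
      ‖b‖ ^ 2 + 2 * (c / r) * inner ℝ a b + (c / r) ^ 2 * ‖a‖ ^ 2 := by
    intro c r a b
    rw [norm_add_sq_real, inner_smul_right, real_inner_comm, norm_smul, mul_pow, norm_eq_abs,
      sq_abs]
    ring
  have conv : ∀ (r : ℝ) (a b : ℂ), b + (m : ℂ) * a / (r : ℂ) = b + (((m : ℝ) / r : ℝ)) • a := by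
    intro r a b
    rw [Complex.real_smul]; push_cast; ring
  rcases le_or_gt 0 m with hm | hm
  · have hm' : (0 : ℝ) ≤ m := by exact_mod_cast hm
    refine ⟨m, fun r hr a b => ?_⟩
    rw [conv, key]
    have e : (‖b‖ ^ 2 + 2 * (m / r) * inner ℝ a b + (m / r) ^ 2 * ‖a‖ ^ 2) * r
        - q * ((‖b‖ ^ 2 + (m : ℝ) ^ 2 * (‖a‖ ^ 2 / r ^ 2)) * r)
        - m * (2 * inner ℝ a b - 2 * α / (1 + r) * ‖a‖ ^ 2)
        = (1 - q) * ((‖b‖ ^ 2 + (m : ℝ) ^ 2 * (‖a‖ ^ 2 / r ^ 2)) * r)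
          + m * (2 * α / (1 + r) * ‖a‖ ^ 2) := by
      field_simp; ring
    rw [e]
    have : 0 ≤ 1 - q := by linarith
    positivity
  · obtain ⟨n, hn⟩ : ∃ n : ℝ, n = -(m : ℝ) := ⟨_, rfl⟩
    have hn1 : 1 ≤ n := by
      have : m ≤ -1 := by omega
      have : (m : ℝ) ≤ -1 := by exact_mod_cast this
      linarith
    have hmn : (m : ℝ) = -n := by linarith
    refine ⟨-n + (1 - q) * α, fun r hr a b => ?_⟩
    rw [conv, key, hmn]
    have h0 := sq_nonneg ‖b + ((-α) / r : ℝ) • a‖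
    rw [key] at h0
    have e : (‖b‖ ^ 2 + 2 * (-n / r) * inner ℝ a b + (-n / r) ^ 2 * ‖a‖ ^ 2) * r
        - q * ((‖b‖ ^ 2 + (-n) ^ 2 * (‖a‖ ^ 2 / r ^ 2)) * r)
        - (-n + (1 - q) * α) * (2 * inner ℝ a b - 2 * α / (1 + r) * ‖a‖ ^ 2)
        = (1 - q) * r * (‖b‖ ^ 2 + 2 * (-α / r) * inner ℝ a b + (-α / r) ^ 2 * ‖a‖ ^ 2)
          + (1 - q) * (n ^ 2 - α ^ 2) * ‖a‖ ^ 2 * (1 / (r * (1 + r)))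
          + ((1 - q) * (n ^ 2 + α ^ 2) - 2 * α * n) * (‖a‖ ^ 2 / (1 + r)) := by
      field_simp; ring
    rw [e]
    have h1 : 0 ≤ 1 - q := by linarith
    have h2 : 0 ≤ n ^ 2 - α ^ 2 := by nlinarith
    have h3 := hq n hn1
    have t1 := mul_nonneg (mul_nonneg h1 hr.le) h0
    have t2 : 0 ≤ (1 - q) * (n ^ 2 - α ^ 2) * ‖a‖ ^ 2 * (1 / (r * (1 + r))) := by positivity
    have t3 : 0 ≤ ((1 - q) * (n ^ 2 + α ^ 2) - 2 * α * n) * (‖a‖ ^ 2 / (1 + r)) :=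
      mul_nonneg h3 (by positivity)
    linarith

lemma integrable_aux (K : Set ℝ) (hK : IsCompact K) (f : ℝ → ℝ) (hf : ContinuousOn f K)
    (h0 : ∀ r, r ∉ K → f r = 0) : Integrable f := by
  rw [← integrableOn_iff_integrable_of_support_subset (s := K)]
  · exact hf.integrableOn_compact hK
  · intro r hr
    by_contra h
    exact hr (h0 r h)

/-- Inequality (2.9) of the paper, case of the lower sign: for each angular mode `m ∈ ℤ`,
with weight `(1+r)^{-2α}`, `0 ≤ α < 1`, and constant `q_α`. -/
theorem weighted_mode_lower_bound_lower_sign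
    (α : ℝ) (hα0 : 0 ≤ α) (hα1 : α < 1) (m : ℤ)
    (φ : ℝ → ℂ) (hφ : ContDiff ℝ 1 φ) (hsupp : HasCompactSupport φ)
    (hsupp' : tsupport φ ⊆ Ioi 0) :
    ∫ r in Ioi (0:ℝ),
        (1 + r) ^ (-(2 * α)) * ‖deriv φ r + (m : ℂ) * φ r / (r : ℂ)‖ ^ 2 * r ≥
      (2 : ℝ) ^ (-2 * α - 1) * (1 - α) ^ 2 /
          (2 * α + (2 : ℝ) ^ (-2 * α - 1) * (1 - α) ^ 2) *
        ∫ r in Ioi (0:ℝ),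
          (1 + r) ^ (-(2 * α)) *
            (‖deriv φ r‖ ^ 2 + (m : ℝ) ^ 2 * (‖φ r‖ ^ 2 / r ^ 2)) * r := by
  obtain ⟨q, hq⟩ : ∃ q : ℝ, q = (2 : ℝ) ^ (-2 * α - 1) * (1 - α) ^ 2 /
          (2 * α + (2 : ℝ) ^ (-2 * α - 1) * (1 - α) ^ 2) := ⟨_, rfl⟩
  rw [← hq]
  obtain ⟨hq1, hq2⟩ := q_bounds α hα0 hα1 q hq
  obtain ⟨κ, hκ⟩ := pointwise_ineq α hα0 hα1 m q hq1 hq2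
  have hK : IsCompact (tsupport φ) := hsupp
  have hpos : ∀ r ∈ tsupport φ, 0 < r := fun r hr => hsupp' hr
  have hz : ∀ r, r ∉ tsupport φ → φ r = 0 := fun r hr => image_eq_zero_of_notMem_tsupport hr
  have hz' : ∀ r, r ∉ tsupport φ → deriv φ r = 0 := by
    intro r hr
    by_contra h
    exact hr (support_deriv_subset h)
  have c1 : ContinuousOn φ (tsupport φ) := hφ.continuous.continuousOn
  have c2 : ContinuousOn (deriv φ) (tsupport φ) := (hφ.continuous_deriv le_rfl).continuousOn
  have cw : ContinuousOn (fun r : ℝ => (1 + r) ^ (-(2 * α))) (tsupport φ) := by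
    apply ContinuousOn.rpow_const (by fun_prop)
    intro r hr
    left
    have := hpos r hr
    positivity
  have cd : ∀ r ∈ tsupport φ, (r : ℂ) ≠ 0 := fun r hr => by exact_mod_cast (hpos r hr).ne'
  have i1 : Integrable (fun r : ℝ =>
      (1 + r) ^ (-(2 * α)) * ‖deriv φ r + (m : ℂ) * φ r / (r : ℂ)‖ ^ 2 * r) := by
    apply integrable_aux _ hK
    · have : ContinuousOn (fun r : ℝ => (m : ℂ) * φ r / (r : ℂ)) (tsupport φ) :=
        (continuousOn_const.mul c1).div (by fun_prop) cd
      exact (cw.mul ((c2.add this).norm.pow 2)).mul continuousOn_id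
    · intro r hr
      simp [hz r hr, hz' r hr]
  have i2 : Integrable (fun r : ℝ => (1 + r) ^ (-(2 * α)) *
            (‖deriv φ r‖ ^ 2 + (m : ℝ) ^ 2 * (‖φ r‖ ^ 2 / r ^ 2)) * r) := by
    apply integrable_aux _ hK
    · have : ContinuousOn (fun r : ℝ => ‖φ r‖ ^ 2 / r ^ 2) (tsupport φ) :=
        (c1.norm.pow 2).div (by fun_prop) (fun r hr => by have := hpos r hr; positivity)
      exact (cw.mul ((c2.norm.pow 2).add (continuousOn_const.mul this))).mul continuousOn_id
    · intro r hr
      simp [hz r hr, hz' r hr]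
  have i3 : Integrable (fun r : ℝ => (1 + r) ^ (-(2 * α)) *
      (2 * inner ℝ (φ r) (deriv φ r) - 2 * α / (1 + r) * ‖φ r‖ ^ 2)) := by
    apply integrable_aux _ hK
    · have : ContinuousOn (fun r : ℝ => 2 * α / (1 + r)) (tsupport φ) :=
        continuousOn_const.div (by fun_prop) (fun r hr => by have := hpos r hr; positivity)
      exact cw.mul ((continuousOn_const.mul (c1.inner c2)).sub (this.mul (c1.norm.pow 2)))
    · intro r hr
      simp [hz r hr, hz' r hr]
  have I0 : ∫ r in Ioi (0:ℝ), (1 + r) ^ (-(2 * α)) *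
      (2 * inner ℝ (φ r) (deriv φ r) - 2 * α / (1 + r) * ‖φ r‖ ^ 2) = 0 := by
    have h0 : φ 0 = 0 := hz 0 (fun h => lt_irrefl _ (hpos 0 h))
    have := integral_Ioi_of_hasDerivAt_of_tendsto (a := 0) (m := (0 : ℝ))
      (f := fun r : ℝ => (1 + r) ^ (-(2 * α)) * ‖φ r‖ ^ 2) (f' := fun r : ℝ => (1 + r) ^ (-(2 * α)) *
      (2 * inner ℝ (φ r) (deriv φ r) - 2 * α / (1 + r) * ‖φ r‖ ^ 2)) ?_ ?_ i3.integrableOn ?_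
    · rw [this]; simp [h0]
    · apply ContinuousAt.continuousWithinAt
      apply ContinuousAt.mul
      · apply ContinuousAt.rpow_const (by fun_prop)
        left; norm_num
      · exact (hφ.continuous.norm.pow 2).continuousAt
    · intro r hr
      have hr' : (0 : ℝ) < 1 + r := by have : 0 < r := hr; linarith
      have d1 : HasDerivAt φ (deriv φ r) r :=
        (hφ.differentiable one_ne_zero r).hasDerivAt
      have d2 := d1.norm_sq
      have d3 : HasDerivAt (fun r : ℝ => (1 + r) ^ (-(2 * α))) _ r :=
        ((hasDerivAt_id r).const_add 1).rpow_const (p := -(2 * α)) (Or.inl hr'.ne')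
      refine (d3.mul d2).congr_deriv ?_
      simp only [id]
      rw [Real.rpow_sub_one hr'.ne']
      field_simp
      ring
    · apply tendsto_const_nhds.congr'
      obtain ⟨R, hR⟩ := hK.bddAbove
      filter_upwards [Filter.eventually_gt_atTop R] with r hr
      simp [hz r (fun h => absurd (hR h) (not_le.mpr hr))]
  have main : 0 ≤ ∫ r in Ioi (0:ℝ),
      ((1 + r) ^ (-(2 * α)) * ‖deriv φ r + (m : ℂ) * φ r / (r : ℂ)‖ ^ 2 * r
      - q * ((1 + r) ^ (-(2 * α)) *
            (‖deriv φ r‖ ^ 2 + (m : ℝ) ^ 2 * (‖φ r‖ ^ 2 / r ^ 2)) * r)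
      - κ * ((1 + r) ^ (-(2 * α)) *
      (2 * inner ℝ (φ r) (deriv φ r) - 2 * α / (1 + r) * ‖φ r‖ ^ 2))) := by
    apply setIntegral_nonneg measurableSet_Ioi
    intro r hr
    have hr' : 0 < r := hr
    have := mul_nonneg (show (0 : ℝ) ≤ (1 + r) ^ (-(2 * α)) by positivity)
      (hκ r hr' (φ r) (deriv φ r))
    linarith
  have e1 := integral_sub (i1.sub (i2.const_mul q)).integrableOn
    (i3.const_mul κ).integrableOn (μ := volume.restrict (Ioi (0:ℝ)))
  simp only [Pi.sub_apply] at e1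
  rw [e1, integral_sub i1.integrableOn (i2.const_mul q).integrableOn, integral_const_mul,
    integral_const_mul, I0] at main
  linarith
end

section
/- Let α ≥ 0, let m ≥ 0 be an integer, and let φ : (0,∞) → ℂ be continuously differentiable with compact support. Then ∫₀^∞ (1+r)^{2α} |φ'(r) - m φ(r)/r|² r dr ≥ ∫₀^∞ (1+r)^{2α} ( |φ'(r)|² + m² r^{-2} |φ(r)|² ) r dr, and likewise ∫₀^∞ (1+r)^{-2α} |φ'(r) + m φ(r)/r|² r dr ≥ ∫₀^∞ (1+r)^{-2α} ( |φ'(r)|² + m² r^{-2} |φ(r)|² ) r dr. -/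
open MeasureTheory Real Set

lemma weighted_aux (β c : ℝ) (hc : c * β ≤ 0)
    (φ : ℝ → ℂ) (hφ : ContDiff ℝ 1 φ) (hsupp : HasCompactSupport φ)
    (hsupp' : tsupport φ ⊆ Ioi 0) :
    ∫ r in Ioi (0:ℝ), (1 + r) ^ β * (‖deriv φ r‖ ^ 2 + c ^ 2 * (‖φ r‖ ^ 2 / r ^ 2)) * r ≤
      ∫ r in Ioi (0:ℝ), (1 + r) ^ β * ‖deriv φ r + (c : ℂ) * φ r / (r : ℂ)‖ ^ 2 * r := by
  have hK : MeasurableSet (tsupport φ) := hsupp.isCompact.measurableSet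
  have z1 : ∀ r, r ∉ tsupport φ → φ r = 0 := fun r hr => image_eq_zero_of_notMem_tsupport hr
  have z2 : ∀ r, r ∉ tsupport φ → deriv φ r = 0 := fun r hr => by
    by_contra h
    exact hr (support_deriv_subset h)
  have hcφ : Continuous φ := hφ.continuous
  have hcd : Continuous (deriv φ) := hφ.continuous_deriv le_rfl
  have hInteg : ∀ F : ℝ → ℝ, ContinuousOn F (Ioi 0) → (∀ r, r ∉ tsupport φ → F r = 0) →
      IntegrableOn F (Ioi 0) := by
    intro F hF h0
    have h1 : IntegrableOn F (tsupport φ) :=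
      (hF.mono hsupp').integrableOn_compact hsupp.isCompact
    exact h1.of_forall_sdiff_eq_zero measurableSet_Ioi (fun x hx => h0 x hx.2)
  have hpow : ∀ γ : ℝ, ContinuousOn (fun r : ℝ => (1 + r) ^ γ) (Ioi 0) := by
    intro γ
    refine ContinuousOn.rpow_const (by fun_prop) ?_
    intro r hr
    left
    have : (0:ℝ) < r := hr
    positivity
  have hne : ∀ r ∈ Ioi (0:ℝ), r ≠ 0 := fun r hr => ne_of_gt hr
  have hneC : ∀ r ∈ Ioi (0:ℝ), (r : ℂ) ≠ 0 := fun r hr => by exact_mod_cast hne r hr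
  set G : ℝ → ℝ := fun r => (1 + r) ^ β * (‖deriv φ r‖ ^ 2 + c ^ 2 * (‖φ r‖ ^ 2 / r ^ 2)) * r
    with hG
  set F : ℝ → ℝ := fun r => (1 + r) ^ β * ‖deriv φ r + (c : ℂ) * φ r / (r : ℂ)‖ ^ 2 * r with hF
  set g : ℝ → ℝ := fun r => (1 + r) ^ β * ‖φ r‖ ^ 2 with hg
  set g' : ℝ → ℝ := fun r => (β * (1 + r) ^ (β - 1)) * ‖φ r‖ ^ 2 +
    (1 + r) ^ β * (2 * inner ℝ (φ r) (deriv φ r)) with hg'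
  have iG : IntegrableOn G (Ioi 0) := by
    refine hInteg G ?_ ?_
    · refine ((hpow β).mul ?_).mul continuousOn_id
      refine ContinuousOn.add (by fun_prop) (continuousOn_const.mul ?_)
      refine ContinuousOn.div (by fun_prop) (by fun_prop) ?_
      intro r hr
      exact pow_ne_zero 2 (hne r hr)
    · intro r hr
      simp [hG, z1 r hr, z2 r hr]
  have iF : IntegrableOn F (Ioi 0) := by
    refine hInteg F ?_ ?_
    · refine ((hpow β).mul ?_).mul continuousOn_id
      refine (ContinuousOn.norm ?_).pow 2
      refine ContinuousOn.add (by fun_prop) ?_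
      exact ContinuousOn.div (by fun_prop) (by fun_prop) hneC
    · intro r hr
      simp [hF, z1 r hr, z2 r hr]
  have ig' : IntegrableOn g' (Ioi 0) := by
    refine hInteg g' ?_ ?_
    · refine ContinuousOn.add ?_ ?_
      · exact (continuousOn_const.mul (hpow _)).mul (by fun_prop)
      · exact (hpow β).mul (by fun_prop)
    · intro r hr
      simp [hg', z1 r hr, z2 r hr]
  have hder : ∀ r ∈ Ioi (0:ℝ), HasDerivAt g (g' r) r := by
    intro r hr
    have hr0 : (0:ℝ) < r := hr
    have h1 : HasDerivAt (fun r : ℝ => (1 + r) ^ β) (β * (1 + r) ^ (β - 1)) r := by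
      have := ((hasDerivAt_id r).const_add 1).rpow_const (p := β)
        (Or.inl (by simp only [id]; positivity))
      simpa using this
    have h2 : HasDerivAt φ (deriv φ r) r :=
      (hφ.differentiable one_ne_zero r).hasDerivAt
    exact h1.mul h2.norm_sq
  have hcont : ContinuousWithinAt g (Ici 0) 0 := by
    refine ContinuousAt.continuousWithinAt ?_
    refine ContinuousAt.mul ?_ (by fun_prop)
    exact ContinuousAt.rpow_const (by fun_prop) (by simp)
  have hg0 : g 0 = 0 := by
    have : (0:ℝ) ∉ tsupport φ := fun h => lt_irrefl (0:ℝ) (mem_Ioi.mp (hsupp' h))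
    simp [hg, z1 0 this]
  have hlim : Filter.Tendsto g Filter.atTop (nhds 0) := by
    refine tendsto_const_nhds.congr' ?_
    obtain ⟨b, hb⟩ := hsupp.isCompact.bddAbove
    filter_upwards [Filter.eventually_gt_atTop b] with r hr
    have : r ∉ tsupport φ := fun h => absurd (hb h) (not_le.mpr hr)
    simp [hg, z1 r this]
  have hftc : ∫ r in Ioi (0:ℝ), g' r = 0 := by
    rw [integral_Ioi_of_hasDerivAt_of_tendsto hcont hder ig' hlim, hg0, sub_zero]
  have hsum : ∫ r in Ioi (0:ℝ), (G r + c * g' r) = ∫ r in Ioi (0:ℝ), G r := by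
    rw [integral_add iG (ig'.const_mul c), integral_const_mul, hftc]
    simp
  rw [← hsum]
  refine setIntegral_mono_on (iG.add (ig'.const_mul c)) iF measurableSet_Ioi ?_
  intro r hr
  have hr0 : (0:ℝ) < r := hr
  have key : ‖deriv φ r + (c : ℂ) * φ r / (r : ℂ)‖ ^ 2 =
      ‖deriv φ r‖ ^ 2 + c ^ 2 * (‖φ r‖ ^ 2 / r ^ 2)
        + 2 * (c / r) * inner ℝ (φ r) (deriv φ r) := by
    have e : (c : ℂ) * φ r / (r : ℂ) = (c / r) • φ r := by
      rw [Complex.real_smul]; push_cast; ring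
    rw [e, norm_add_sq_real, inner_smul_right, norm_smul, real_inner_comm, mul_pow,
      Real.norm_eq_abs, sq_abs]
    ring
  have hFG : F r = G r + c * g' r - (c * β) * ((1 + r) ^ (β - 1) * ‖φ r‖ ^ 2) := by
    simp only [hF, hG, hg']
    rw [key]
    field_simp
    ring
  have hnn : 0 ≤ (1 + r) ^ (β - 1) * ‖φ r‖ ^ 2 := by positivity
  change G r + c * g' r ≤ F r
  rw [hFG]
  nlinarith [mul_nonneg (neg_nonneg.mpr hc) hnn]

/-- For nonnegative angular modes `m ≥ 0` the weighted mode inequalities hold with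
constant `1`, for any `α ≥ 0`. -/
theorem weighted_mode_lower_bound_nonneg_m
    (α : ℝ) (hα : 0 ≤ α) (m : ℤ) (hm : 0 ≤ m)
    (φ : ℝ → ℂ) (hφ : ContDiff ℝ 1 φ) (hsupp : HasCompactSupport φ)
    (hsupp' : tsupport φ ⊆ Ioi 0) :
    (∫ r in Ioi (0:ℝ),
        (1 + r) ^ (2 * α) * ‖deriv φ r - (m : ℂ) * φ r / (r : ℂ)‖ ^ 2 * r ≥
      ∫ r in Ioi (0:ℝ),
        (1 + r) ^ (2 * α) *
          (‖deriv φ r‖ ^ 2 + (m : ℝ) ^ 2 * (‖φ r‖ ^ 2 / r ^ 2)) * r) ∧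
    (∫ r in Ioi (0:ℝ),
        (1 + r) ^ (-(2 * α)) * ‖deriv φ r + (m : ℂ) * φ r / (r : ℂ)‖ ^ 2 * r ≥
      ∫ r in Ioi (0:ℝ),
        (1 + r) ^ (-(2 * α)) *
          (‖deriv φ r‖ ^ 2 + (m : ℝ) ^ 2 * (‖φ r‖ ^ 2 / r ^ 2)) * r) := by
  have hm' : (0:ℝ) ≤ m := by exact_mod_cast hm
  constructor
  · have h := weighted_aux (2 * α) (-(m:ℝ)) (by nlinarith [mul_nonneg hm' hα]) φ hφ hsupp hsupp'
    simp only [neg_sq, Complex.ofReal_neg, Complex.ofReal_intCast, neg_mul, neg_div,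
      ← sub_eq_add_neg] at h
    exact h
  · have h := weighted_aux (-(2 * α)) (m:ℝ) (by nlinarith [mul_nonneg hm' hα]) φ hφ hsupp hsupp'
    simp only [Complex.ofReal_intCast] at h
    exact h
end
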